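/- (Theorem B) Let Z be a finite nonempty set of points in the complex projective plane ℙ² and let I be its radical homogeneous ideal. Assume that for some integer m ≥ 1 one has α(I^(m+k)) = α(I^(m)) + 2k for k = 1, 2, 3, 4. Then Z is contained in a conic. -/

import Mathlib

open scoped LinearAlgebra.Projectivization

/-- A polynomial `F` vanishes to order at least `m` at the (affine representative) point
`v`: all iterated partial derivatives of order `≤ m - 1` (i.e. of order `< m`) vanish at `v`. -/
def VanishesToOrder (m : ℕ) (F : MvPolynomial (Fin 3) ℂ) (v : Fin 3 → ℂ) : Prop :=
  ∀ k : ℕ, k < m → ∀ d : Fin k → Fin 3,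
    MvPolynomial.eval v ((List.ofFn d).foldl (fun p i => MvPolynomial.pderiv i p) F) = 0

/-- The `m`-th symbolic power of the (radical) ideal of a set `Z` of points of `ℙ²`:
all polynomials vanishing to order at least `m` at every point of `Z`. -/
def symbolicPower (Z : Set (ℙ ℂ (Fin 3 → ℂ))) (m : ℕ) : Set (MvPolynomial (Fin 3) ℂ) :=
  {F | ∀ P ∈ Z, ∀ (v : Fin 3 → ℂ) (hv : v ≠ 0),
    Projectivization.mk ℂ v hv = P → VanishesToOrder m F v}

/-- The initial degree `α` of a set of polynomials: the least `t` such that the set contains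
a nonzero homogeneous polynomial of degree `t`. -/
noncomputable def initialDegree (S : Set (MvPolynomial (Fin 3) ℂ)) : ℕ :=
  sInf {t | ∃ F ∈ S, F ≠ 0 ∧ F.IsHomogeneous t}

/-- The Waldschmidt constant `α̂(I) = inf_{m ≥ 1} α(I^(m))/m` of the radical ideal of `Z`. -/
noncomputable def waldschmidt (Z : Set (ℙ ℂ (Fin 3 → ℂ))) : ℝ :=
  ⨅ m : ℕ+, (initialDegree (symbolicPower Z (m : ℕ)) : ℝ) / ((m : ℕ) : ℝ)

/-- A (homogeneous equation of a) line in `ℙ²`: a nonzero homogeneous polynomial of degree 1. -/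
def IsLine (L : MvPolynomial (Fin 3) ℂ) : Prop := L ≠ 0 ∧ L.IsHomogeneous 1

/-- The point `x ∈ ℙ²` lies on the line (or curve) with equation `L`. -/
def MemLine (L : MvPolynomial (Fin 3) ℂ) (x : ℙ ℂ (Fin 3 → ℂ)) : Prop :=
  ∀ (v : Fin 3 → ℂ) (hv : v ≠ 0), Projectivization.mk ℂ v hv = x → MvPolynomial.eval v L = 0

/-- Three points of `ℙ²` are collinear if some line contains all of them. -/
def Collin (x y z : ℙ ℂ (Fin 3 → ℂ)) : Prop :=
  ∃ M, IsLine M ∧ MemLine M x ∧ MemLine M y ∧ MemLine M z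

/-- `Z` is contained in a conic: the zero set of a nonzero homogeneous polynomial of degree 2
(possibly degenerate). -/
def ContainedInConic (Z : Set (ℙ ℂ (Fin 3 → ℂ))) : Prop :=
  ∃ F : MvPolynomial (Fin 3) ℂ, F ≠ 0 ∧ F.IsHomogeneous 2 ∧ ∀ x ∈ Z, MemLine F x

namespace PlaneCurve

open MvPolynomial

/-- The polynomial `F (X + v)`. -/
noncomputable def translate (v : Fin 3 → ℂ) :
    MvPolynomial (Fin 3) ℂ →ₐ[ℂ] MvPolynomial (Fin 3) ℂ :=
  aeval (fun i => X i + C (v i))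

@[simp] lemma translate_X (v : Fin 3 → ℂ) (i : Fin 3) : translate v (X i) = X i + C (v i) := by
  simp [translate]

@[simp] lemma translate_C (v : Fin 3 → ℂ) (a : ℂ) : translate v (C a) = C a := by
  simp [translate, algebraMap_eq]

lemma translate_injective (v : Fin 3 → ℂ) : Function.Injective (translate v) := by
  have h : (translate (-v)).comp (translate v) = AlgHom.id ℂ _ := by
    ext i : 1
    simp [add_assoc]
  intro F G hFG
  simpa using (DFunLike.congr_fun h F).symm.trans
    ((congrArg (translate (-v)) hFG).trans (DFunLike.congr_fun h G))

lemma translate_ne_zero (v : Fin 3 → ℂ) {F : MvPolynomial (Fin 3) ℂ} (hF : F ≠ 0) :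
    translate v F ≠ 0 := fun h => hF (translate_injective v (by simpa using h))

lemma constantCoeff_translate (v : Fin 3 → ℂ) (F : MvPolynomial (Fin 3) ℂ) :
    coeff 0 (translate v F) = eval v F := by
  have h : (constantCoeff (σ := Fin 3) (R := ℂ)).comp (translate v).toRingHom = eval v := by
    ext i <;> simp
  exact DFunLike.congr_fun h F

lemma pderiv_translate (v : Fin 3 → ℂ) (i : Fin 3) (F : MvPolynomial (Fin 3) ℂ) :
    pderiv i (translate v F) = translate v (pderiv i F) := by
  induction F using MvPolynomial.induction_on with
  | C a => simp
  | add p q hp hq => simp [hp, hq]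
  | mul_X p j hp =>
    rw [map_mul, pderiv_mul, hp, pderiv_mul, map_add, map_mul, map_mul, translate_X, map_add,
      pderiv_X, pderiv_C, add_zero]
    by_cases hij : j = i <;> simp [hij]

/-- `F` vanishes to order at least `k` at `v`: the Taylor coefficients at `v` of degree less than
`k` are zero. -/
def OrderGE (v : Fin 3 → ℂ) (k : ℕ) (F : MvPolynomial (Fin 3) ℂ) : Prop :=
  ∀ μ : Fin 3 →₀ ℕ, μ.degree < k → coeff μ (translate v F) = 0

/-- The multiplicity of `F` at a point of the plane. -/
noncomputable def mult (P : ℙ ℂ (Fin 3 → ℂ)) (F : MvPolynomial (Fin 3) ℂ) : ℕ :=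
  (MvPowerSeries.order (translate P.rep F : MvPowerSeries (Fin 3) ℂ)).toNat

lemma coe_mult (P : ℙ ℂ (Fin 3 → ℂ)) {F : MvPolynomial (Fin 3) ℂ} (hF : F ≠ 0) :
    (mult P F : ℕ∞) = MvPowerSeries.order (translate P.rep F : MvPowerSeries (Fin 3) ℂ) := by
  refine MvPowerSeries.ne_zero_iff_order_finite.mp ?_
  simpa using translate_ne_zero P.rep hF

lemma le_mult_iff {P : ℙ ℂ (Fin 3 → ℂ)} {F : MvPolynomial (Fin 3) ℂ} (hF : F ≠ 0) {k : ℕ} :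
    k ≤ mult P F ↔ OrderGE P.rep k F := by
  rw [← Nat.cast_le (α := ℕ∞), coe_mult P hF]
  constructor
  · intro h μ hμ
    rw [← coeff_coe]
    exact MvPowerSeries.coeff_of_lt_order (lt_of_lt_of_le (by exact_mod_cast hμ) h)
  · intro h
    exact MvPowerSeries.nat_le_order fun d hd => by rw [coeff_coe]; exact h d hd

lemma mult_mul (P : ℙ ℂ (Fin 3 → ℂ)) {F G : MvPolynomial (Fin 3) ℂ} (hF : F ≠ 0) (hG : G ≠ 0) :
    mult P (F * G) = mult P F + mult P G := by
  have h : (mult P (F * G) : ℕ∞) = mult P F + mult P G := by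
    rw [coe_mult P (mul_ne_zero hF hG), coe_mult P hF, coe_mult P hG, map_mul, coe_mul,
      MvPowerSeries.order_mul]
  exact_mod_cast h

lemma one_le_mult_iff {P : ℙ ℂ (Fin 3 → ℂ)} {F : MvPolynomial (Fin 3) ℂ} (hF : F ≠ 0) :
    1 ≤ mult P F ↔ eval P.rep F = 0 := by
  rw [le_mult_iff hF, ← constantCoeff_translate]
  constructor
  · intro h
    exact h 0 (by simp)
  · intro h μ hμ
    have : μ = 0 := by rw [← Finsupp.degree_eq_zero_iff]; omega
    rw [this, h]

@[simp] lemma mult_C (P : ℙ ℂ (Fin 3 → ℂ)) (a : ℂ) : mult P (C a) = 0 := by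
  by_cases ha : a = 0
  · simp [ha, mult]
  · by_contra h
    have h1 : 1 ≤ mult P (C a) := by omega
    rw [one_le_mult_iff (by simpa using ha)] at h1
    exact ha (by simpa using h1)

@[simp] lemma mult_one (P : ℙ ℂ (Fin 3 → ℂ)) : mult P 1 = 0 := by
  simpa using mult_C P 1

lemma mult_pow (P : ℙ ℂ (Fin 3 → ℂ)) {F : MvPolynomial (Fin 3) ℂ} (hF : F ≠ 0) (n : ℕ) :
    mult P (F ^ n) = n * mult P F := by
  induction n with
  | zero => simp
  | succ n ih => rw [pow_succ, mult_mul P (pow_ne_zero n hF) hF, ih]; ring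

lemma mult_prod (P : ℙ ℂ (Fin 3 → ℂ)) {ι : Type*} (s : Finset ι)
    (f : ι → MvPolynomial (Fin 3) ℂ) (hf : ∀ i ∈ s, f i ≠ 0) :
    mult P (∏ i ∈ s, f i) = ∑ i ∈ s, mult P (f i) := by
  classical
  induction s using Finset.induction_on with
  | empty => simp
  | insert a s ha ih =>
    rw [Finset.prod_insert ha, Finset.sum_insert ha, mult_mul P (hf a (by simp))
      (Finset.prod_ne_zero_iff.mpr fun i hi => hf i (by simp [hi])),
      ih fun i hi => hf i (by simp [hi])]

lemma mult_mono_of_dvd (P : ℙ ℂ (Fin 3 → ℂ)) {F G : MvPolynomial (Fin 3) ℂ} (h : F ∣ G)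
    (hG : G ≠ 0) : mult P F ≤ mult P G := by
  obtain ⟨H, rfl⟩ := h
  rw [mult_mul P (left_ne_zero_of_mul hG) (right_ne_zero_of_mul hG)]
  omega

lemma mult_pderiv (P : ℙ ℂ (Fin 3 → ℂ)) {F : MvPolynomial (Fin 3) ℂ} (i : Fin 3)
    (h : pderiv i F ≠ 0) : mult P F - 1 ≤ mult P (pderiv i F) := by
  have hF : F ≠ 0 := by rintro rfl; simp at h
  rw [le_mult_iff h]
  intro μ hμ
  rw [← pderiv_translate, coeff_pderiv, (le_mult_iff hF).mp le_rfl _ ?_, zero_mul]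
  rw [map_add, Finsupp.degree_single]
  omega

lemma sum_coeff_add_single_eq_zero {v : Fin 3 → ℂ} {k d : ℕ} {F : MvPolynomial (Fin 3) ℂ}
    (hF : F.IsHomogeneous d) (hk : OrderGE v k F) (ν : Fin 3 →₀ ℕ) (hν : ν.degree < k) :
    ∑ j, v j * (coeff (ν + Finsupp.single j 1) (translate v F) * (ν j + 1)) = 0 := by
  have h := congrArg (fun p => coeff ν (translate v p)) hF.sum_X_mul_pderiv
  simp only [map_sum, map_mul, translate_X, map_nsmul, coeff_sum, add_mul, coeff_add, coeff_C_mul,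
    ← pderiv_translate, coeff_smul, hk ν hν, smul_zero, Finset.sum_add_distrib] at h
  have h0 : ∀ j : Fin 3, coeff ν (X j * pderiv j (translate v F)) = 0 := by
    intro j
    rw [coeff_X_mul']
    split_ifs with hj
    · rw [coeff_pderiv, tsub_add_cancel_of_le, hk ν hν, zero_mul]
      rw [Finsupp.single_le_iff]
      exact Nat.one_le_iff_ne_zero.mpr (Finsupp.mem_support_iff.mp hj)
    · rfl
  simp only [h0, Finset.sum_const_zero, zero_add, coeff_pderiv] at h
  exact h

lemma OrderGE.succ_of_coeff_eq_zero {v : Fin 3 → ℂ} {k d : ℕ} {F : MvPolynomial (Fin 3) ℂ}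
    (hF : F.IsHomogeneous d) (hk : OrderGE v k F) {i : Fin 3} (hi : v i ≠ 0)
    (h0 : ∀ μ : Fin 3 →₀ ℕ, μ.degree = k → μ i = 0 → coeff μ (translate v F) = 0) :
    OrderGE v (k + 1) F := by
  have key : ∀ n : ℕ, ∀ μ : Fin 3 →₀ ℕ, μ.degree = k → μ i = n →
      coeff μ (translate v F) = 0 := by
    intro n
    induction n with
    | zero => exact h0
    | succ n ih =>
      intro μ hμ hn
      have hle : Finsupp.single i 1 ≤ μ := by rw [Finsupp.single_le_iff]; omega
      obtain ⟨ν, rfl⟩ := exists_add_of_le hle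
      rw [add_comm] at hμ hn ⊢
      have hνd : ν.degree + 1 = k := by simpa using hμ
      have hνi : ν i = n := by simpa using hn
      have hs := sum_coeff_add_single_eq_zero hF hk ν (by omega)
      rw [Finset.sum_eq_single i] at hs
      · rcases mul_eq_zero.mp hs with h | h
        · exact absurd h hi
        · rcases mul_eq_zero.mp h with h | h
          · exact h
          · exact absurd h (by exact_mod_cast Nat.succ_ne_zero (ν i))
      · intro j _ hj
        rw [ih (ν + Finsupp.single j 1) (by simpa using hνd)
          (by simp [hνi, hj])]
        simp
      · simp
  intro μ hμ
  rcases Nat.lt_succ_iff_lt_or_eq.mp hμ with h | h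
  · exact hk μ h
  · exact key _ μ h rfl

/-- The forms of degree `d` vanishing to order at least `g P` at every point `P` of `Z`. -/
noncomputable def forms (Z : Finset (ℙ ℂ (Fin 3 → ℂ))) (g : ℙ ℂ (Fin 3 → ℂ) → ℕ) (d : ℕ) :
    Submodule ℂ (MvPolynomial (Fin 3) ℂ) where
  carrier := {F | F.IsHomogeneous d ∧ ∀ P ∈ Z, OrderGE P.rep (g P) F}
  zero_mem' := ⟨isHomogeneous_zero _ _ _, fun P _ μ _ => by simp⟩
  add_mem' := fun ha hb => ⟨ha.1.add hb.1, fun P hP μ hμ => by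
    rw [map_add, coeff_add, ha.2 P hP μ hμ, hb.2 P hP μ hμ, add_zero]⟩
  smul_mem' := fun c F h => ⟨(homogeneousSubmodule (Fin 3) ℂ d).smul_mem c h.1,
    fun P hP μ hμ => by rw [map_smul, coeff_smul, h.2 P hP μ hμ, smul_zero]⟩

lemma mem_forms {Z : Finset (ℙ ℂ (Fin 3 → ℂ))} {g : ℙ ℂ (Fin 3 → ℂ) → ℕ} {d : ℕ}
    {F : MvPolynomial (Fin 3) ℂ} :
    F ∈ forms Z g d ↔ F.IsHomogeneous d ∧ ∀ P ∈ Z, OrderGE P.rep (g P) F := Iff.rfl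

lemma mem_forms_iff {Z : Finset (ℙ ℂ (Fin 3 → ℂ))} {g : ℙ ℂ (Fin 3 → ℂ) → ℕ} {d : ℕ}
    {F : MvPolynomial (Fin 3) ℂ} (hF : F ≠ 0) :
    F ∈ forms Z g d ↔ F.IsHomogeneous d ∧ ∀ P ∈ Z, g P ≤ mult P F := by
  simp only [mem_forms, le_mult_iff hF]

instance (d : ℕ) : Module.Finite ℂ (homogeneousSubmodule (Fin 3) ℂ d) :=
  Module.Finite.iff_fg.mpr (homogeneousSubmodule_fg _ _ _)

lemma forms_le (Z : Finset (ℙ ℂ (Fin 3 → ℂ))) (g : ℙ ℂ (Fin 3 → ℂ) → ℕ) (d : ℕ) :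
    forms Z g d ≤ homogeneousSubmodule (Fin 3) ℂ d := fun _ h => h.1

instance (Z : Finset (ℙ ℂ (Fin 3 → ℂ))) (g : ℙ ℂ (Fin 3 → ℂ) → ℕ) (d : ℕ) :
    Module.Finite ℂ (forms Z g d) :=
  Submodule.finiteDimensional_of_le (forms_le Z g d)

lemma finrank_homogeneousSubmodule (d : ℕ) :
    2 * Module.finrank ℂ (homogeneousSubmodule (Fin 3) ℂ d) = (d + 1) * (d + 2) := by
  classical
  have hset : {μ : Fin 3 →₀ ℕ | μ.degree = d} =
      ((Finset.finsuppAntidiag (Finset.univ : Finset (Fin 3)) d : Finset _) : Set _) := by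
    ext μ
    simp [Finset.mem_finsuppAntidiag, Finsupp.degree_eq_sum]
  have h : Module.finrank ℂ (homogeneousSubmodule (Fin 3) ℂ d) =
      (Finset.finsuppAntidiag (Finset.univ : Finset (Fin 3)) d).card := by
    rw [homogeneousSubmodule_eq_finsupp_supported, hset]
    rw [(AddMonoidAlgebra.supportedEquivFinsupp _).finrank_eq, Module.finrank_finsupp_self]
    simp
  rw [h, Finset.card_finsuppAntidiag_nat_eq_choose]
  rw [Finset.card_univ, Fintype.card_fin, show 3 + d - 1 = d + 2 by omega, Nat.choose_symm_add,
    Nat.choose_two_right, Nat.mul_div_cancel' (Nat.even_mul_pred_self (d + 2)).two_dvd]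
  rw [show d + 2 - 1 = d + 1 by omega]
  ring

/-- The two coordinates other than `i` give the monomial of degree `k` with exponent `r` in the
first one. -/
noncomputable def sideMonomial (i : Fin 3) (k r : ℕ) : Fin 3 →₀ ℕ :=
  Finsupp.single (i.succAbove 0) r + Finsupp.single (i.succAbove 1) (k - r)

lemma eq_sideMonomial {i : Fin 3} {k : ℕ} {μ : Fin 3 →₀ ℕ} (hμ : μ.degree = k) (hi : μ i = 0) :
    μ (i.succAbove 0) < k + 1 ∧ μ = sideMonomial i k (μ (i.succAbove 0)) := by
  rw [Finsupp.degree_eq_sum, Fin.sum_univ_succAbove _ i, Fin.sum_univ_two, hi] at hμ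
  refine ⟨by omega, ?_⟩
  ext j
  rcases Fin.eq_self_or_eq_succAbove i j with rfl | ⟨l, rfl⟩
  · simp [sideMonomial, hi]
  · fin_cases l
    · simp [sideMonomial]
    · simp [sideMonomial]
      omega

/-- The coefficients of degree `k`, free of the coordinate `i`, of the expansion at `v`. -/
noncomputable def jet (v : Fin 3 → ℂ) (i : Fin 3) (k : ℕ) :
    MvPolynomial (Fin 3) ℂ →ₗ[ℂ] (Fin (k + 1) → ℂ) :=
  LinearMap.pi fun r => lcoeff ℂ (sideMonomial i k r) ∘ₗ (translate v).toLinearMap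

lemma jet_apply (v : Fin 3 → ℂ) (i : Fin 3) (k : ℕ) (F : MvPolynomial (Fin 3) ℂ)
    (r : Fin (k + 1)) : jet v i k F r = coeff (sideMonomial i k r) (translate v F) := rfl

lemma exists_rep_ne_zero (P : ℙ ℂ (Fin 3 → ℂ)) : ∃ i, P.rep i ≠ 0 :=
  Function.ne_iff.mp P.rep_nonzero

lemma ker_jet_inf_forms [DecidableEq (ℙ ℂ (Fin 3 → ℂ))] {Z : Finset (ℙ ℂ (Fin 3 → ℂ))}
    {g : ℙ ℂ (Fin 3 → ℂ) → ℕ} {d : ℕ}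
    {P : ℙ ℂ (Fin 3 → ℂ)} (hP : P ∈ Z) {i : Fin 3} (hi : P.rep i ≠ 0) :
    forms Z g d ⊓ LinearMap.ker (jet P.rep i (g P)) =
      forms Z (Function.update g P (g P + 1)) d := by
  ext F
  simp only [Submodule.mem_inf, mem_forms, LinearMap.mem_ker]
  constructor
  · rintro ⟨⟨hd, hF⟩, hj⟩
    refine ⟨hd, fun Q hQ => ?_⟩
    by_cases h : Q = P
    · subst h
      rw [Function.update_self]
      refine (hF Q hQ).succ_of_coeff_eq_zero hd hi fun μ hμ hμi => ?_
      obtain ⟨hr, hμ'⟩ := eq_sideMonomial hμ hμi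
      have := congrFun hj ⟨_, hr⟩
      rw [jet_apply] at this
      rw [hμ']
      exact this
    · rw [Function.update_of_ne h]
      exact hF Q hQ
  · rintro ⟨hd, hF⟩
    have hle : ∀ Q, g Q ≤ Function.update g P (g P + 1) Q := by
      intro Q
      by_cases h : Q = P
      · subst h; simp
      · simp [h]
    refine ⟨⟨hd, fun Q hQ μ hμ => hF Q hQ μ (lt_of_lt_of_le hμ (hle Q))⟩, ?_⟩
    ext r
    rw [jet_apply]
    refine hF P hP _ ?_
    have := r.2
    simp only [sideMonomial, map_add, Finsupp.degree_single, Function.update_self]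
    omega

lemma finrank_forms_update [DecidableEq (ℙ ℂ (Fin 3 → ℂ))] {Z : Finset (ℙ ℂ (Fin 3 → ℂ))}
    {g : ℙ ℂ (Fin 3 → ℂ) → ℕ} {d : ℕ} {P : ℙ ℂ (Fin 3 → ℂ)} (hP : P ∈ Z) {i : Fin 3}
    (hi : P.rep i ≠ 0) :
    Module.finrank ℂ (forms Z g d) =
      Module.finrank ℂ (forms Z (Function.update g P (g P + 1)) d) +
      Module.finrank ℂ ((forms Z g d).map (jet P.rep i (g P))) := by
  have h := LinearMap.finrank_range_add_finrank_ker ((jet P.rep i (g P)).domRestrict (forms Z g d))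
  rw [LinearMap.range_domRestrict] at h
  have h2 : Module.finrank ℂ (LinearMap.ker ((jet P.rep i (g P)).domRestrict (forms Z g d))) =
      Module.finrank ℂ (forms Z (Function.update g P (g P + 1)) d) := by
    rw [← ker_jet_inf_forms hP hi, LinearMap.ker_domRestrict, ← Submodule.map_comap_subtype,
      Submodule.finrank_map_subtype_eq]
  omega

lemma exists_line_separating {P Q : ℙ ℂ (Fin 3 → ℂ)} (h : P ≠ Q) :
    ∃ l : MvPolynomial (Fin 3) ℂ, l.IsHomogeneous 1 ∧ eval Q.rep l = 0 ∧ eval P.rep l ≠ 0 := by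
  by_contra! hcon
  obtain ⟨i, hi⟩ := exists_rep_ne_zero Q
  apply h
  rw [← P.mk_rep, ← Q.mk_rep, Projectivization.mk_eq_mk_iff']
  refine ⟨P.rep i / Q.rep i, ?_⟩
  ext j
  have := hcon (C (Q.rep i) * X j - C (Q.rep j) * X i)
    ((isHomogeneous_C_mul_X _ _).sub (isHomogeneous_C_mul_X _ _)) (by simp; ring)
  simp only [map_sub, map_mul, eval_C, eval_X] at this
  simp only [Pi.smul_apply, smul_eq_mul]
  field_simp
  linear_combination -this

lemma coeff_mul_of_isHomogeneous {k : ℕ} (p : MvPolynomial (Fin 3) ℂ)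
    {u : MvPolynomial (Fin 3) ℂ} (hu : u.IsHomogeneous k) {μ : Fin 3 →₀ ℕ} (hμ : μ.degree = k) :
    coeff μ (p * u) = coeff 0 p * coeff μ u := by
  classical
  rw [coeff_mul, Finset.sum_eq_single (0, μ)]
  · rintro ⟨a, b⟩ hab hne
    rw [Finset.HasAntidiagonal.mem_antidiagonal] at hab
    simp only at hab ⊢
    rw [hu.coeff_eq_zero (d := b), mul_zero]
    intro hb
    have h1 : a.degree + b.degree = k := by rw [← map_add, hab, hμ]
    have h2 : a = 0 := by rw [← Finsupp.degree_eq_zero_iff]; omega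
    subst h2
    apply hne
    rw [zero_add] at hab
    rw [hab]
  · intro h
    exact absurd (by simp) h

lemma map_jet_forms_eq_top [DecidableEq (ℙ ℂ (Fin 3 → ℂ))] {Z : Finset (ℙ ℂ (Fin 3 → ℂ))}
    {g : ℙ ℂ (Fin 3 → ℂ) → ℕ} {d : ℕ} {P : ℙ ℂ (Fin 3 → ℂ)} (hP : P ∈ Z) {i : Fin 3}
    (hi : P.rep i ≠ 0) (hd : ∑ Q ∈ Z, g Q ≤ d) :
    (forms Z g d).map (jet P.rep i (g P)) = ⊤ := by
  set k := g P with hk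
  have hl : ∀ Q : ℙ ℂ (Fin 3 → ℂ), ∃ l : MvPolynomial (Fin 3) ℂ, l.IsHomogeneous 1 ∧
      (Q ≠ P → eval Q.rep l = 0) ∧ eval P.rep l ≠ 0 := by
    intro Q
    by_cases h : P = Q
    · exact ⟨X i, isHomogeneous_X _ _, fun h' => absurd h.symm h', by simpa using hi⟩
    · obtain ⟨l, h1, h2, h3⟩ := exists_line_separating h
      exact ⟨l, h1, fun _ => h2, h3⟩
  choose l hl1 hl2 hl3 using hl
  have hl0 : ∀ Q, l Q ≠ 0 := fun Q h => hl3 Q (by simp [h])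
  rw [← Finset.sum_erase_add _ _ hP, ← hk] at hd
  set p : MvPolynomial (Fin 3) ℂ := (∏ Q ∈ Z.erase P, l Q ^ g Q) *
    X i ^ (d - (∑ Q ∈ Z.erase P, g Q + k)) with hp
  have hpd : p.IsHomogeneous (d - k) := by
    have := (IsHomogeneous.prod (Z.erase P) (fun Q => l Q ^ g Q) (fun Q => 1 * g Q)
      (fun Q _ => (hl1 Q).pow (g Q))).mul
      (isHomogeneous_X_pow (R := ℂ) i (d - (∑ Q ∈ Z.erase P, g Q + k)))
    convert this using 1
    simp only [one_mul]
    omega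
  have hp0 : p ≠ 0 := mul_ne_zero (Finset.prod_ne_zero_iff.mpr fun Q _ => pow_ne_zero _ (hl0 Q))
    (pow_ne_zero _ (X_ne_zero i))
  have hpe : eval P.rep p ≠ 0 := by
    simp only [hp, map_mul, map_prod, map_pow, eval_X]
    exact mul_ne_zero (Finset.prod_ne_zero_iff.mpr fun Q _ => pow_ne_zero _ (hl3 Q))
      (pow_ne_zero _ hi)
  have hpdvd : ∀ Q ∈ Z.erase P, l Q ^ g Q ∣ p := fun Q hQ =>
    (Finset.dvd_prod_of_mem _ hQ).mul_right _
  clear_value p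
  let y : Fin 2 → MvPolynomial (Fin 3) ℂ := fun t =>
    X (i.succAbove t) - C (P.rep (i.succAbove t) / P.rep i) * X i
  have hyh : ∀ t, (y t).IsHomogeneous 1 := fun t =>
    (isHomogeneous_X _ _).sub (isHomogeneous_C_mul_X _ _)
  have hyt : ∀ t, translate P.rep (y t) = y t := by
    intro t
    have hX := translate_X P.rep (i.succAbove t)
    simp only [y, map_sub, map_mul, hX, translate_X, translate_C, mul_add]
    rw [← C_mul (a := _ / _), div_mul_cancel₀ _ hi]
    ring
  let u : ℕ → MvPolynomial (Fin 3) ℂ := fun r => y 0 ^ r * y 1 ^ (k - r)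
  have hut : ∀ r, translate P.rep (u r) = u r := fun r => by simp [u, hyt]
  have huh : ∀ r, r ≤ k → (u r).IsHomogeneous k := by
    intro r hr
    convert ((hyh 0).pow r).mul ((hyh 1).pow (k - r)) using 1
    omega
  have huc : ∀ r s : ℕ, coeff (sideMonomial i k s) (u r) =
      if sideMonomial i k r = sideMonomial i k s then 1 else 0 := by
    intro r s
    have hdvd : X i ∣ u r - monomial (sideMonomial i k r) 1 := by
      rw [← Ideal.mem_span_singleton, ← Ideal.Quotient.eq]
      have hm : (monomial (sideMonomial i k r) 1 : MvPolynomial (Fin 3) ℂ) =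
          X (i.succAbove 0) ^ r * X (i.succAbove 1) ^ (k - r) := by
        rw [X_pow_eq_monomial, X_pow_eq_monomial, monomial_mul, one_mul]
        rfl
      have hy : ∀ t, Ideal.Quotient.mk (Ideal.span {X i}) (y t) =
          Ideal.Quotient.mk (Ideal.span {X i}) (X (i.succAbove t)) := by
        intro t
        rw [Ideal.Quotient.eq, Ideal.mem_span_singleton]
        exact ⟨-C (P.rep (i.succAbove t) / P.rep i), by simp only [y]; ring⟩
      simp [hm, u, hy]
    obtain ⟨w, hw⟩ := hdvd
    rw [sub_eq_iff_eq_add] at hw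
    rw [hw, coeff_add, coeff_X_mul', if_neg, zero_add, coeff_monomial]
    simp [sideMonomial]
  rw [eq_top_iff]
  have hspan : ∀ r : Fin (k + 1), Pi.single r 1 ∈ (forms Z g d).map (jet P.rep i k) := by
    intro r
    have hr : (r : ℕ) ≤ k := Nat.lt_succ_iff.mp r.2
    have hy0 : ∀ t, y t ≠ 0 := by
      intro t ht
      have := congrArg (coeff (Finsupp.single (i.succAbove t) 1)) ht
      simp [y, coeff_X, coeff_C_mul, Finsupp.single_left_inj, Fin.ne_succAbove] at this
    have hu0 : u r ≠ 0 := mul_ne_zero (pow_ne_zero _ (hy0 0)) (pow_ne_zero _ (hy0 1))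
    refine ⟨(eval P.rep p)⁻¹ • (p * u r), (forms Z g d).smul_mem _ ?_, ?_⟩
    · rw [mem_forms_iff (mul_ne_zero hp0 hu0)]
      refine ⟨?_, fun Q hQ => ?_⟩
      · convert hpd.mul (huh r hr) using 1
        omega
      · by_cases hQP : Q = P
        · rw [hQP, le_mult_iff (mul_ne_zero hp0 hu0)]
          intro μ hμ
          rw [map_mul, hut, coeff_mul]
          refine Finset.sum_eq_zero fun ab hab => ?_
          rw [(huh r hr).coeff_eq_zero (d := ab.2), mul_zero]
          rw [Finset.HasAntidiagonal.mem_antidiagonal] at hab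
          rw [← hab, map_add] at hμ
          omega
        · have hQ' : Q ∈ Z.erase P := by simp [hQ, hQP]
          have hdv : l Q ^ g Q ∣ p * u r := (hpdvd Q hQ').mul_right _
          have h1 := mult_mono_of_dvd Q hdv (mul_ne_zero hp0 hu0)
          rw [mult_pow Q (hl0 Q)] at h1
          have h2 := (one_le_mult_iff (hl0 Q)).mpr (hl2 Q hQP)
          exact le_trans (Nat.le_mul_of_pos_right _ h2) h1
    · ext s
      rw [map_smul, Pi.smul_apply, jet_apply, map_mul, hut,
        coeff_mul_of_isHomogeneous _ (huh r hr), constantCoeff_translate, huc, smul_eq_mul,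
        inv_mul_cancel_left₀ hpe, Pi.single_apply]
      · congr 1
        rw [eq_iff_iff]
        constructor
        · intro h
          have := DFunLike.congr_fun h (i.succAbove 0)
          simp [sideMonomial] at this
          exact Fin.ext this.symm
        · rintro rfl; rfl
      · have := s.2
        simp only [sideMonomial, map_add, Finsupp.degree_single]
        omega
  intro f _
  rw [pi_eq_sum_univ f]
  refine Submodule.sum_mem _ fun r _ => Submodule.smul_mem _ _ ?_
  convert hspan r using 1
  ext s
  simp [Pi.single_apply, eq_comm]

lemma finrank_forms_aux (Z : Finset (ℙ ℂ (Fin 3 → ℂ))) (d n : ℕ) :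
    ∀ g : ℙ ℂ (Fin 3 → ℂ) → ℕ, ∑ P ∈ Z, g P = n →
    (d + 1) * (d + 2) ≤ 2 * Module.finrank ℂ (forms Z g d) + ∑ P ∈ Z, g P * (g P + 1) ∧
    (n ≤ d + 1 →
      2 * Module.finrank ℂ (forms Z g d) + ∑ P ∈ Z, g P * (g P + 1) = (d + 1) * (d + 2)) := by
  classical
  induction n with
  | zero =>
    intro g hg
    have hg0 : ∀ P ∈ Z, g P = 0 := fun P hP => Finset.sum_eq_zero_iff.mp hg P hP
    have hforms : forms Z g d = homogeneousSubmodule (Fin 3) ℂ d := by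
      refine le_antisymm (forms_le Z g d) fun F hF => ⟨hF, fun P hP μ hμ => ?_⟩
      rw [hg0 P hP] at hμ
      exact absurd hμ (Nat.not_lt_zero _)
    have hs : ∑ P ∈ Z, g P * (g P + 1) = 0 := Finset.sum_eq_zero fun P hP => by simp [hg0 P hP]
    rw [hforms, hs, add_zero, finrank_homogeneousSubmodule]
    simp
  | succ n ih =>
    intro g hg
    obtain ⟨P, hP, hgP⟩ : ∃ P ∈ Z, g P ≠ 0 := by
      by_contra! h
      rw [Finset.sum_eq_zero h] at hg
      omega
    obtain ⟨k, hk⟩ := Nat.exists_eq_succ_of_ne_zero hgP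
    obtain ⟨i, hi⟩ := exists_rep_ne_zero P
    set g' := Function.update g P k with hg'
    have hg'P : g' P = k := by simp [hg']
    have hgg : Function.update g' P (g' P + 1) = g := by
      rw [hg'P, hg', Function.update_idem, ← Nat.succ_eq_add_one, ← hk, Function.update_eq_self]
    have hrest : ∀ f : ℕ → ℕ, ∑ Q ∈ Z.erase P, f (g' Q) = ∑ Q ∈ Z.erase P, f (g Q) := by
      intro f
      refine Finset.sum_congr rfl fun Q hQ => ?_
      rw [hg', Function.update_of_ne (Finset.ne_of_mem_erase hQ)]
    have hsum' : ∑ Q ∈ Z, g' Q = n := by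
      rw [← Finset.sum_erase_add _ _ hP] at hg ⊢
      have := hrest id
      simp only [id] at this
      rw [this, hg'P]
      omega
    have hquad : ∑ Q ∈ Z, g Q * (g Q + 1) = ∑ Q ∈ Z, g' Q * (g' Q + 1) + 2 * (k + 1) := by
      rw [← Finset.sum_erase_add _ _ hP, ← Finset.sum_erase_add Z (fun Q => g' Q * (g' Q + 1)) hP,
        hrest (fun t => t * (t + 1)), hg'P, hk]
      rw [Nat.succ_eq_add_one]
      ring
    have hstep := finrank_forms_update (g := g') (d := d) hP hi
    rw [hgg] at hstep
    obtain ⟨h1, h2⟩ := ih g' hsum'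
    have hle : Module.finrank ℂ ((forms Z g' d).map (jet P.rep i (g' P))) ≤ k + 1 := by
      refine (Submodule.finrank_le _).trans ?_
      rw [Module.finrank_fin_fun, hg'P]
    constructor
    · omega
    · intro hn
      have htop := map_jet_forms_eq_top (g := g') (d := d) hP hi (by omega)
      rw [htop, finrank_top, Module.finrank_fin_fun, hg'P] at hstep
      have := h2 (by omega)
      omega

/-- The expected dimension is a lower bound for the dimension. -/
lemma finrank_forms_ge (Z : Finset (ℙ ℂ (Fin 3 → ℂ))) (g : ℙ ℂ (Fin 3 → ℂ) → ℕ) (d : ℕ) :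
    (d + 1) * (d + 2) ≤ 2 * Module.finrank ℂ (forms Z g d) + ∑ P ∈ Z, g P * (g P + 1) :=
  (finrank_forms_aux Z d _ g rfl).1

/-- In large degree, the dimension is the expected one. -/
lemma finrank_forms_eq (Z : Finset (ℙ ℂ (Fin 3 → ℂ))) (g : ℙ ℂ (Fin 3 → ℂ) → ℕ) {d : ℕ}
    (hd : ∑ P ∈ Z, g P ≤ d) :
    2 * Module.finrank ℂ (forms Z g d) + ∑ P ∈ Z, g P * (g P + 1) = (d + 1) * (d + 2) :=
  (finrank_forms_aux Z d _ g rfl).2 (by omega)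

lemma exists_form_of_sum_lt (Z : Finset (ℙ ℂ (Fin 3 → ℂ))) (g : ℙ ℂ (Fin 3 → ℂ) → ℕ) (d : ℕ)
    (h : ∑ P ∈ Z, g P * (g P + 1) < (d + 1) * (d + 2)) :
    ∃ F : MvPolynomial (Fin 3) ℂ, F ≠ 0 ∧ F.IsHomogeneous d ∧ ∀ P ∈ Z, g P ≤ mult P F := by
  have h1 := finrank_forms_ge Z g d
  have hne : forms Z g d ≠ ⊥ := by
    intro hbot
    rw [hbot, finrank_bot] at h1
    omega
  obtain ⟨F, hF, hF0⟩ := Submodule.exists_mem_ne_zero_of_ne_bot hne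
  obtain ⟨h2, h3⟩ := (mem_forms_iff hF0).mp hF
  exact ⟨F, hF0, h2, h3⟩

lemma isHomogeneous_of_mul_left {F G : MvPolynomial (Fin 3) ℂ} {d : ℕ}
    (h : (F * G).IsHomogeneous d) (h0 : F * G ≠ 0) : F.IsHomogeneous F.totalDegree := by
  have hF := left_ne_zero_of_mul h0
  have hG := right_ne_zero_of_mul h0
  have hle : ∀ {H : MvPolynomial (Fin 3) ℂ}, H ≠ 0 →
      (H : MvPowerSeries (Fin 3) ℂ).order ≤ H.totalDegree := by
    intro H hH
    obtain ⟨μ, hμ⟩ := MvPolynomial.ne_zero_iff.mp hH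
    refine (MvPowerSeries.order_le (d := μ) (by rwa [coeff_coe])).trans ?_
    exact_mod_cast le_totalDegree (mem_support_iff.mpr hμ)
  have hdeg : F.totalDegree + G.totalDegree = d := by
    rw [← totalDegree_mul_of_isDomain hF hG]
    exact h.totalDegree h0
  have hord : (d : ℕ∞) ≤ (F : MvPowerSeries (Fin 3) ℂ).order +
      (G : MvPowerSeries (Fin 3) ℂ).order := by
    rw [← MvPowerSeries.order_mul, ← coe_mul]
    refine MvPowerSeries.nat_le_order fun μ hμ => ?_
    rw [coeff_coe]
    exact h.coeff_eq_zero hμ.ne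
  have hFo : (F.totalDegree : ℕ∞) ≤ (F : MvPowerSeries (Fin 3) ℂ).order := by
    have h1 := hord.trans (add_le_add_right (hle hG) _)
    rw [← hdeg, Nat.cast_add] at h1
    exact (ENat.add_le_add_iff_right (ENat.natCast_ne_top _)).mp h1
  intro μ hμ
  rw [show (1 : Fin 3 → ℕ) = fun _ => 1 from rfl, ← Finsupp.degree_eq_weight_one]
  refine le_antisymm (le_totalDegree (mem_support_iff.mpr hμ)) ?_
  have := hFo.trans (MvPowerSeries.order_le (d := μ) (by rwa [coeff_coe]))
  exact_mod_cast this

lemma isHomogeneous_of_dvd {F A : MvPolynomial (Fin 3) ℂ} {d : ℕ} (hA : A.IsHomogeneous d)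
    (h0 : A ≠ 0) (h : F ∣ A) : F.IsHomogeneous F.totalDegree := by
  obtain ⟨G, rfl⟩ := h
  exact isHomogeneous_of_mul_left hA h0

/-- **Bézout's inequality** for an irreducible curve and a curve not containing it. -/
lemma sum_mult_mul_mult_le (Z : Finset (ℙ ℂ (Fin 3 → ℂ))) {A G : MvPolynomial (Fin 3) ℂ} {a b : ℕ}
    (hA : Irreducible A) (hAa : A.IsHomogeneous a) (hG : G.IsHomogeneous b)
    (hAG : ¬ A ∣ G) : ∑ P ∈ Z, mult P A * mult P G ≤ a * b := by
  have hA0 := hA.ne_zero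
  have hG0 : G ≠ 0 := by rintro rfl; exact hAG (dvd_zero A)
  set m : ℙ ℂ (Fin 3 → ℂ) → ℕ := fun P => mult P A with hm
  set n : ℙ ℂ (Fin 3 → ℂ) → ℕ := fun P => mult P G with hn
  set s := ∑ P ∈ Z, (m P + n P) with hs
  have hmul : ∀ {H : MvPolynomial (Fin 3) ℂ}, H ≠ 0 →
      Function.Injective (LinearMap.mulLeft ℂ H) := fun h _ _ h' => mul_left_cancel₀ h h'
  set U := (forms Z n (s + b)).map (LinearMap.mulLeft ℂ A) with hU
  set V := (forms Z m (s + a)).map (LinearMap.mulLeft ℂ G) with hV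
  have hUr : Module.finrank ℂ U = Module.finrank ℂ (forms Z n (s + b)) :=
    (Submodule.equivMapOfInjective _ (hmul hA0) _).symm.finrank_eq
  have hVr : Module.finrank ℂ V = Module.finrank ℂ (forms Z m (s + a)) :=
    (Submodule.equivMapOfInjective _ (hmul hG0) _).symm.finrank_eq
  have hsup : U ⊔ V ≤ forms Z (fun P => m P + n P) (s + a + b) := by
    refine sup_le ?_ ?_
    · rintro _ ⟨F, hF, rfl⟩
      by_cases hF0 : F = 0
      · simp [hF0]
      · obtain ⟨h1, h2⟩ := (mem_forms_iff hF0).mp hF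
        rw [LinearMap.mulLeft_apply, mem_forms_iff (mul_ne_zero hA0 hF0)]
        refine ⟨?_, fun P hP => ?_⟩
        · convert hAa.mul h1 using 1
          omega
        · rw [mult_mul P hA0 hF0]
          exact Nat.add_le_add_left (h2 P hP) _
    · rintro _ ⟨F, hF, rfl⟩
      by_cases hF0 : F = 0
      · simp [hF0]
      · obtain ⟨h1, h2⟩ := (mem_forms_iff hF0).mp hF
        rw [LinearMap.mulLeft_apply, mem_forms_iff (mul_ne_zero hG0 hF0)]
        refine ⟨?_, fun P hP => ?_⟩
        · convert hG.mul h1 using 1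
          omega
        · rw [mult_mul P hG0 hF0, add_comm]
          exact Nat.add_le_add_left (h2 P hP) _
  have hinf : U ⊓ V ≤ (homogeneousSubmodule (Fin 3) ℂ s).map (LinearMap.mulLeft ℂ (A * G)) := by
    rintro F ⟨⟨H, hH, rfl⟩, ⟨K, hK, hHK⟩⟩
    simp only [LinearMap.mulLeft_apply] at hHK ⊢
    obtain ⟨T, hT⟩ := (hA.prime.dvd_or_dvd (Dvd.intro H hHK.symm)).resolve_left hAG
    by_cases hT0 : T = 0
    · rw [hT, hT0, mul_zero, mul_zero] at hHK
      rw [← hHK]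
      exact Submodule.zero_mem _
    · refine ⟨T, ?_, ?_⟩
      · have hK1 : (A * T).IsHomogeneous (s + a) := hT ▸ hK.1
        rw [mul_comm] at hK1
        have h1 := isHomogeneous_of_mul_left hK1 (mul_ne_zero hT0 hA0)
        have h2 := (h1.mul hAa).inj_right hK1 (mul_ne_zero hT0 hA0)
        have h3 : T.totalDegree = s := by omega
        rw [h3] at h1
        exact h1
      · rw [LinearMap.mulLeft_apply, ← hHK, hT]
        ring
  have hfr := Submodule.finrank_sup_add_finrank_inf_eq U V
  have h1 := Submodule.finrank_mono hsup
  have h2 := (Submodule.finrank_mono hinf).trans (Submodule.finrank_map_le _ _)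
  have h3 := finrank_forms_ge Z n (s + b)
  have h4 := finrank_forms_ge Z m (s + a)
  have h5 := finrank_forms_eq Z (fun P => m P + n P) (d := s + a + b) (by omega)
  have h6 := finrank_homogeneousSubmodule s
  have h7 : ∑ P ∈ Z, (m P + n P) * (m P + n P + 1) = ∑ P ∈ Z, n P * (n P + 1) +
      ∑ P ∈ Z, m P * (m P + 1) + 2 * ∑ P ∈ Z, m P * n P := by
    rw [Finset.mul_sum, ← Finset.sum_add_distrib, ← Finset.sum_add_distrib]
    exact Finset.sum_congr rfl fun P _ => by ring
  have h8 : (s + b + 1) * (s + b + 2) + (s + a + 1) * (s + a + 2) + 2 * (a * b) =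
      (s + a + b + 1) * (s + a + b + 2) + (s + 1) * (s + 2) := by ring
  change ∑ P ∈ Z, m P * n P ≤ a * b
  omega

lemma exists_factorization {A : MvPolynomial (Fin 3) ℂ} {d : ℕ} (hA : A ≠ 0)
    (hd : A.IsHomogeneous d) :
    ∃ (I : Finset (MvPolynomial (Fin 3) ℂ)) (x : MvPolynomial (Fin 3) ℂ → ℕ),
      (∀ D ∈ I, Irreducible D ∧ D.IsHomogeneous D.totalDegree ∧ 1 ≤ x D) ∧
      (∀ D ∈ I, ∀ E ∈ I, D ∣ E → D = E) ∧ Associated (∏ D ∈ I, D ^ x D) A := by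
  classical
  let _ : StrongNormalizationMonoid (MvPolynomial (Fin 3) ℂ) :=
    UniqueFactorizationMonoid.strongNormalizationMonoid
  refine ⟨(UniqueFactorizationMonoid.normalizedFactors A).toFinset,
    fun D => (UniqueFactorizationMonoid.normalizedFactors A).count D, ?_, ?_, ?_⟩
  · intro D hD
    rw [Multiset.mem_toFinset] at hD
    exact ⟨UniqueFactorizationMonoid.irreducible_of_normalized_factor D hD,
      isHomogeneous_of_dvd hd hA (UniqueFactorizationMonoid.dvd_of_mem_normalizedFactors hD),
      Multiset.one_le_count_iff_mem.mpr hD⟩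
  · intro D hD E hE hDE
    rw [Multiset.mem_toFinset] at hD hE
    have h1 := UniqueFactorizationMonoid.irreducible_of_normalized_factor D hD
    have h2 := UniqueFactorizationMonoid.irreducible_of_normalized_factor E hE
    have h3 : Associated D E := h1.associated_of_dvd h2 hDE
    rw [← UniqueFactorizationMonoid.normalize_normalized_factor D hD,
      ← UniqueFactorizationMonoid.normalize_normalized_factor E hE]
    exact normalize_eq_normalize_iff_associated.mpr h3
  · rw [← Finset.prod_multiset_count]
    exact UniqueFactorizationMonoid.prod_normalizedFactors hA

lemma eval_smul_of_isHomogeneous {F : MvPolynomial (Fin 3) ℂ} {d : ℕ} (hF : F.IsHomogeneous d)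
    (c : ℂ) (w : Fin 3 → ℂ) : eval (c • w) F = c ^ d * eval w F := by
  rw [eval_eq', eval_eq', Finset.mul_sum]
  refine Finset.sum_congr rfl fun μ hμ => ?_
  have hd : ∑ i, μ i = d := by
    rw [← Finsupp.degree_eq_sum]
    by_contra h
    exact mem_support_iff.mp hμ (hF.coeff_eq_zero h)
  simp only [Pi.smul_apply, smul_eq_mul, mul_pow, Finset.prod_mul_distrib,
    Finset.prod_pow_eq_pow_sum,
    hd]
  ring

lemma exists_mult_pos_notMem {A : MvPolynomial (Fin 3) ℂ} {a : ℕ} (hA : Irreducible A)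
    (hAa : A.IsHomogeneous a) (ha : 2 ≤ a) (T : Finset (ℙ ℂ (Fin 3 → ℂ))) :
    ∃ P, P ∉ T ∧ 1 ≤ mult P A := by
  by_contra! hcon
  have hl : ∀ P : ℙ ℂ (Fin 3 → ℂ), ∃ l : MvPolynomial (Fin 3) ℂ, l ≠ 0 ∧ l.IsHomogeneous 1 ∧
      1 ≤ mult P l := by
    intro P
    obtain ⟨l, h1, h2, h3⟩ := exists_form_of_sum_lt {P} (fun _ => 1) 1 (by simp)
    exact ⟨l, h1, h2, h3 P (by simp)⟩
  choose l hl0 hl1 hl2 using hl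
  have hndvd : ∀ {u : MvPolynomial (Fin 3) ℂ}, u ≠ 0 → u.IsHomogeneous 1 → ¬ A ∣ u := by
    intro u hu hu1 hdvd
    have := totalDegree_le_of_dvd_of_isDomain hdvd hu
    rw [hu1.totalDegree hu, hAa.totalDegree hA.ne_zero] at this
    omega
  have hv : X 0 * ∏ P ∈ T, l P ∈
      vanishingIdeal ℂ (zeroLocus ℂ (Ideal.span {A})) := by
    rw [mem_vanishingIdeal_iff]
    intro w hw
    have hw0 : eval w A = 0 := by
      have := (mem_zeroLocus_iff.mp hw) A (Ideal.mem_span_singleton_self A)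
      simpa using this
    by_cases hw00 : w = 0
    · simp [hw00]
    · set P : ℙ ℂ (Fin 3 → ℂ) := Projectivization.mk ℂ w hw00 with hP
      obtain ⟨c, hc⟩ := Projectivization.exists_smul_eq_mk_rep ℂ w hw00
      have hscale : ∀ {F : MvPolynomial (Fin 3) ℂ} {d : ℕ}, F.IsHomogeneous d →
          (eval P.rep F = 0 ↔ eval w F = 0) := by
        intro F d hF
        rw [hP, ← hc]
        have : eval ((c : ℂ) • w) F = (c : ℂ) ^ d * eval w F := eval_smul_of_isHomogeneous hF _ _
        rw [Units.smul_def, this]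
        simp
      have hPT : P ∈ T := by
        by_contra hPT
        have := hcon P hPT
        have h1 := (one_le_mult_iff hA.ne_zero).mpr ((hscale hAa).mpr hw0)
        omega
      have h1 := (hscale (hl1 P)).mp ((one_le_mult_iff (hl0 P)).mp (hl2 P))
      simp only [map_mul, map_prod]
      rw [Finset.prod_eq_zero hPT h1, mul_zero]
  rw [vanishingIdeal_zeroLocus_eq_radical] at hv
  have hprime : (Ideal.span {A}).IsPrime :=
    (Ideal.span_singleton_prime hA.ne_zero).mpr hA.prime
  rw [hprime.radical, Ideal.mem_span_singleton] at hv
  rcases hA.prime.dvd_or_dvd hv with h | h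
  · exact hndvd (X_ne_zero 0) (isHomogeneous_X _ _) h
  · obtain ⟨P, _, hP⟩ := (Prime.dvd_finsetProd_iff hA.prime _).mp h
    exact hndvd (hl0 P) (hl1 P) hP

lemma exists_finset_mult_pos {A : MvPolynomial (Fin 3) ℂ} {a : ℕ} (hA : Irreducible A)
    (hAa : A.IsHomogeneous a) (ha : 2 ≤ a) (T : Finset (ℙ ℂ (Fin 3 → ℂ))) (q : ℕ) :
    ∃ E : Finset (ℙ ℂ (Fin 3 → ℂ)), E.card = q ∧ Disjoint T E ∧ ∀ P ∈ E, 1 ≤ mult P A := by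
  classical
  induction q with
  | zero => exact ⟨∅, by simp⟩
  | succ q ih =>
    obtain ⟨E, h1, h2, h3⟩ := ih
    obtain ⟨P, hP, hPA⟩ := exists_mult_pos_notMem hA hAa ha (T ∪ E)
    rw [Finset.mem_union, not_or] at hP
    refine ⟨insert P E, by rw [Finset.card_insert_of_notMem hP.2, h1], ?_, ?_⟩
    · rw [Finset.disjoint_insert_right]
      exact ⟨hP.1, h2⟩
    · intro Q hQ
      rcases Finset.mem_insert.mp hQ with rfl | hQ
      · exact hPA
      · exact h3 Q hQ

lemma not_dvd_of_degree_lt {A G : MvPolynomial (Fin 3) ℂ} {a b : ℕ} (hA0 : A ≠ 0)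
    (hAa : A.IsHomogeneous a) (hG0 : G ≠ 0) (hG : G.IsHomogeneous b) (h : b < a) : ¬ A ∣ G := by
  intro hdvd
  have := totalDegree_le_of_dvd_of_isDomain hdvd hG0
  rw [hG.totalDegree hG0, hAa.totalDegree hA0] at this
  omega

/-- The **genus bound** for an irreducible curve. -/
lemma sum_mult_mul_pred_le (Z : Finset (ℙ ℂ (Fin 3 → ℂ))) {A : MvPolynomial (Fin 3) ℂ} {c : ℕ}
    (hA : Irreducible A) (hAc : A.IsHomogeneous (c + 1)) :
    ∑ P ∈ Z, mult P A * (mult P A - 1) ≤ c * (c - 1) := by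
  classical
  have hA0 := hA.ne_zero
  have hbez : ∀ (T : Finset (ℙ ℂ (Fin 3 → ℂ))) {G : MvPolynomial (Fin 3) ℂ}, G ≠ 0 →
      G.IsHomogeneous c → ∑ P ∈ T, mult P A * mult P G ≤ (c + 1) * c := fun T G hG0 hG =>
    sum_mult_mul_mult_le T hA hAc hG (not_dvd_of_degree_lt hA0 hAc hG0 hG (Nat.lt_succ_self c))
  have hpolar : ∑ P ∈ Z, mult P A * (mult P A - 1) ≤ (c + 1) * c := by
    obtain ⟨i, hi⟩ : ∃ i, pderiv i A ≠ 0 := by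
      by_contra! h
      have := hAc.sum_X_mul_pderiv
      simp only [h, mul_zero, Finset.sum_const_zero] at this
      exact hA0 ((smul_eq_zero.mp this.symm).resolve_left (Nat.succ_ne_zero c))
    refine le_trans (Finset.sum_le_sum fun P _ => ?_) (hbez Z hi hAc.pderiv)
    exact Nat.mul_le_mul_left _ (mult_pderiv P i hi)
  rcases Nat.eq_zero_or_pos c with rfl | hc
  · simpa using hpolar
  have heven : Even (∑ P ∈ Z, mult P A * (mult P A - 1)) :=
    Finset.even_sum _ fun P _ => Nat.even_mul_pred_self _
  obtain ⟨δ, hδ⟩ := heven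
  obtain ⟨t, ht⟩ : Even ((c + 1) * (c + 2)) := Nat.even_mul_succ_self (c + 1)
  have hexp : (c + 1) * (c + 2) = (c + 1) * c + 2 * (c + 1) := by ring
  obtain ⟨E, hE1, hE2, hE3⟩ := exists_finset_mult_pos hA hAc (by omega) Z (t - δ - 1)
  let g : ℙ ℂ (Fin 3 → ℂ) → ℕ := fun P => if P ∈ E then 1 else mult P A - 1
  have hgZ : ∀ P ∈ Z, g P = mult P A - 1 := fun P hP => by
    simp [g, Finset.disjoint_left.mp hE2 hP]
  have hgE : ∀ P ∈ E, g P = 1 := fun P hP => by simp [g, hP]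
  have hsum : ∑ P ∈ Z ∪ E, g P * (g P + 1) = 2 * δ + 2 * (t - δ - 1) := by
    have hsE : ∑ P ∈ E, g P * (g P + 1) = 2 * (t - δ - 1) := by
      rw [Finset.sum_congr rfl fun P hP => by rw [hgE P hP], Finset.sum_const, hE1]
      simp [mul_comm]
    rw [Finset.sum_union hE2, hsE]
    have : ∑ P ∈ Z, g P * (g P + 1) = ∑ P ∈ Z, mult P A * (mult P A - 1) := by
      refine Finset.sum_congr rfl fun P hP => ?_
      rw [hgZ P hP]
      rcases Nat.eq_zero_or_pos (mult P A) with h | h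
      · simp [h]
      · rw [Nat.sub_add_cancel h, mul_comm]
    rw [this, hδ]
    ring
  obtain ⟨G, hG0, hG, hGm⟩ := exists_form_of_sum_lt (Z ∪ E) g c (by omega)
  have hb := hbez (Z ∪ E) hG0 hG
  rw [Finset.sum_union hE2] at hb
  have h1 : ∑ P ∈ Z, mult P A * (mult P A - 1) ≤ ∑ P ∈ Z, mult P A * mult P G := by
    refine Finset.sum_le_sum fun P hP => Nat.mul_le_mul_left _ ?_
    rw [← hgZ P hP]
    exact hGm P (Finset.mem_union_left _ hP)
  have h2 : t - δ - 1 ≤ ∑ P ∈ E, mult P A * mult P G := by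
    rw [← hE1, Finset.card_eq_sum_ones]
    refine Finset.sum_le_sum fun P hP => ?_
    have := hGm P (Finset.mem_union_right _ hP)
    rw [hgE P hP] at this
    exact Nat.one_le_iff_ne_zero.mpr (mul_ne_zero (by have := hE3 P hP; omega) (by omega))
  obtain ⟨b, rfl⟩ : ∃ b, c = b + 1 := ⟨c - 1, by omega⟩
  have e1 : (b + 1 + 1) * (b + 1) = b * b + 3 * b + 2 := by ring
  have e2 : (b + 1) * (b + 1 - 1) = b * b + b := by simp; ring
  rw [e2]
  omega

lemma OrderGE.pderiv {v : Fin 3 → ℂ} {k : ℕ} {F : MvPolynomial (Fin 3) ℂ}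
    (h : OrderGE v (k + 1) F) (i : Fin 3) : OrderGE v k (pderiv i F) := by
  intro μ hμ
  rw [← pderiv_translate, coeff_pderiv, h _ (by simpa using hμ), zero_mul]

lemma orderGE_succ {v : Fin 3 → ℂ} {k : ℕ} {F : MvPolynomial (Fin 3) ℂ} (h0 : eval v F = 0)
    (h : ∀ i, OrderGE v k (MvPolynomial.pderiv i F)) : OrderGE v (k + 1) F := by
  intro μ hμ
  by_cases hμ0 : μ = 0
  · rw [hμ0, constantCoeff_translate, h0]
  · obtain ⟨i, hi⟩ := Finsupp.ne_iff.mp hμ0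
    have hle : Finsupp.single i 1 ≤ μ := by
      rw [Finsupp.single_le_iff]
      exact Nat.one_le_iff_ne_zero.mpr hi
    obtain ⟨ν, rfl⟩ := exists_add_of_le hle
    have h1 := h i ν (by simp only [map_add, Finsupp.degree_single] at hμ; omega)
    rw [← pderiv_translate, coeff_pderiv, add_comm ν] at h1
    exact (mul_eq_zero.mp h1).resolve_right (by exact_mod_cast Nat.succ_ne_zero (ν i))

lemma orderGE_iff_foldl (v : Fin 3 → ℂ) (k : ℕ) :
    ∀ F : MvPolynomial (Fin 3) ℂ, OrderGE v k F ↔ ∀ l : List (Fin 3), l.length < k →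
      eval v (l.foldl (fun p i => MvPolynomial.pderiv i p) F) = 0 := by
  induction k with
  | zero => exact fun F => ⟨fun _ l hl => absurd hl (Nat.not_lt_zero _),
      fun _ μ hμ => absurd hμ (Nat.not_lt_zero _)⟩
  | succ k ih =>
    intro F
    constructor
    · rintro h (_ | ⟨i, l⟩) hl
      · rw [List.foldl_nil, ← constantCoeff_translate]
        exact h 0 (by simp)
      · rw [List.foldl_cons]
        exact (ih _).mp (h.pderiv i) l (by simpa using hl)
    · intro h
      refine orderGE_succ (h [] (by simp)) fun i => (ih _).mpr fun l hl => ?_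
      exact h (i :: l) (by simpa using hl)

lemma vanishesToOrder_iff (m : ℕ) (F : MvPolynomial (Fin 3) ℂ) (v : Fin 3 → ℂ) :
    VanishesToOrder m F v ↔ OrderGE v m F := by
  rw [orderGE_iff_foldl]
  constructor
  · intro h l hl
    have := h l.length hl l.get
    rwa [List.ofFn_get] at this
  · intro h k hk d
    exact h _ (by simpa using hk)

lemma foldl_pderiv_isHomogeneous (l : List (Fin 3)) :
    ∀ {F : MvPolynomial (Fin 3) ℂ} {d : ℕ}, F.IsHomogeneous d →
      (l.foldl (fun p i => MvPolynomial.pderiv i p) F).IsHomogeneous (d - l.length) := by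
  induction l with
  | nil => intro F d h; simpa using h
  | cons i l ih =>
    intro F d h
    rw [List.foldl_cons, List.length_cons, add_comm, ← Nat.sub_sub]
    exact ih h.pderiv

/-- A nonzero form of degree `d`. -/
def IsForm (F : MvPolynomial (Fin 3) ℂ) (d : ℕ) : Prop := F ≠ 0 ∧ F.IsHomogeneous d

lemma isForm_one : IsForm 1 0 := ⟨one_ne_zero, isHomogeneous_one _ _⟩

lemma IsForm.mul {F G : MvPolynomial (Fin 3) ℂ} {d e : ℕ} (hF : IsForm F d) (hG : IsForm G e) :
    IsForm (F * G) (d + e) := ⟨mul_ne_zero hF.1 hG.1, hF.2.mul hG.2⟩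

lemma IsForm.eval_rep_eq_zero_iff {F : MvPolynomial (Fin 3) ℂ} {d : ℕ} (hF : F.IsHomogeneous d)
    {w : Fin 3 → ℂ} (hw : w ≠ 0) :
    eval (Projectivization.mk ℂ w hw).rep F = 0 ↔ eval w F = 0 := by
  obtain ⟨c, hc⟩ := Projectivization.exists_smul_eq_mk_rep ℂ w hw
  rw [← hc, Units.smul_def, eval_smul_of_isHomogeneous hF]
  simp

lemma IsForm.mem_symbolicPower_iff {F : MvPolynomial (Fin 3) ℂ} {d : ℕ} (hF : IsForm F d)
    (Z : Set (ℙ ℂ (Fin 3 → ℂ))) (m : ℕ) :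
    F ∈ symbolicPower Z m ↔ ∀ P ∈ Z, m ≤ mult P F := by
  constructor
  · intro h P hP
    rw [le_mult_iff hF.1, ← vanishesToOrder_iff]
    exact h P hP P.rep P.rep_nonzero P.mk_rep
  · rintro h P hP v hv rfl
    have h1 := (vanishesToOrder_iff m F _).mpr ((le_mult_iff hF.1).mp (h _ hP))
    intro k hk D
    exact (IsForm.eval_rep_eq_zero_iff (foldl_pderiv_isHomogeneous _ hF.2) hv).mp (h1 k hk D)

lemma IsForm.containedInConic {F : MvPolynomial (Fin 3) ℂ} (hF : IsForm F 2)
    {Z : Set (ℙ ℂ (Fin 3 → ℂ))} (h : ∀ P ∈ Z, 1 ≤ mult P F) : ContainedInConic Z := by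
  refine ⟨F, hF.1, hF.2, ?_⟩
  rintro P hP v hv rfl
  exact (IsForm.eval_rep_eq_zero_iff hF.2 hv).mp ((one_le_mult_iff hF.1).mp (h _ hP))

/-- The irreducible factorization of a form, with `x D` the exponent of `D ∈ I`. -/
structure IsFactorization (A : MvPolynomial (Fin 3) ℂ) (I : Finset (MvPolynomial (Fin 3) ℂ))
    (x : MvPolynomial (Fin 3) ℂ → ℕ) : Prop where
  irreducible : ∀ D ∈ I, Irreducible D
  homogeneous : ∀ D ∈ I, D.IsHomogeneous D.totalDegree
  one_le : ∀ D ∈ I, 1 ≤ x D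
  eq_of_dvd : ∀ D ∈ I, ∀ E ∈ I, D ∣ E → D = E
  associated : Associated (∏ D ∈ I, D ^ x D) A

lemma IsForm.exists_isFactorization {A : MvPolynomial (Fin 3) ℂ} {d : ℕ} (hA : IsForm A d) :
    ∃ I x, IsFactorization A I x := by
  obtain ⟨I, x, h1, h2, h3⟩ := exists_factorization hA.1 hA.2
  exact ⟨I, x, fun D hD => (h1 D hD).1, fun D hD => (h1 D hD).2.1, fun D hD => (h1 D hD).2.2,
    h2, h3⟩

lemma mult_eq_of_associated (P : ℙ ℂ (Fin 3 → ℂ)) {A B : MvPolynomial (Fin 3) ℂ}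
    (h : Associated A B) (hB : B ≠ 0) : mult P A = mult P B :=
  le_antisymm (mult_mono_of_dvd P h.dvd hB)
    (mult_mono_of_dvd P h.symm.dvd (h.ne_zero_iff.mpr hB))

lemma IsForm.totalDegree {A : MvPolynomial (Fin 3) ℂ} {d : ℕ} (hA : IsForm A d) :
    A.totalDegree = d := hA.2.totalDegree hA.1

lemma IsForm.of_mul_right {A B : MvPolynomial (Fin 3) ℂ} {a d : ℕ} (h : IsForm (A * B) d)
    (hA : IsForm A a) : IsForm B (d - a) := by
  have hB0 := right_ne_zero_of_mul h.1
  have hm : (B * A).IsHomogeneous d := by rw [mul_comm]; exact h.2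
  have hB : IsForm B B.totalDegree :=
    ⟨hB0, isHomogeneous_of_mul_left hm (mul_ne_zero hB0 hA.1)⟩
  have := (hA.mul hB).totalDegree.symm.trans h.totalDegree
  rwa [show d - a = B.totalDegree by omega]

lemma IsForm.irreducible {l : MvPolynomial (Fin 3) ℂ} (hl : IsForm l 1) : Irreducible l :=
  irreducible_of_totalDegree_eq_one hl.totalDegree (by
    intro c hc
    by_contra hcu
    have hc0 : c = 0 := by rwa [isUnit_iff_ne_zero, not_not] at hcu
    exact hl.1 (MvPolynomial.ext _ _ fun μ => by
      have := hc μ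
      rw [hc0, zero_dvd_iff] at this
      rw [this, coeff_zero]))

section Factorization

variable {A : MvPolynomial (Fin 3) ℂ} {d : ℕ} {I : Finset (MvPolynomial (Fin 3) ℂ)}
  {x : MvPolynomial (Fin 3) ℂ → ℕ}

lemma IsFactorization.isForm (h : IsFactorization A I x) {D : MvPolynomial (Fin 3) ℂ}
    (hD : D ∈ I) : IsForm D D.totalDegree := ⟨(h.irreducible D hD).ne_zero, h.homogeneous D hD⟩

lemma IsFactorization.one_le_totalDegree (h : IsFactorization A I x)
    {D : MvPolynomial (Fin 3) ℂ} (hD : D ∈ I) : 1 ≤ D.totalDegree := by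
  by_contra hcon
  have h0 : D.totalDegree = 0 := by omega
  rw [totalDegree_eq_zero_iff_eq_C] at h0
  refine (h.irreducible D hD).not_isUnit ?_
  rw [h0]
  refine IsUnit.map C (isUnit_iff_ne_zero.mpr fun hc => (h.isForm hD).1 ?_)
  rw [h0, hc, C_0]

lemma IsFactorization.mult_eq (h : IsFactorization A I x) (hA : A ≠ 0) (P : ℙ ℂ (Fin 3 → ℂ)) :
    mult P A = ∑ D ∈ I, x D * mult P D := by
  rw [← mult_eq_of_associated P h.associated hA,
    mult_prod P I _ fun D hD => pow_ne_zero _ (h.isForm hD).1]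
  exact Finset.sum_congr rfl fun D hD => mult_pow P (h.isForm hD).1 _

lemma isForm_prod {ι : Type*} (s : Finset ι) (f : ι → MvPolynomial (Fin 3) ℂ) (n : ι → ℕ)
    (h : ∀ i ∈ s, IsForm (f i) (n i)) : IsForm (∏ i ∈ s, f i) (∑ i ∈ s, n i) :=
  ⟨Finset.prod_ne_zero_iff.mpr fun i hi => (h i hi).1,
    IsHomogeneous.prod s f n fun i hi => (h i hi).2⟩

lemma IsForm.pow {F : MvPolynomial (Fin 3) ℂ} {d : ℕ} (hF : IsForm F d) (n : ℕ) :
    IsForm (F ^ n) (n * d) := ⟨pow_ne_zero n hF.1, by rw [mul_comm]; exact hF.2.pow n⟩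

lemma IsFactorization.degree_eq (h : IsFactorization A I x) (hA : IsForm A d) :
    d = ∑ D ∈ I, x D * D.totalDegree := by
  rw [← hA.totalDegree, ← (isForm_prod I (fun D => D ^ x D) (fun D => x D * D.totalDegree)
    fun D hD => (h.isForm hD).pow _).totalDegree]
  refine le_antisymm ?_ ?_
  · exact totalDegree_le_of_dvd_of_isDomain h.associated.symm.dvd
      (h.associated.ne_zero_iff.mpr hA.1)
  · exact totalDegree_le_of_dvd_of_isDomain h.associated.dvd hA.1

lemma IsFactorization.exists_eq_prod_mul (h : IsFactorization A I x)
    {J : Finset (MvPolynomial (Fin 3) ℂ)} (hJ : J ⊆ I) : ∃ U, A = (∏ D ∈ J, D) * U := by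
  have h1 : ∏ D ∈ J, D ∣ ∏ D ∈ I, D ^ x D :=
    (Finset.prod_dvd_prod_of_dvd _ _ fun D hD =>
      dvd_pow_self D (Nat.one_le_iff_ne_zero.mp (h.one_le D (hJ hD)))).trans
      (Finset.prod_dvd_prod_of_subset _ _ _ hJ)
  exact h1.trans h.associated.dvd

/-- The cofactor of a squarefree product of factors. -/
lemma IsFactorization.exists_cofactor (h : IsFactorization A I x) (hA : IsForm A d)
    {J : Finset (MvPolynomial (Fin 3) ℂ)} (hJ : J ⊆ I) :
    ∃ U e, IsForm U e ∧ d = ∑ D ∈ J, D.totalDegree + e ∧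
      ∀ P, mult P A = ∑ D ∈ J, mult P D + mult P U := by
  obtain ⟨U, hU⟩ := h.exists_eq_prod_mul hJ
  have hB : IsForm (∏ D ∈ J, D) (∑ D ∈ J, D.totalDegree) :=
    isForm_prod J _ _ fun D hD => h.isForm (hJ hD)
  have hA' := hA
  rw [hU] at hA'
  have hUf := hA'.of_mul_right hB
  refine ⟨U, _, hUf, hA'.totalDegree.symm.trans (hB.mul hUf).totalDegree, fun P => ?_⟩
  rw [hU, mult_mul P hB.1 hUf.1, mult_prod P J _ fun D hD => (h.isForm (hJ hD)).1]

lemma IsFactorization.bezout (h : IsFactorization A I x) {D E : MvPolynomial (Fin 3) ℂ}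
    (hD : D ∈ I) (hE : E ∈ I) (hne : D ≠ E) (T : Finset (ℙ ℂ (Fin 3 → ℂ))) :
    ∑ P ∈ T, mult P D * mult P E ≤ D.totalDegree * E.totalDegree :=
  sum_mult_mul_mult_le T (h.irreducible D hD) (h.homogeneous D hD) (h.homogeneous E hE)
    fun hdvd => hne (h.eq_of_dvd D hD E hE hdvd)

lemma IsFactorization.card_le (h : IsFactorization A I x) {D E : MvPolynomial (Fin 3) ℂ}
    (hD : D ∈ I) (hE : E ∈ I) (hne : D ≠ E) (T : Finset (ℙ ℂ (Fin 3 → ℂ)))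
    (hT : ∀ P ∈ T, 1 ≤ mult P D ∧ 1 ≤ mult P E) : T.card ≤ D.totalDegree * E.totalDegree := by
  refine le_trans ?_ (h.bezout hD hE hne T)
  rw [Finset.card_eq_sum_ones]
  exact Finset.sum_le_sum fun P hP => Nat.mul_le_mul (hT P hP).1 (hT P hP).2

lemma IsFactorization.eq_of_two_points (h : IsFactorization A I x) {D E : MvPolynomial (Fin 3) ℂ}
    (hD : D ∈ I) (hE : E ∈ I) (hD1 : D.totalDegree = 1) (hE1 : E.totalDegree = 1)
    {P R : ℙ ℂ (Fin 3 → ℂ)} (hPR : P ≠ R) (hDP : 1 ≤ mult P D) (hDR : 1 ≤ mult R D)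
    (hEP : 1 ≤ mult P E) (hER : 1 ≤ mult R E) : D = E := by
  classical
  by_contra hne
  have := h.card_le hD hE hne {P, R} (by
    intro W hW
    rcases Finset.mem_insert.mp hW with rfl | hW
    · exact ⟨hDP, hEP⟩
    · rw [Finset.mem_singleton.mp hW]; exact ⟨hDR, hER⟩)
  rw [Finset.card_pair hPR, hD1, hE1] at this
  omega

lemma IsFactorization.genus (h : IsFactorization A I x) {D : MvPolynomial (Fin 3) ℂ}
    (hD : D ∈ I) (T : Finset (ℙ ℂ (Fin 3 → ℂ))) :
    ∑ P ∈ T, mult P D * (mult P D - 1) ≤ (D.totalDegree - 1) * (D.totalDegree - 2) := by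
  have h1 := h.one_le_totalDegree hD
  have := sum_mult_mul_pred_le T (A := D) (c := D.totalDegree - 1) (h.irreducible D hD)
    (by rw [Nat.sub_add_cancel h1]; exact h.homogeneous D hD)
  rwa [Nat.sub_sub] at this

/-- A line dividing the form is, up to a unit, one of the factors. -/
lemma IsFactorization.exists_line (h : IsFactorization A I x) {l : MvPolynomial (Fin 3) ℂ}
    (hl : IsForm l 1) (hdvd : l ∣ A) : ∃ D ∈ I, D.totalDegree = 1 ∧ ∀ P, mult P D = mult P l := by
  have hirr := hl.irreducible
  have h1 : l ∣ ∏ D ∈ I, D ^ x D := hdvd.trans h.associated.symm.dvd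
  obtain ⟨D, hD, hlD⟩ := (Prime.dvd_finsetProd_iff hirr.prime _).mp h1
  have hass := hirr.associated_of_dvd (h.irreducible D hD) (hirr.prime.dvd_of_dvd_pow hlD)
  refine ⟨D, hD, ?_, fun P => mult_eq_of_associated P hass.symm hl.1⟩
  exact le_antisymm
    (hl.totalDegree ▸ totalDegree_le_of_dvd_of_isDomain hass.symm.dvd hl.1)
    (h.one_le_totalDegree hD)

end Factorization

/-- The points of `Z` do not lie on a conic. -/
def NoConic (Z : Finset (ℙ ℂ (Fin 3 → ℂ))) : Prop :=
  ∀ H, IsForm H 2 → ∃ P ∈ Z, mult P H = 0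

lemma exists_line_through (P R : ℙ ℂ (Fin 3 → ℂ)) :
    ∃ l, IsForm l 1 ∧ 1 ≤ mult P l ∧ 1 ≤ mult R l := by
  classical
  obtain ⟨l, h1, h2, h3⟩ := exists_form_of_sum_lt {P, R} (fun _ => 1) 1 (by
    simp only [Finset.sum_const, smul_eq_mul]
    have := Finset.card_le_two (a := P) (b := R)
    omega)
  exact ⟨l, ⟨h1, h2⟩, h3 P (by simp), h3 R (by simp)⟩

/-- `Z` is not covered by two lines. -/
lemma NoConic.not_two_lines {Z : Finset (ℙ ℂ (Fin 3 → ℂ))} (hZ : NoConic Z)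
    {l k : MvPolynomial (Fin 3) ℂ} (hl : IsForm l 1) (hk : IsForm k 1)
    (h : ∀ P ∈ Z, 1 ≤ mult P l ∨ 1 ≤ mult P k) : False := by
  obtain ⟨P, hP, h0⟩ := hZ _ (hl.mul hk)
  rw [mult_mul P hl.1 hk.1] at h0
  rcases h P hP with h | h <;> omega

/-- `Z` is not covered by a line and two points. -/
lemma NoConic.not_line_points {Z : Finset (ℙ ℂ (Fin 3 → ℂ))} (hZ : NoConic Z)
    {l : MvPolynomial (Fin 3) ℂ} (hl : IsForm l 1) (R S : ℙ ℂ (Fin 3 → ℂ))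
    (h : ∀ P ∈ Z, P ≠ R → P ≠ S → 1 ≤ mult P l) : False := by
  obtain ⟨k, hk, hkR, hkS⟩ := exists_line_through R S
  refine hZ.not_two_lines hl hk fun P hP => ?_
  by_cases h1 : P = R
  · exact Or.inr (h1 ▸ hkR)
  by_cases h2 : P = S
  · exact Or.inr (h2 ▸ hkS)
  exact Or.inl (h P hP h1 h2)

lemma NoConic.six_le_card {Z : Finset (ℙ ℂ (Fin 3 → ℂ))} (hZ : NoConic Z) : 6 ≤ Z.card := by
  by_contra hcon
  obtain ⟨l, h1, h2, h3⟩ := exists_form_of_sum_lt Z (fun _ => 1) 2 (by simp; omega)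
  obtain ⟨P, hP, h0⟩ := hZ l ⟨h1, h2⟩
  have := h3 P hP
  omega

/-- A form `A` of degree `d` which vanishes to order `j` on `Z`, except at `Q` where the order
drops by one, in a situation where forms of order `j - k` on `Z` have degree `> d - 2 * k`. -/
structure Defect (Z : Finset (ℙ ℂ (Fin 3 → ℂ))) (Q : ℙ ℂ (Fin 3 → ℂ)) (j d : ℕ)
    (A : MvPolynomial (Fin 3) ℂ) (I : Finset (MvPolynomial (Fin 3) ℂ))
    (x : MvPolynomial (Fin 3) ℂ → ℕ) : Prop where
  noConic : NoConic Z
  mem : Q ∈ Z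
  low : ∀ k ≤ 2, ∀ H e, IsForm H e → (∀ P ∈ Z, j ≤ mult P H + k) → d + 1 ≤ e + 2 * k
  form : IsForm A d
  mult_base : j = mult Q A + 1
  le_mult : ∀ P ∈ Z, P ≠ Q → j ≤ mult P A
  fac : IsFactorization A I x

/-- The factors of degree `c` with multiplicity `c - 1` at `Q`. -/
noncomputable def sections (I : Finset (MvPolynomial (Fin 3) ℂ)) (Q : ℙ ℂ (Fin 3 → ℂ)) :
    Finset (MvPolynomial (Fin 3) ℂ) :=
  {D ∈ I | mult Q D + 1 = D.totalDegree}

/-- The remaining factors, which turn out to be the lines through `Q`. -/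
noncomputable def fibres (I : Finset (MvPolynomial (Fin 3) ℂ)) (Q : ℙ ℂ (Fin 3 → ℂ)) :
    Finset (MvPolynomial (Fin 3) ℂ) :=
  {D ∈ I | ¬ mult Q D + 1 = D.totalDegree}

noncomputable def lineSections (I : Finset (MvPolynomial (Fin 3) ℂ)) (Q : ℙ ℂ (Fin 3 → ℂ)) :
    Finset (MvPolynomial (Fin 3) ℂ) :=
  {D ∈ sections I Q | D.totalDegree = 1}

noncomputable def curveSections (I : Finset (MvPolynomial (Fin 3) ℂ)) (Q : ℙ ℂ (Fin 3 → ℂ)) :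
    Finset (MvPolynomial (Fin 3) ℂ) :=
  {D ∈ sections I Q | ¬ D.totalDegree = 1}

namespace Defect

variable {Z : Finset (ℙ ℂ (Fin 3 → ℂ))} {Q P R O : ℙ ℂ (Fin 3 → ℂ)} {j d : ℕ}
  {A D S T L : MvPolynomial (Fin 3) ℂ} {I : Finset (MvPolynomial (Fin 3) ℂ)}
  {x : MvPolynomial (Fin 3) ℂ → ℕ}

/-- Replacing the product of the factors in `J` by a form `G` cannot lower the degree
too much. -/
lemma exchange (s : Defect Z Q j d A I x) {k : ℕ} (hk : k ≤ 2)
    {J : Finset (MvPolynomial (Fin 3) ℂ)} (hJ : J ⊆ I) {G : MvPolynomial (Fin 3) ℂ} {b : ℕ}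
    (hG : IsForm G b) (hb : b + 2 * k ≤ ∑ D ∈ J, D.totalDegree)
    (hQ : ∑ D ∈ J, mult Q D + 1 ≤ mult Q G + k)
    (hP : ∀ P ∈ Z, P ≠ Q → j + ∑ D ∈ J, mult P D ≤ mult P A + mult P G + k) : False := by
  obtain ⟨U, e, hUf, hdeg, hmult⟩ := s.fac.exists_cofactor s.form hJ
  have := s.low k hk (U * G) _ (hUf.mul hG) fun P hPZ => by
    rw [mult_mul P hUf.1 hG.1]
    have h1 := hmult P
    by_cases hPQ : P = Q
    · subst hPQ
      have := s.mult_base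
      omega
    · have := hP P hPZ hPQ
      omega
  omega

lemma totalDegree_le (s : Defect Z Q j d A I x) (hD : D ∈ I) :
    D.totalDegree ≤ mult Q D + 1 := by
  classical
  by_contra hcon
  obtain ⟨c, hc⟩ : ∃ c, D.totalDegree = c + 2 := ⟨D.totalDegree - 2, by omega⟩
  have hg := s.fac.genus hD Z
  rw [← Finset.add_sum_erase _ _ s.mem] at hg
  obtain ⟨G, hG0, hG1, hG2⟩ := exists_form_of_sum_lt Z
    (fun P => if P = Q then mult Q D else mult P D - 1) c (by
      rw [← Finset.add_sum_erase _ _ s.mem, if_pos rfl]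
      have h1 : ∑ P ∈ Z.erase Q, (if P = Q then mult Q D else mult P D - 1) *
          ((if P = Q then mult Q D else mult P D - 1) + 1) =
          ∑ P ∈ Z.erase Q, mult P D * (mult P D - 1) := by
        refine Finset.sum_congr rfl fun P hP => ?_
        rw [if_neg (Finset.ne_of_mem_erase hP)]
        rcases Nat.eq_zero_or_pos (mult P D) with h | h
        · simp [h]
        · rw [Nat.sub_add_cancel h, mul_comm]
      rw [h1]
      rw [hc] at hg hcon
      simp only [Nat.add_sub_cancel, show c + 2 - 1 = c + 1 by omega] at hg
      have h2 : mult Q D * (mult Q D + 1) = mult Q D * (mult Q D - 1) + 2 * mult Q D := by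
        rcases Nat.eq_zero_or_pos (mult Q D) with h | h
        · simp [h]
        · obtain ⟨q, hq⟩ : ∃ q, mult Q D = q + 1 := ⟨_, (Nat.sub_add_cancel h).symm⟩
          rw [hq, Nat.add_sub_cancel]; ring
      nlinarith)
  refine s.exchange (k := 1) (by omega) (J := {D}) (by simpa using hD) ⟨hG0, hG1⟩ (by simp [hc])
    ?_ fun P hPZ hPQ => ?_
  · have := hG2 Q s.mem
    simp only [if_true, Finset.sum_singleton] at this ⊢
    omega
  · have := hG2 P hPZ
    rw [if_neg hPQ] at this
    have := s.le_mult P hPZ hPQ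
    rw [Finset.sum_singleton]
    omega

lemma mem_sections : D ∈ sections I Q ↔ D ∈ I ∧ mult Q D + 1 = D.totalDegree :=
  Finset.mem_filter

lemma mem_lineSections :
    D ∈ lineSections I Q ↔ D ∈ sections I Q ∧ D.totalDegree = 1 := Finset.mem_filter

lemma mem_curveSections :
    D ∈ curveSections I Q ↔ D ∈ sections I Q ∧ ¬ D.totalDegree = 1 := Finset.mem_filter

lemma mem_fibres (s : Defect Z Q j d A I x) :
    D ∈ fibres I Q ↔ D ∈ I ∧ mult Q D = 1 ∧ D.totalDegree = 1 := by
  rw [fibres, Finset.mem_filter]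
  refine and_congr_right fun hD => ⟨fun h => ?_, fun h => by omega⟩
  have h1 := s.totalDegree_le hD
  have h2 := s.fac.one_le_totalDegree hD
  have hg := s.fac.genus hD {Q}
  rw [Finset.sum_singleton] at hg
  obtain ⟨c, hc⟩ : ∃ c, D.totalDegree = c + 1 := ⟨D.totalDegree - 1, by omega⟩
  obtain ⟨q, hq⟩ : ∃ q, mult Q D = c + 1 + q := ⟨mult Q D - (c + 1), by omega⟩
  rw [hq, hc] at hg
  simp only [show c + 1 + q - 1 = c + q by omega, show c + 1 - 1 = c by omega,
    show c + 1 - 2 = c - 1 by omega] at hg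
  have h3 : c * (c - 1) ≤ c * c := Nat.mul_le_mul_left _ (Nat.sub_le _ _)
  have hc0 : c = 0 := by nlinarith
  have hq0 : q = 0 := by subst hc0; nlinarith
  omega

lemma mult_le_one (s : Defect Z Q j d A I x) (hD : D ∈ I) (hPQ : P ≠ Q) : mult P D ≤ 1 := by
  classical
  have hg := s.fac.genus hD {Q, P}
  rw [Finset.sum_pair (Ne.symm hPQ)] at hg
  have h2 := s.fac.one_le_totalDegree hD
  have h1 := s.totalDegree_le hD
  obtain ⟨c, hc⟩ : ∃ c, D.totalDegree = c + 1 := ⟨D.totalDegree - 1, by omega⟩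
  obtain ⟨q, hq⟩ : ∃ q, mult Q D = c + q := ⟨mult Q D - c, by omega⟩
  rw [hq, hc] at hg
  simp only [Nat.add_sub_cancel, show c + 1 - 2 = c - 1 by omega] at hg
  have h3 : c * (c - 1) ≤ (c + q) * (c + q - 1) :=
    Nat.mul_le_mul (by omega) (by omega)
  by_contra hcon
  have h4 : 1 * 1 ≤ mult P D * (mult P D - 1) := Nat.mul_le_mul (by omega) (by omega)
  omega

lemma sum_split (f : MvPolynomial (Fin 3) ℂ → ℕ) :
    ∑ D ∈ I, f D = ∑ D ∈ lineSections I Q, f D + ∑ D ∈ curveSections I Q, f D +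
      ∑ D ∈ fibres I Q, f D := by
  rw [lineSections, curveSections, Finset.sum_filter_add_sum_filter_not, sections, fibres,
    Finset.sum_filter_add_sum_filter_not]

lemma mult_split (s : Defect Z Q j d A I x) (P : ℙ ℂ (Fin 3 → ℂ)) :
    mult P A = ∑ D ∈ lineSections I Q, x D * mult P D + ∑ D ∈ curveSections I Q, x D * mult P D +
      ∑ D ∈ fibres I Q, x D * mult P D := by
  rw [s.fac.mult_eq s.form.1 P, sum_split (Q := Q)]

lemma order_eq (s : Defect Z Q j d A I x) :
    j = ∑ D ∈ curveSections I Q, x D * (D.totalDegree - 1) + ∑ D ∈ fibres I Q, x D + 1 := by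
  rw [s.mult_base, s.mult_split Q]
  have h1 : ∑ D ∈ lineSections I Q, x D * mult Q D = 0 := Finset.sum_eq_zero fun D hD => by
    rw [mem_lineSections, mem_sections] at hD
    rw [show mult Q D = 0 by omega, mul_zero]
  have h2 : ∑ D ∈ curveSections I Q, x D * mult Q D =
      ∑ D ∈ curveSections I Q, x D * (D.totalDegree - 1) := Finset.sum_congr rfl fun D hD => by
    rw [mem_curveSections, mem_sections] at hD
    rw [show mult Q D = D.totalDegree - 1 by omega]
  have h3 : ∑ D ∈ fibres I Q, x D * mult Q D = ∑ D ∈ fibres I Q, x D :=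
    Finset.sum_congr rfl fun D hD => by rw [(s.mem_fibres.mp hD).2.1, mul_one]
  rw [h1, h2, h3]
  ring

lemma degree_add_one_eq (s : Defect Z Q j d A I x) :
    d + 1 = j + (∑ D ∈ lineSections I Q, x D + ∑ D ∈ curveSections I Q, x D) := by
  rw [s.order_eq, s.fac.degree_eq s.form, sum_split (Q := Q)]
  have h1 : ∑ D ∈ lineSections I Q, x D * D.totalDegree = ∑ D ∈ lineSections I Q, x D :=
    Finset.sum_congr rfl fun D hD => by rw [(mem_lineSections.mp hD).2, mul_one]
  have h2 : ∑ D ∈ curveSections I Q, x D * D.totalDegree =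
      ∑ D ∈ curveSections I Q, x D * (D.totalDegree - 1) + ∑ D ∈ curveSections I Q, x D := by
    rw [← Finset.sum_add_distrib]
    refine Finset.sum_congr rfl fun D hD => ?_
    rw [mem_curveSections, mem_sections] at hD
    rw [← Nat.mul_succ, Nat.succ_eq_add_one, Nat.sub_add_cancel (by omega)]
  have h3 : ∑ D ∈ fibres I Q, x D * D.totalDegree = ∑ D ∈ fibres I Q, x D :=
    Finset.sum_congr rfl fun D hD => by rw [(s.mem_fibres.mp hD).2.2, mul_one]
  rw [h1, h2, h3]
  ring

lemma mult_fibres_le (s : Defect Z Q j d A I x) (hPQ : P ≠ Q) :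
    ∑ D ∈ fibres I Q, x D * mult P D ≤ ∑ D ∈ fibres I Q, x D :=
  Finset.sum_le_sum fun D hD => by
    have := s.mult_le_one (s.mem_fibres.mp hD).1 hPQ
    nlinarith

lemma exists_section (s : Defect Z Q j d A I x) (hP : P ∈ Z) (hPQ : P ≠ Q) :
    ∃ D ∈ sections I Q, 1 ≤ mult P D := by
  by_contra! hcon
  have h1 : ∑ D ∈ lineSections I Q, x D * mult P D = 0 := Finset.sum_eq_zero fun D hD => by
    have := hcon D (mem_lineSections.mp hD).1
    rw [show mult P D = 0 by omega, mul_zero]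
  have h2 : ∑ D ∈ curveSections I Q, x D * mult P D = 0 := Finset.sum_eq_zero fun D hD => by
    have := hcon D (mem_curveSections.mp hD).1
    rw [show mult P D = 0 by omega, mul_zero]
  have h3 := s.mult_fibres_le hPQ
  have h4 := s.mult_split P
  have h5 := s.le_mult P hP hPQ
  have h6 := s.order_eq
  omega

/-- Two distinct sections meet in many points of `Z` where the order of `A` is exactly `j`. -/
lemma exists_tight_pair (s : Defect Z Q j d A I x) (hS : S ∈ sections I Q)
    (hT : T ∈ sections I Q) (hST : S ≠ T) :
    ∃ W : Finset (ℙ ℂ (Fin 3 → ℂ)), S.totalDegree + T.totalDegree ≤ W.card + 1 ∧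
      ∀ P ∈ W, P ∈ Z ∧ P ≠ Q ∧ mult P A = j ∧ 1 ≤ mult P S ∧ 1 ≤ mult P T := by
  classical
  rw [mem_sections] at hS hT
  refine ⟨{P ∈ Z | P ≠ Q ∧ mult P A = j ∧ 1 ≤ mult P S ∧ 1 ≤ mult P T}, ?_,
    fun P hP => by simpa using hP⟩
  by_contra hcon
  set W := ({P ∈ Z | P ≠ Q ∧ mult P A = j ∧ 1 ≤ mult P S ∧ 1 ≤ mult P T} : Finset _) with hW
  have hQW : Q ∉ W := by simp [hW]
  have h1 := s.fac.one_le_totalDegree hS.1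
  have h2 := s.fac.one_le_totalDegree hT.1
  obtain ⟨n, hn⟩ : ∃ n, S.totalDegree + T.totalDegree = n + 2 :=
    ⟨S.totalDegree + T.totalDegree - 2, by omega⟩
  obtain ⟨G, hG0, hG1, hG2⟩ := exists_form_of_sum_lt (insert Q W)
    (fun P => if P = Q then n else 1) n (by
      rw [Finset.sum_insert hQW, if_pos rfl, Finset.sum_congr rfl (g := fun _ => 2)
        fun P hP => by rw [if_neg (ne_of_mem_of_not_mem hP hQW)]]
      rw [Finset.sum_const, smul_eq_mul]
      nlinarith)
  refine s.exchange (k := 1) (by omega) (J := {S, T}) (by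
    intro D hD
    rcases Finset.mem_insert.mp hD with rfl | hD
    · exact hS.1
    · rw [Finset.mem_singleton.mp hD]; exact hT.1) ⟨hG0, hG1⟩
    (by rw [Finset.sum_pair hST]; omega) ?_ fun P hPZ hPQ => ?_
  · have := hG2 Q (Finset.mem_insert_self _ _)
    rw [if_pos rfl] at this
    rw [Finset.sum_pair hST]
    omega
  · rw [Finset.sum_pair hST]
    have h3 := s.mult_le_one hS.1 hPQ
    have h4 := s.mult_le_one hT.1 hPQ
    have h5 := s.le_mult P hPZ hPQ
    by_cases hPW : P ∈ W
    · have := hG2 P (Finset.mem_insert_of_mem hPW)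
      rw [if_neg hPQ] at this
      omega
    · have : ¬ (mult P A = j ∧ 1 ≤ mult P S ∧ 1 ≤ mult P T) := fun h =>
        hPW (by rw [hW, Finset.mem_filter]; exact ⟨hPZ, hPQ, h⟩)
      omega

/-- Three distinct sections meet in many points of `Z`. -/
lemma exists_common_triple (s : Defect Z Q j d A I x) (hS : S ∈ sections I Q)
    (hT : T ∈ sections I Q) (hL : L ∈ sections I Q) (hST : S ≠ T) (hSL : S ≠ L) (hTL : T ≠ L)
    (h4 : 4 ≤ L.totalDegree + S.totalDegree + T.totalDegree) :
    ∃ W : Finset (ℙ ℂ (Fin 3 → ℂ)),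
      L.totalDegree + S.totalDegree + T.totalDegree ≤ W.card + 3 ∧
      ∀ P ∈ W, P ∈ Z ∧ P ≠ Q ∧ 1 ≤ mult P S ∧ 1 ≤ mult P T ∧ 1 ≤ mult P L := by
  classical
  rw [mem_sections] at hS hT hL
  refine ⟨{P ∈ Z | P ≠ Q ∧ 1 ≤ mult P S ∧ 1 ≤ mult P T ∧ 1 ≤ mult P L}, ?_,
    fun P hP => by simpa using hP⟩
  by_contra hcon
  set W := ({P ∈ Z | P ≠ Q ∧ 1 ≤ mult P S ∧ 1 ≤ mult P T ∧ 1 ≤ mult P L} : Finset _) with hW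
  have hQW : Q ∉ W := by simp [hW]
  obtain ⟨n, hn⟩ : ∃ n, L.totalDegree + S.totalDegree + T.totalDegree = n + 4 :=
    ⟨L.totalDegree + S.totalDegree + T.totalDegree - 4, by omega⟩
  obtain ⟨G, hG0, hG1, hG2⟩ := exists_form_of_sum_lt (insert Q W)
    (fun P => if P = Q then n else 1) n (by
      rw [Finset.sum_insert hQW, if_pos rfl, Finset.sum_congr rfl (g := fun _ => 2)
        fun P hP => by rw [if_neg (ne_of_mem_of_not_mem hP hQW)]]
      rw [Finset.sum_const, smul_eq_mul]
      nlinarith)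
  have hsum : ∀ f : MvPolynomial (Fin 3) ℂ → ℕ,
      ∑ D ∈ ({S, T, L} : Finset _), f D = f S + f T + f L := fun f => by
    rw [Finset.sum_insert (by simp [hST, hSL]), Finset.sum_pair hTL, add_assoc]
  refine s.exchange (k := 2) (by omega) (J := {S, T, L}) (by
    intro D hD
    simp only [Finset.mem_insert, Finset.mem_singleton] at hD
    rcases hD with rfl | rfl | rfl
    exacts [hS.1, hT.1, hL.1]) ⟨hG0, hG1⟩
    (by rw [hsum]; omega) ?_ fun P hPZ hPQ => ?_
  · have := hG2 Q (Finset.mem_insert_self _ _)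
    rw [if_pos rfl] at this
    rw [hsum]
    omega
  · rw [hsum]
    have h3 := s.mult_le_one hS.1 hPQ
    have h4 := s.mult_le_one hT.1 hPQ
    have h5 := s.mult_le_one hL.1 hPQ
    have h6 := s.le_mult P hPZ hPQ
    by_cases hPW : P ∈ W
    · have := hG2 P (Finset.mem_insert_of_mem hPW)
      rw [if_neg hPQ] at this
      omega
    · have : ¬ (1 ≤ mult P S ∧ 1 ≤ mult P T ∧ 1 ≤ mult P L) := fun h =>
        hPW (by rw [hW, Finset.mem_filter]; exact ⟨hPZ, hPQ, h⟩)
      omega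

end Defect

namespace Defect

variable {Z : Finset (ℙ ℂ (Fin 3 → ℂ))} {Q P R O : ℙ ℂ (Fin 3 → ℂ)} {j d : ℕ}
  {A D S T L M N : MvPolynomial (Fin 3) ℂ} {I : Finset (MvPolynomial (Fin 3) ℂ)}
  {x : MvPolynomial (Fin 3) ℂ → ℕ}

lemma mem_of_mem_sections (h : S ∈ sections I Q) : S ∈ I := (mem_sections.mp h).1

lemma mem_of_mem_lineSections (h : L ∈ lineSections I Q) : L ∈ I :=
  mem_of_mem_sections (mem_lineSections.mp h).1

lemma exists_tight (s : Defect Z Q j d A I x) (hL : L ∈ sections I Q)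
    (hS : S ∈ sections I Q) (hLS : L ≠ S) :
    ∃ O ∈ Z, O ≠ Q ∧ mult O A = j ∧ 1 ≤ mult O L ∧ 1 ≤ mult O S := by
  obtain ⟨W, hW, h⟩ := s.exists_tight_pair hL hS hLS
  have h1 := s.fac.one_le_totalDegree (mem_of_mem_sections hL)
  have h2 := s.fac.one_le_totalDegree (mem_of_mem_sections hS)
  obtain ⟨O, hO⟩ : W.Nonempty := Finset.card_pos.mp (by omega)
  exact ⟨O, h O hO⟩

/-- A curve section passes through the points where a line section meets another section. -/
lemma mult_curve_pos (s : Defect Z Q j d A I x) (hL : L ∈ lineSections I Q)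
    (hS : S ∈ sections I Q) (hLS : L ≠ S) (hT : T ∈ curveSections I Q)
    (hOL : 1 ≤ mult O L) (hOS : 1 ≤ mult O S) : 1 ≤ mult O T := by
  classical
  rw [mem_lineSections] at hL
  rw [mem_curveSections] at hT
  by_cases hST : S = T
  · exact hST ▸ hOS
  have hLT : T ≠ L := fun h => hT.2 (h ▸ hL.2)
  have h1 := s.fac.one_le_totalDegree (mem_of_mem_sections hS)
  have h2 := s.fac.one_le_totalDegree (mem_of_mem_sections hT.1)
  obtain ⟨W, hW, h⟩ := s.exists_common_triple hS hT.1 hL.1 hST (Ne.symm hLS) hLT (by omega)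
  by_contra hcon
  have hOW : O ∉ W := fun hO => hcon (h O hO).2.2.2.1
  have := s.fac.card_le (mem_of_mem_sections hL.1) (mem_of_mem_sections hS) hLS (insert O W)
    fun P hP => by
      rcases Finset.mem_insert.mp hP with rfl | hP
      · exact ⟨hOL, hOS⟩
      · exact ⟨(h P hP).2.2.2.2, (h P hP).2.2.1⟩
  rw [Finset.card_insert_of_notMem hOW, hL.2] at this
  omega

lemma totalDegree_curve (s : Defect Z Q j d A I x) (hL : L ∈ lineSections I Q)
    (hM : M ∈ lineSections I Q) (hLM : L ≠ M) (hT : T ∈ curveSections I Q) :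
    T.totalDegree = 2 := by
  rw [mem_lineSections] at hL hM
  rw [mem_curveSections] at hT
  have hTL : T ≠ L := fun h => hT.2 (h ▸ hL.2)
  have hTM : M ≠ T := fun h => hT.2 (h ▸ hM.2)
  have h2 := s.fac.one_le_totalDegree (mem_of_mem_sections hT.1)
  obtain ⟨W, hW, h⟩ := s.exists_common_triple hM.1 hT.1 hL.1 hTM (Ne.symm hLM) hTL (by omega)
  have := s.fac.card_le (mem_of_mem_sections hL.1) (mem_of_mem_sections hM.1) hLM W
    fun P hP => ⟨(h P hP).2.2.2.2, (h P hP).2.2.1⟩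
  rw [hL.2, hM.2] at this
  omega

lemma eq_of_mem_line (s : Defect Z Q j d A I x) (hL : L ∈ lineSections I Q)
    (hM : M ∈ lineSections I Q) (hLM : L ≠ M) (h1 : 1 ≤ mult P L) (h2 : 1 ≤ mult P M)
    (h3 : 1 ≤ mult R L) (h4 : 1 ≤ mult R M) : P = R := by
  by_contra hne
  exact hLM (s.fac.eq_of_two_points (mem_of_mem_lineSections hL) (mem_of_mem_lineSections hM)
    (mem_lineSections.mp hL).2 (mem_lineSections.mp hM).2 hne h1 h3 h2 h4)

lemma tight_of_lines (s : Defect Z Q j d A I x) (hL : L ∈ lineSections I Q)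
    (hM : M ∈ lineSections I Q) (hLM : L ≠ M) (h1 : 1 ≤ mult P L) (h2 : 1 ≤ mult P M) :
    P ∈ Z ∧ P ≠ Q ∧ mult P A = j := by
  obtain ⟨O, hO, hOQ, hOt, hOL, hOM⟩ := s.exists_tight (mem_lineSections.mp hL).1
    (mem_lineSections.mp hM).1 hLM
  obtain rfl := s.eq_of_mem_line hL hM hLM h1 h2 hOL hOM
  exact ⟨hO, hOQ, hOt⟩

/-- A fibre meets a section at most once away from `Q`. -/
lemma eq_of_mem_fibre (s : Defect Z Q j d A I x) (hD : D ∈ fibres I Q) (hS : S ∈ sections I Q)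
    (hP : P ≠ Q) (hR : R ≠ Q) (h1 : 1 ≤ mult P D) (h2 : 1 ≤ mult R D) (h3 : 1 ≤ mult P S)
    (h4 : 1 ≤ mult R S) : P = R := by
  classical
  by_contra hne
  rw [mem_sections] at hS
  rw [s.mem_fibres] at hD
  have hDS : D ≠ S := by
    rintro rfl
    omega
  have h := s.fac.bezout hD.1 hS.1 hDS {Q, P, R}
  rw [Finset.sum_insert (by simp [Ne.symm hP, Ne.symm hR]), Finset.sum_pair hne, hD.2.1, hD.2.2]
    at h
  nlinarith

lemma fibre_unique (s : Defect Z Q j d A I x) (hD : D ∈ fibres I Q) (hS : S ∈ fibres I Q)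
    (hP : P ≠ Q) (h1 : 1 ≤ mult P D) (h2 : 1 ≤ mult P S) : D = S := by
  rw [s.mem_fibres] at hD hS
  exact s.fac.eq_of_two_points hD.1 hS.1 hD.2.2 hS.2.2 hP h1 (by omega) h2 (by omega)

lemma exists_common_fibre (s : Defect Z Q j d A I x) (hP : P ≠ Q) (hR : R ≠ Q)
    (h : ∑ D ∈ fibres I Q, x D <
      ∑ D ∈ fibres I Q, x D * mult P D + ∑ D ∈ fibres I Q, x D * mult R D) :
    ∃ D ∈ fibres I Q, 1 ≤ mult P D ∧ 1 ≤ mult R D := by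
  by_contra! hcon
  rw [← Finset.sum_add_distrib] at h
  refine absurd h (not_lt.mpr (Finset.sum_le_sum fun D hD => ?_))
  have h1 := hcon D hD
  have h2 := s.mult_le_one (s.mem_fibres.mp hD).1 hP
  have h3 := s.mult_le_one (s.mem_fibres.mp hD).1 hR
  rw [← mul_add]
  have : mult P D + mult R D ≤ 1 := by omega
  nlinarith

lemma sum_curve_le (s : Defect Z Q j d A I x) :
    ∑ D ∈ curveSections I Q, x D ≤ ∑ D ∈ curveSections I Q, x D * (D.totalDegree - 1) :=
  Finset.sum_le_sum fun D hD => by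
    rw [mem_curveSections] at hD
    have := s.fac.one_le_totalDegree (mem_of_mem_sections hD.1)
    exact Nat.le_mul_of_pos_right _ (by omega)

lemma sum_eq_of_forall {J : Finset (MvPolynomial (Fin 3) ℂ)} (s : Defect Z Q j d A I x)
    (hJ : J ⊆ I) (hO : O ≠ Q) (h : ∀ D ∈ J, 1 ≤ mult O D) :
    ∑ D ∈ J, x D * mult O D = ∑ D ∈ J, x D :=
  Finset.sum_congr rfl fun D hD => by
    have := h D hD
    rw [show mult O D = 1 from le_antisymm (s.mult_le_one (hJ hD) hO) this, mul_one]

lemma sum_curve_mult_le (s : Defect Z Q j d A I x) (hP : P ≠ Q) :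
    ∑ D ∈ curveSections I Q, x D * mult P D ≤ ∑ D ∈ curveSections I Q, x D :=
  Finset.sum_le_sum fun D hD => by
    have := s.mult_le_one (mem_of_mem_sections (mem_curveSections.mp hD).1) hP
    nlinarith

lemma lineSections_subset : lineSections I Q ⊆ I := fun _ h => mem_of_mem_lineSections h

lemma curveSections_subset : curveSections I Q ⊆ I :=
  fun _ h => mem_of_mem_sections (mem_curveSections.mp h).1

lemma not_subset_line (s : Defect Z Q j d A I x) (hL : L ∈ lineSections I Q)
    (h : ∀ P ∈ Z, P ≠ Q → P ≠ O → 1 ≤ mult P L) : False := by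
  have hf := s.fac.isForm (mem_of_mem_lineSections hL)
  rw [(mem_lineSections.mp hL).2] at hf
  exact s.noConic.not_line_points hf Q O h

/-- If all sections pass through `O`, every other point lies on a line section. -/
lemma exists_line_of_star (s : Defect Z Q j d A I x) (hO : O ≠ Q)
    (ht : mult O A = j) (h : ∀ S ∈ sections I Q, 1 ≤ mult O S) (hPZ : P ∈ Z) (hPQ : P ≠ Q)
    (hPO : P ≠ O) : ∃ N ∈ lineSections I Q, 1 ≤ mult P N ∧
      j ≤ x N + ∑ D ∈ curveSections I Q, x D + ∑ D ∈ fibres I Q, x D * mult P D := by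
  have hX := s.sum_eq_of_forall lineSections_subset hO fun D hD => h D (mem_lineSections.mp hD).1
  have hy := s.sum_eq_of_forall curveSections_subset hO
    fun D hD => h D (mem_curveSections.mp hD).1
  have hj := s.mult_split O
  have hj2 := s.order_eq
  have hj3 := s.sum_curve_le
  rw [hX, hy, ht] at hj
  have h1 := s.mult_split P
  have h2 := s.le_mult P hPZ hPQ
  have h3 := s.sum_curve_mult_le hPQ
  have h4 := s.mult_fibres_le hPQ
  by_cases hN : ∃ N ∈ lineSections I Q, 1 ≤ mult P N
  · obtain ⟨N, hN, hPN⟩ := hN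
    refine ⟨N, hN, hPN, ?_⟩
    have h5 : mult P N = 1 :=
      le_antisymm (s.mult_le_one (mem_of_mem_lineSections hN) hPQ) hPN
    have h6 : ∑ D ∈ lineSections I Q, x D * mult P D = x N := by
      rw [Finset.sum_eq_single_of_mem N hN, h5, mul_one]
      intro D hD hDN
      rcases Nat.eq_zero_or_pos (mult P D) with h0 | h0
      · rw [h0, mul_zero]
      · exact absurd (s.eq_of_mem_line hD hN hDN h0 hPN (h D (mem_lineSections.mp hD).1)
          (h N (mem_lineSections.mp hN).1)) hPO
    omega
  · push Not at hN
    have h6 : ∑ D ∈ lineSections I Q, x D * mult P D = 0 := Finset.sum_eq_zero fun D hD => by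
      rw [Nat.lt_one_iff.mp (hN D hD), mul_zero]
    omega

lemma exists_fibre_of_star (s : Defect Z Q j d A I x) (hO : O ≠ Q)
    (ht : mult O A = j) (h : ∀ S ∈ sections I Q, 1 ≤ mult O S) (hPZ : P ∈ Z) (hPQ : P ≠ Q)
    (hPO : P ≠ O) (hRZ : R ∈ Z) (hRQ : R ≠ Q) (hRO : R ≠ O) (hN : N ∈ lineSections I Q)
    (hPN : 1 ≤ mult P N) (hRN : ¬ 1 ≤ mult R N) :
    ∃ D ∈ fibres I Q, 1 ≤ mult P D ∧ 1 ≤ mult R D := by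
  classical
  have hX := s.sum_eq_of_forall lineSections_subset hO fun D hD => h D (mem_lineSections.mp hD).1
  have hy := s.sum_eq_of_forall curveSections_subset hO
    fun D hD => h D (mem_curveSections.mp hD).1
  have hj := s.mult_split O
  have hj2 := s.order_eq
  have hj3 := s.sum_curve_le
  rw [hX, hy, ht] at hj
  obtain ⟨N1, hN1, hPN1, hle1⟩ := s.exists_line_of_star hO ht h hPZ hPQ hPO
  obtain ⟨N2, hN2, hRN2, hle2⟩ := s.exists_line_of_star hO ht h hRZ hRQ hRO
  have hN12 : N1 ≠ N2 := by
    rintro rfl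
    by_cases hNN : N = N1
    · exact hRN (hNN ▸ hRN2)
    · exact hPO (s.eq_of_mem_line hN hN1 hNN hPN hPN1 (h N (mem_lineSections.mp hN).1)
        (h N1 (mem_lineSections.mp hN1).1))
  refine s.exists_common_fibre hPQ hRQ ?_
  have : x N1 + x N2 ≤ ∑ D ∈ lineSections I Q, x D := by
    rw [← Finset.sum_pair hN12]
    exact Finset.sum_le_sum_of_subset
      (Finset.insert_subset hN1 (Finset.singleton_subset_iff.mpr hN2))
  omega

/-- Not all sections pass through a common point of `Z` where the order is exactly `j`. -/
lemma not_star (s : Defect Z Q j d A I x) (hL : L ∈ lineSections I Q) (hO : O ≠ Q)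
    (ht : mult O A = j) (h : ∀ S ∈ sections I Q, 1 ≤ mult O S) : False := by
  obtain ⟨P, hPZ, hPQ, hPO⟩ : ∃ P ∈ Z, P ≠ Q ∧ P ≠ O := by
    by_contra! hcon
    exact s.not_subset_line hL (O := O) fun P hP h1 h2 => absurd (hcon P hP h1) h2
  obtain ⟨N, hN, hPN, -⟩ := s.exists_line_of_star hO ht h hPZ hPQ hPO
  obtain ⟨R, hRZ, hRQ, hRO, hRN⟩ : ∃ R ∈ Z, R ≠ Q ∧ R ≠ O ∧ ¬ 1 ≤ mult R N := by
    by_contra! hcon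
    exact s.not_subset_line hN (O := O) fun P hP h1 h2 => hcon P hP h1 h2
  obtain ⟨D, hD, hPD, hRD⟩ :=
    s.exists_fibre_of_star hO ht h hPZ hPQ hPO hRZ hRQ hRO hN hPN hRN
  have hDf := s.fac.isForm (s.mem_fibres.mp hD).1
  rw [(s.mem_fibres.mp hD).2.2] at hDf
  refine s.noConic.not_line_points hDf Q O fun W hW hWQ hWO => ?_
  by_cases hWN : 1 ≤ mult W N
  · obtain ⟨E, hE, hWE, hRE⟩ :=
      s.exists_fibre_of_star hO ht h hW hWQ hWO hRZ hRQ hRO hN hWN hRN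
    exact s.fibre_unique hE hD hRQ hRE hRD ▸ hWE
  · obtain ⟨E, hE, hPE, hWE⟩ :=
      s.exists_fibre_of_star hO ht h hPZ hPQ hPO hW hWQ hWO hN hPN hWN
    exact s.fibre_unique hE hD hPQ hPE hPD ▸ hWE

/-- There is a line among the sections. -/
lemma exists_lineSection (s : Defect Z Q j d A I x) : ∃ L, L ∈ lineSections I Q := by
  classical
  by_contra! hcon
  have h0 : lineSections I Q = ∅ := Finset.eq_empty_of_forall_notMem hcon
  have h1 := s.degree_add_one_eq
  have h2 := s.order_eq
  have h3 := s.sum_curve_le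
  rw [h0, Finset.sum_empty] at h1
  have hpair : ∀ P ∈ Z, P ≠ Q → ∀ R ∈ Z, R ≠ Q → P ≠ R →
      ∃ D ∈ I, D.totalDegree = 1 ∧ 1 ≤ mult P D ∧ 1 ≤ mult R D ∧ 1 ≤ mult Q D := by
    intro P hPZ hPQ R hRZ hRQ hPR
    obtain ⟨l, hl, hlP, hlR⟩ := exists_line_through P R
    have hdvd : l ∣ A := by
      by_contra hndvd
      have h4 := sum_mult_mul_mult_le {P, R} hl.irreducible hl.2 s.form.2 hndvd
      rw [Finset.sum_pair hPR] at h4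
      have h5 := s.le_mult P hPZ hPQ
      have h6 := s.le_mult R hRZ hRQ
      have h7 := Nat.le_mul_of_pos_left (mult P A) hlP
      have h8 := Nat.le_mul_of_pos_left (mult R A) hlR
      omega
    obtain ⟨D, hD, hD1, hDm⟩ := s.fac.exists_line hl hdvd
    refine ⟨D, hD, hD1, hlP.trans_eq (hDm P).symm, hlR.trans_eq (hDm R).symm, ?_⟩
    by_contra hQD
    exact hcon D (mem_lineSections.mpr ⟨mem_sections.mpr ⟨hD, by omega⟩, hD1⟩)
  obtain ⟨l, hl, hlQ, -⟩ := exists_line_through Q Q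
  obtain ⟨P, hPZ, hPQ⟩ : ∃ P ∈ Z, P ≠ Q := by
    by_contra! hcon
    exact s.noConic.not_line_points hl Q Q fun P hP h1 => absurd (hcon P hP) h1
  obtain ⟨R, hRZ, hRQ, hPR⟩ : ∃ R ∈ Z, R ≠ Q ∧ P ≠ R := by
    by_contra! hcon
    exact s.noConic.not_line_points hl Q P fun P hP h1 h2 => absurd (hcon P hP h1).symm h2
  obtain ⟨D, hD, hD1, hPD, -, hQD⟩ := hpair P hPZ hPQ R hRZ hRQ hPR
  have hDf := s.fac.isForm hD
  rw [hD1] at hDf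
  refine s.noConic.not_line_points hDf Q P fun W hW hWQ hWP => ?_
  obtain ⟨E, hE, hE1, hPE, hWE, hQE⟩ := hpair P hPZ hPQ W hW hWQ (Ne.symm hWP)
  exact s.fac.eq_of_two_points hE hD hE1 hD1 hPQ hPE hQE hPD hQD ▸ hWE

end Defect

lemma sum_four {J : Type*} [DecidableEq J] {a b c e : J} (hab : a ≠ b) (hac : a ≠ c) (hae : a ≠ e)
    (hbc : b ≠ c) (hbe : b ≠ e) (hce : c ≠ e) (f : J → ℕ) :
    ∑ i ∈ ({a, b, c, e} : Finset J), f i = f a + f b + f c + f e := by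
  rw [Finset.sum_insert (by simp [hab, hac, hae]), Finset.sum_insert (by simp [hbc, hbe]),
    Finset.sum_pair hce]
  ring

namespace Defect

variable {Z : Finset (ℙ ℂ (Fin 3 → ℂ))} {Q P R O : ℙ ℂ (Fin 3 → ℂ)} {j d : ℕ}
  {A D S T L M N K : MvPolynomial (Fin 3) ℂ} {I : Finset (MvPolynomial (Fin 3) ℂ)}
  {x : MvPolynomial (Fin 3) ℂ → ℕ}

/-- Four lines among the factors, at most one of them through `Q`, have a triple point. -/
lemma exists_triple_point (s : Defect Z Q j d A I x) (hL : L ∈ lineSections I Q)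
    (hM : M ∈ lineSections I Q) (hN : N ∈ lineSections I Q) (hK : K ∈ I)
    (hK1 : K.totalDegree = 1) (hKQ : mult Q K ≤ 1) (hLM : L ≠ M) (hLN : L ≠ N) (hMN : M ≠ N)
    (hKL : L ≠ K) (hKM : M ≠ K) (hKN : N ≠ K) :
    ∃ P, P ≠ Q ∧ 3 ≤ mult P L + mult P M + mult P N + mult P K := by
  classical
  by_contra! hcon
  have hsum := sum_four hLM hLN hKL hMN hKM hKN
  have hLI := mem_of_mem_lineSections hL
  have hMI := mem_of_mem_lineSections hM
  have hNI := mem_of_mem_lineSections hN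
  rw [mem_lineSections, mem_sections] at hL hM hN
  refine s.exchange (k := 2) le_rfl (J := {L, M, N, K}) (by
    intro D hD
    simp only [Finset.mem_insert, Finset.mem_singleton] at hD
    rcases hD with rfl | rfl | rfl | rfl
    exacts [hLI, hMI, hNI, hK]) isForm_one ?_ ?_ fun P hPZ hPQ => ?_
  · rw [hsum]; omega
  · rw [hsum]; omega
  · rw [hsum]
    have h1 := hcon P hPQ
    have h2 := s.le_mult P hPZ hPQ
    omega

lemma order_eq_of_lines (s : Defect Z Q j d A I x) (hL : L ∈ lineSections I Q)
    (hM : M ∈ lineSections I Q) (hLM : L ≠ M) :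
    j = ∑ D ∈ curveSections I Q, x D + ∑ D ∈ fibres I Q, x D + 1 := by
  have h : ∑ D ∈ curveSections I Q, x D * (D.totalDegree - 1) = ∑ D ∈ curveSections I Q, x D :=
    Finset.sum_congr rfl fun D hD => by
      rw [s.totalDegree_curve hL hM hLM hD, show (2 - 1 : ℕ) = 1 from rfl, mul_one]
  rw [← h]
  exact s.order_eq

lemma order_eq_vertex (s : Defect Z Q j d A I x) (hL : L ∈ lineSections I Q)
    (hM : M ∈ lineSections I Q) (hLM : L ≠ M) (h1 : 1 ≤ mult P L) (h2 : 1 ≤ mult P M) :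
    j = ∑ D ∈ lineSections I Q, x D * mult P D + ∑ D ∈ curveSections I Q, x D +
      ∑ D ∈ fibres I Q, x D * mult P D := by
  obtain ⟨-, hPQ, ht⟩ := s.tight_of_lines hL hM hLM h1 h2
  rw [← s.sum_eq_of_forall curveSections_subset hPQ fun D hD =>
    s.mult_curve_pos hL (mem_lineSections.mp hM).1 hLM hD h1 h2, ← s.mult_split P, ht]

lemma ne_of_mem_fibres (s : Defect Z Q j d A I x) (hL : L ∈ lineSections I Q)
    (hD : D ∈ fibres I Q) : L ≠ D := by
  rintro rfl
  rw [mem_lineSections, mem_sections] at hL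
  rw [s.mem_fibres] at hD
  omega

/-- Each fibre passes through a vertex of a triangle of line sections. -/
lemma fibre_vertex (s : Defect Z Q j d A I x) (hL : L ∈ lineSections I Q)
    (hM : M ∈ lineSections I Q) (hN : N ∈ lineSections I Q) (hLM : L ≠ M) (hLN : L ≠ N)
    (hMN : M ≠ N) (h : ∀ P, 1 ≤ mult P L → 1 ≤ mult P M → ¬ 1 ≤ mult P N)
    (hD : D ∈ fibres I Q) {U V W : ℙ ℂ (Fin 3 → ℂ)} (hUM : 1 ≤ mult U M) (hUN : 1 ≤ mult U N)
    (hVL : 1 ≤ mult V L) (hVN : 1 ≤ mult V N) (hWL : 1 ≤ mult W L) (hWM : 1 ≤ mult W M) :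
    1 ≤ mult U D ∨ 1 ≤ mult V D ∨ 1 ≤ mult W D := by
  have hD' := s.mem_fibres.mp hD
  obtain ⟨P, hPQ, hP⟩ := s.exists_triple_point hL hM hN hD'.1 hD'.2.2 hD'.2.1.le hLM hLN hMN
    (s.ne_of_mem_fibres hL hD) (s.ne_of_mem_fibres hM hD) (s.ne_of_mem_fibres hN hD)
  have h1 := s.mult_le_one (mem_of_mem_lineSections hL) hPQ
  have h2 := s.mult_le_one (mem_of_mem_lineSections hM) hPQ
  have h3 := s.mult_le_one (mem_of_mem_lineSections hN) hPQ
  have h4 := s.mult_le_one hD'.1 hPQ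
  have h5 := h P
  have hPD : 1 ≤ mult P D := by omega
  by_cases hPL : 1 ≤ mult P L
  · by_cases hPM : 1 ≤ mult P M
    · exact Or.inr (Or.inr (s.eq_of_mem_line hL hM hLM hPL hPM hWL hWM ▸ hPD))
    · have hPN : 1 ≤ mult P N := by omega
      exact Or.inr (Or.inl (s.eq_of_mem_line hL hN hLN hPL hPN hVL hVN ▸ hPD))
  · have hPM : 1 ≤ mult P M := by omega
    have hPN : 1 ≤ mult P N := by omega
    exact Or.inl (s.eq_of_mem_line hM hN hMN hPM hPN hUM hUN ▸ hPD)

/-- Three line sections through a point `O` and a fourth one off `O` do not coexist. -/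
lemma not_three_concurrent (s : Defect Z Q j d A I x) (hL : L ∈ lineSections I Q)
    (hM : M ∈ lineSections I Q) (hN : N ∈ lineSections I Q) (hK : K ∈ lineSections I Q)
    (hLM : L ≠ M) (hLN : L ≠ N) (hMN : M ≠ N) (hOL : 1 ≤ mult O L) (hOM : 1 ≤ mult O M)
    (hON : 1 ≤ mult O N) (hOK : ¬ 1 ≤ mult O K) : False := by
  classical
  have hKL : L ≠ K := fun h => hOK (h ▸ hOL)
  have hKM : M ≠ K := fun h => hOK (h ▸ hOM)
  have hKN : N ≠ K := fun h => hOK (h ▸ hON)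
  have hs := fun {D} (h : D ∈ lineSections I Q) => (mem_lineSections.mp h).1
  obtain ⟨U, -, hUQ, -, hUL, hUK⟩ := s.exists_tight (hs hL) (hs hK) hKL
  obtain ⟨V, -, hVQ, -, hVM, hVK⟩ := s.exists_tight (hs hM) (hs hK) hKM
  obtain ⟨W, -, hWQ, -, hWN, hWK⟩ := s.exists_tight (hs hN) (hs hK) hKN
  obtain ⟨-, hOQ, -⟩ := s.tight_of_lines hL hM hLM hOL hOM
  have hUO : U ≠ O := fun h => hOK (h ▸ hUK)
  have hVO : V ≠ O := fun h => hOK (h ▸ hVK)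
  have hUV : U ≠ V := fun h => hUO (s.eq_of_mem_line hL hM hLM hUL (h ▸ hVM) hOL hOM)
  have hUW : U ≠ W := fun h => hUO (s.eq_of_mem_line hL hN hLN hUL (h ▸ hWN) hOL hON)
  have hVW : V ≠ W := fun h => hVO (s.eq_of_mem_line hM hN hMN hVM (h ▸ hWN) hOM hON)
  have htri : ∀ {B C : MvPolynomial (Fin 3) ℂ}, B ∈ lineSections I Q → C ∈ lineSections I Q →
      B ≠ C → 1 ≤ mult O B → 1 ≤ mult O C → ∀ P, 1 ≤ mult P B → 1 ≤ mult P C →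
      ¬ 1 ≤ mult P K := fun hB hC hBC h1 h2 P h3 h4 h5 =>
    hOK (s.eq_of_mem_line hB hC hBC h3 h4 h1 h2 ▸ h5)
  have hfib : ∀ D ∈ fibres I Q, 1 ≤ mult O D := by
    intro D hD
    by_contra hOD
    have h1 := s.fibre_vertex hL hM hK hLM hKL hKM (htri hL hM hLM hOL hOM) hD
      hVM hVK hUL hUK hOL hOM
    have h2 := s.fibre_vertex hL hN hK hLN hKL hKN (htri hL hN hLN hOL hON) hD
      hWN hWK hUL hUK hOL hON
    have h3 := s.fibre_vertex hM hN hK hMN hKM hKN (htri hM hN hMN hOM hON) hD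
      hWN hWK hVM hVK hOM hON
    have huv : ¬ (1 ≤ mult U D ∧ 1 ≤ mult V D) := fun h =>
      hUV (s.eq_of_mem_fibre hD (hs hK) hUQ hVQ h.1 h.2 hUK hVK)
    have huw : ¬ (1 ≤ mult U D ∧ 1 ≤ mult W D) := fun h =>
      hUW (s.eq_of_mem_fibre hD (hs hK) hUQ hWQ h.1 h.2 hUK hWK)
    have hvw : ¬ (1 ≤ mult V D ∧ 1 ≤ mult W D) := fun h =>
      hVW (s.eq_of_mem_fibre hD (hs hK) hVQ hWQ h.1 h.2 hVK hWK)
    omega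
  have hv := s.sum_eq_of_forall (fun D hD => (s.mem_fibres.mp hD).1) hOQ hfib
  have h1 := s.order_eq_vertex hL hM hLM hOL hOM
  have h2 := s.order_eq_of_lines hL hM hLM
  have h3 : ∑ D ∈ ({L, M} : Finset _), x D * mult O D ≤
      ∑ D ∈ lineSections I Q, x D * mult O D :=
    Finset.sum_le_sum_of_subset (Finset.insert_subset hL (Finset.singleton_subset_iff.mpr hM))
  rw [Finset.sum_pair hLM] at h3
  have h4 : 1 * 1 ≤ x L * mult O L :=
    Nat.mul_le_mul (s.fac.one_le L (mem_of_mem_lineSections hL)) hOL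
  have h5 : 1 * 1 ≤ x M * mult O M :=
    Nat.mul_le_mul (s.fac.one_le M (mem_of_mem_lineSections hM)) hOM
  omega

/-- The line sections are not the sides of a triangle. -/
lemma not_triangle (s : Defect Z Q j d A I x)
    (hI : ∀ D, D ∈ lineSections I Q ↔ D = L ∨ D = M ∨ D = N)
    (hLM : L ≠ M) (hLN : L ≠ N) (hMN : M ≠ N)
    (h : ∀ P, 1 ≤ mult P L → 1 ≤ mult P M → ¬ 1 ≤ mult P N) : False := by
  classical
  have hL := (hI L).mpr (by tauto)
  have hM := (hI M).mpr (by tauto)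
  have hN := (hI N).mpr (by tauto)
  have hs := fun {D} (h : D ∈ lineSections I Q) => (mem_lineSections.mp h).1
  obtain ⟨U, -, hUQ, -, hUM, hUN⟩ := s.exists_tight (hs hM) (hs hN) hMN
  obtain ⟨V, -, hVQ, -, hVL, hVN⟩ := s.exists_tight (hs hL) (hs hN) hLN
  obtain ⟨W, -, hWQ, -, hWL, hWM⟩ := s.exists_tight (hs hL) (hs hM) hLM
  have hv : ∑ D ∈ fibres I Q, x D = ∑ D ∈ fibres I Q, x D * mult U D +
      ∑ D ∈ fibres I Q, x D * mult V D + ∑ D ∈ fibres I Q, x D * mult W D := by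
    rw [← Finset.sum_add_distrib, ← Finset.sum_add_distrib]
    refine Finset.sum_congr rfl fun D hD => ?_
    rw [← mul_add, ← mul_add]
    have h1 := s.fibre_vertex hL hM hN hLM hLN hMN h hD hUM hUN hVL hVN hWL hWM
    have huv : ¬ (1 ≤ mult U D ∧ 1 ≤ mult V D) := fun hh => h U
      (s.eq_of_mem_fibre hD (hs hN) hUQ hVQ hh.1 hh.2 hUN hVN ▸ hVL) hUM hUN
    have huw : ¬ (1 ≤ mult U D ∧ 1 ≤ mult W D) := fun hh => h U
      (s.eq_of_mem_fibre hD (hs hM) hUQ hWQ hh.1 hh.2 hUM hWM ▸ hWL) hUM hUN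
    have hvw : ¬ (1 ≤ mult V D ∧ 1 ≤ mult W D) := fun hh => h V hVL
      (s.eq_of_mem_fibre hD (hs hL) hVQ hWQ hh.1 hh.2 hVL hWL ▸ hWM) hVN
    have h2 := s.mult_le_one (s.mem_fibres.mp hD).1 hUQ
    have h3 := s.mult_le_one (s.mem_fibres.mp hD).1 hVQ
    have h4 := s.mult_le_one (s.mem_fibres.mp hD).1 hWQ
    rw [show mult U D + mult V D + mult W D = 1 by omega, mul_one]
  have hlin : lineSections I Q = {L, M, N} := by
    ext D
    simp [hI]
  have hsum : ∀ P, ∑ D ∈ lineSections I Q, x D * mult P D =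
      x L * mult P L + x M * mult P M + x N * mult P N := fun P => by
    rw [hlin, Finset.sum_insert (by simp [hLM, hLN]), Finset.sum_pair hMN, add_assoc]
  have hone : ∀ {P D}, P ≠ Q → D ∈ lineSections I Q → 1 ≤ mult P D → mult P D = 1 :=
    fun hP hD h1 => le_antisymm (s.mult_le_one (mem_of_mem_lineSections hD) hP) h1
  have hU := s.order_eq_vertex hM hN hMN hUM hUN
  have hV := s.order_eq_vertex hL hN hLN hVL hVN
  have hW := s.order_eq_vertex hL hM hLM hWL hWM
  have hj := s.order_eq_of_lines hL hM hLM
  rw [hsum, hone hUQ hM hUM, hone hUQ hN hUN,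
    Nat.lt_one_iff.mp (not_le.mp fun hh => h U hh hUM hUN)] at hU
  rw [hsum, hone hVQ hL hVL, hone hVQ hN hVN,
    Nat.lt_one_iff.mp (not_le.mp fun hh => h V hVL hh hVN)] at hV
  rw [hsum, hone hWQ hL hWL, hone hWQ hM hWM,
    Nat.lt_one_iff.mp (not_le.mp fun hh => h W hWL hWM hh)] at hW
  omega

lemma elim (s : Defect Z Q j d A I x) : False := by
  obtain ⟨L, hL⟩ := s.exists_lineSection
  have hs := fun {D} (h : D ∈ lineSections I Q) => (mem_lineSections.mp h).1
  by_cases hM : ∃ M ∈ lineSections I Q, L ≠ M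
  · obtain ⟨M, hM, hLM⟩ := hM
    obtain ⟨O, hOZ, hOQ, hOt, hOL, hOM⟩ := s.exists_tight (hs hL) (hs hM) hLM
    by_cases hN : ∃ N ∈ lineSections I Q, ¬ 1 ≤ mult O N
    · obtain ⟨N, hN, hON⟩ := hN
      have hLN : L ≠ N := fun h => hON (h ▸ hOL)
      have hMN : M ≠ N := fun h => hON (h ▸ hOM)
      have htri : ∀ P, 1 ≤ mult P L → 1 ≤ mult P M → ¬ 1 ≤ mult P N := fun P h1 h2 h3 =>
        hON (s.eq_of_mem_line hL hM hLM h1 h2 hOL hOM ▸ h3)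
      by_cases hK : ∃ K ∈ lineSections I Q, K ≠ L ∧ K ≠ M ∧ K ≠ N
      · obtain ⟨K, hK, hKL, hKM, hKN⟩ := hK
        have hK' := hK
        rw [mem_lineSections, mem_sections] at hK'
        obtain ⟨P, hPQ, hP⟩ := s.exists_triple_point hL hM hN hK'.1.1 hK'.2 (by omega) hLM hLN hMN
          (Ne.symm hKL) (Ne.symm hKM) (Ne.symm hKN)
        have h1 := s.mult_le_one (mem_of_mem_lineSections hL) hPQ
        have h2 := s.mult_le_one (mem_of_mem_lineSections hM) hPQ
        have h3 := s.mult_le_one (mem_of_mem_lineSections hN) hPQ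
        have h4 := s.mult_le_one hK'.1.1 hPQ
        have h5 := htri P
        by_cases hPL : 1 ≤ mult P L
        · by_cases hPM : 1 ≤ mult P M
          · exact s.not_three_concurrent hL hM hK hN hLM (Ne.symm hKL) (Ne.symm hKM) hPL hPM
              (by omega) (by omega)
          · exact s.not_three_concurrent hL hN hK hM hLN (Ne.symm hKL) (Ne.symm hKN) hPL
              (by omega) (by omega) hPM
        · exact s.not_three_concurrent hM hN hK hL hMN (Ne.symm hKM) (Ne.symm hKN) (by omega)
            (by omega) (by omega) hPL
      · push Not at hK
        refine s.not_triangle (L := L) (M := M) (N := N) (fun D => ⟨fun hD => ?_, ?_⟩) hLM hLN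
          hMN htri
        · by_contra! hcon
          exact hcon.2.2 (hK D hD hcon.1 hcon.2.1)
        · rintro (rfl | rfl | rfl)
          exacts [hL, hM, hN]
    · push Not at hN
      refine s.not_star hL hOQ hOt fun S hS => ?_
      by_cases hS1 : S.totalDegree = 1
      · exact hN S (mem_lineSections.mpr ⟨hS, hS1⟩)
      · exact s.mult_curve_pos hL (hs hM) hLM (mem_curveSections.mpr ⟨hS, hS1⟩) hOL hOM
  · push Not at hM
    by_cases hS : ∃ S ∈ sections I Q, L ≠ S
    · obtain ⟨S, hS, hLS⟩ := hS
      obtain ⟨O, hOZ, hOQ, hOt, hOL, hOS⟩ := s.exists_tight (hs hL) hS hLS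
      refine s.not_star hL hOQ hOt fun T hT => ?_
      by_cases hT1 : T.totalDegree = 1
      · exact hM T (mem_lineSections.mpr ⟨hT, hT1⟩) ▸ hOL
      · exact s.mult_curve_pos hL hS hLS (mem_curveSections.mpr ⟨hT, hT1⟩) hOL hOS
    · push Not at hS
      refine s.not_subset_line hL (O := Q) fun P hP hPQ _ => ?_
      obtain ⟨D, hD, hPD⟩ := s.exists_section hP hPQ
      exact hS D hD ▸ hPD

end Defect

/-- If forms of order `j - k` on `Z` have degree `≥ a - 2 * k` for `k ≤ 2`, there is no form of
degree `a - 1` vanishing to order `j` on `Z` except for a drop by one at a single point. -/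
lemma NoConic.lt_degree {Z : Finset (ℙ ℂ (Fin 3 → ℂ))} (hZ : NoConic Z) {j a : ℕ}
    (low : ∀ k ≤ 2, ∀ H e, IsForm H e → (∀ P ∈ Z, j ≤ mult P H + k) → a ≤ e + 2 * k)
    {A : MvPolynomial (Fin 3) ℂ} {d : ℕ} (hA : IsForm A d) {Q : ℙ ℂ (Fin 3 → ℂ)}
    (hAQ : j ≤ mult Q A + 1) (hAP : ∀ P ∈ Z, P ≠ Q → j ≤ mult P A) : a ≤ d := by
  by_contra hcon
  have hlow : ∀ k ≤ 2, ∀ H e, IsForm H e → (∀ P ∈ Z, j ≤ mult P H + k) → d + 1 ≤ e + 2 * k :=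
    fun k hk H e hH h => le_trans (by omega) (low k hk H e hH h)
  obtain ⟨hQ, hQA⟩ : Q ∈ Z ∧ ¬ j ≤ mult Q A := by
    by_contra hh
    have := hlow 0 (by omega) A d hA fun P hP => by
      by_cases hPQ : P = Q
      · subst hPQ; by_contra h0; exact hh ⟨hP, h0⟩
      · exact hAP P hP hPQ
    omega
  obtain ⟨I, x, hf⟩ := hA.exists_isFactorization
  exact Defect.elim ⟨hZ, hQ, hlow, hA, by omega, hAP, hf⟩

/-- A form `F` of least degree `d` among those of order `m` on `Z`, where the least degrees
for the orders `m - k` with `k ≤ 4` are at least `d - 2 * k`. -/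
structure Extremal (Z : Finset (ℙ ℂ (Fin 3 → ℂ))) (m d : ℕ)
    (F : MvPolynomial (Fin 3) ℂ) (I : Finset (MvPolynomial (Fin 3) ℂ))
    (x : MvPolynomial (Fin 3) ℂ → ℕ) : Prop where
  noConic : NoConic Z
  one_le : 1 ≤ m
  low : ∀ k ≤ 4, ∀ H e, IsForm H e → (∀ P ∈ Z, m ≤ mult P H + k) → d ≤ e + 2 * k
  pred : ∃ H e, IsForm H e ∧ e + 2 ≤ d ∧ ∀ P ∈ Z, m ≤ mult P H + 1
  form : IsForm F d
  le_mult : ∀ P ∈ Z, m ≤ mult P F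
  fac : IsFactorization F I x
  conic : ∀ C ∈ I, C.totalDegree = 2 → ∃ T : Finset (ℙ ℂ (Fin 3 → ℂ)), 5 ≤ T.card ∧
    ∀ P ∈ T, P ∈ Z ∧ mult P F = m ∧ 1 ≤ mult P C

namespace Extremal

variable {Z : Finset (ℙ ℂ (Fin 3 → ℂ))} {Q P R O : ℙ ℂ (Fin 3 → ℂ)} {m d : ℕ}
  {F D : MvPolynomial (Fin 3) ℂ} {I : Finset (MvPolynomial (Fin 3) ℂ)}
  {x : MvPolynomial (Fin 3) ℂ → ℕ}

/-- Replacing the product of the factors in `J` by a form `G` cannot lower the degree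
too much, even if the order drops once more at a single point. -/
lemma exchange (s : Extremal Z m d F I x) {k : ℕ} (hk : k ≤ 2)
    {J : Finset (MvPolynomial (Fin 3) ℂ)} (hJ : J ⊆ I) {G : MvPolynomial (Fin 3) ℂ} {b : ℕ}
    (hG : IsForm G b) (hb : b + 2 * k + 1 ≤ ∑ D ∈ J, D.totalDegree) (Q : ℙ ℂ (Fin 3 → ℂ))
    (hQ : m + ∑ D ∈ J, mult Q D ≤ mult Q F + mult Q G + k + 1)
    (hP : ∀ P ∈ Z, P ≠ Q → m + ∑ D ∈ J, mult P D ≤ mult P F + mult P G + k) : False := by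
  obtain ⟨U, e, hU, hdeg, hmult⟩ := s.fac.exists_cofactor s.form hJ
  have := s.noConic.lt_degree (j := m - k) (a := d - 2 * k) (A := U * G) (d := e + b) (Q := Q)
    (fun l hl H e hH h => by
      have := s.low (k + l) (by omega) H e hH fun P hP => by
        have := h P hP
        omega
      omega) (hU.mul hG)
    (by
      rw [mult_mul Q hU.1 hG.1]
      have := hmult Q
      omega)
    (fun P hPZ hPQ => by
      rw [mult_mul P hU.1 hG.1]
      have := hmult P
      have := hP P hPZ hPQ
      omega)
  omega

/-- Factors of total degree `2 * k + 1` pass sufficiently often through points of `Z`. -/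
lemma exists_excess (s : Extremal Z m d F I x) {k : ℕ} (hk : k ≤ 2)
    {J : Finset (MvPolynomial (Fin 3) ℂ)} (hJ : J ⊆ I)
    (hb : 2 * k + 1 ≤ ∑ D ∈ J, D.totalDegree) :
    (∃ P ∈ Z, mult P F + k + 2 ≤ m + ∑ D ∈ J, mult P D) ∨
    ∃ P ∈ Z, ∃ R ∈ Z, P ≠ R ∧ mult P F + k + 1 ≤ m + ∑ D ∈ J, mult P D ∧
      mult R F + k + 1 ≤ m + ∑ D ∈ J, mult R D := by
  by_contra! hcon
  obtain ⟨h1, h2⟩ := hcon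
  have hne : ∃ Q, Q ∈ Z := by
    have := s.noConic.six_le_card
    exact Finset.card_pos.mp (by omega)
  obtain ⟨Q, hQZ, hQ⟩ : ∃ Q ∈ Z, ∀ P ∈ Z, P ≠ Q → m + ∑ D ∈ J, mult P D ≤ mult P F + k := by
    by_cases hQ : ∃ Q ∈ Z, mult Q F + k + 1 ≤ m + ∑ D ∈ J, mult Q D
    · obtain ⟨Q, hQZ, hQ⟩ := hQ
      exact ⟨Q, hQZ, fun P hP hPQ => by have := h2 Q hQZ P hP (Ne.symm hPQ) hQ; omega⟩
    · push Not at hQ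
      obtain ⟨Q, hQZ⟩ := hne
      exact ⟨Q, hQZ, fun P hP _ => by have := hQ P hP; omega⟩
  refine s.exchange hk hJ isForm_one (by omega) Q ?_ fun P hPZ hPQ => ?_
  · have := h1 Q hQZ
    omega
  · have := hQ P hPZ hPQ
    omega

lemma totalDegree_le_two (s : Extremal Z m d F I x) (hD : D ∈ I) : D.totalDegree ≤ 2 := by
  classical
  by_contra hcon
  obtain ⟨c, hc⟩ : ∃ c, D.totalDegree = c + 3 := ⟨D.totalDegree - 3, by omega⟩
  have hg := s.fac.genus hD Z
  rw [hc, show c + 3 - 1 = c + 2 by omega, show c + 3 - 2 = c + 1 by omega] at hg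
  obtain ⟨P₀, hP₀⟩ : ∃ Q, Q ∈ Z := by
    have := s.noConic.six_le_card
    exact Finset.card_pos.mp (by omega)
  have hred : ∀ n : ℕ, (n - 1) * (n - 1 + 1) = n * (n - 1) := fun n => by
    rcases n with _ | n
    · rfl
    · simp [mul_comm]
  obtain ⟨Q, hQZ, G, hG, hGQ, hGP⟩ : ∃ Q ∈ Z, ∃ G, IsForm G c ∧ mult Q D ≤ mult Q G + 2 ∧
      ∀ P ∈ Z, P ≠ Q → mult P D ≤ mult P G + 1 := by
    by_cases hQ : ∃ Q ∈ Z, 2 ≤ mult Q D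
    · obtain ⟨Q, hQZ, hQ⟩ := hQ
      obtain ⟨G, hG0, hG1, hG2⟩ := exists_form_of_sum_lt Z
        (fun P => if P = Q then mult Q D - 2 else mult P D - 1) c (by
          rw [← Finset.add_sum_erase _ _ hQZ] at hg ⊢
          rw [if_pos rfl, Finset.sum_congr rfl (g := fun P => mult P D * (mult P D - 1))
            fun P hP => by rw [if_neg (Finset.ne_of_mem_erase hP), hred]]
          obtain ⟨q, hq⟩ : ∃ q, mult Q D = q + 2 := ⟨mult Q D - 2, by omega⟩
          rw [hq, show q + 2 - 1 = q + 1 by omega] at hg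
          rw [hq, show q + 2 - 2 = q by omega]
          nlinarith)
      refine ⟨Q, hQZ, G, ⟨hG0, hG1⟩, ?_, fun P hP hPQ => ?_⟩
      · have := hG2 Q hQZ
        rw [if_pos rfl] at this
        omega
      · have := hG2 P hP
        rw [if_neg hPQ] at this
        omega
    · push Not at hQ
      obtain ⟨G, hG0, hG1, hG2⟩ := exists_form_of_sum_lt Z (fun _ => 0) c (by simp)
      refine ⟨P₀, hP₀, G, ⟨hG0, hG1⟩, ?_, fun P hP hPQ => ?_⟩
      · have := hQ _ hP₀
        omega
      · have := hQ _ hP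
        omega
  refine s.exchange (k := 1) (by omega) (J := {D}) (by simpa using hD) hG
    (by rw [Finset.sum_singleton]; omega) Q ?_ fun P hP hPQ => ?_
  · rw [Finset.sum_singleton]
    have := s.le_mult Q hQZ
    omega
  · rw [Finset.sum_singleton]
    have := s.le_mult P hP
    have := hGP P hP hPQ
    omega

lemma totalDegree_eq (s : Extremal Z m d F I x) (hD : D ∈ I) :
    D.totalDegree = 1 ∨ D.totalDegree = 2 := by
  have h1 := s.totalDegree_le_two hD
  have h2 := s.fac.one_le_totalDegree hD
  omega

lemma mult_le_one (s : Extremal Z m d F I x) (hD : D ∈ I) (P : ℙ ℂ (Fin 3 → ℂ)) :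
    mult P D ≤ 1 := by
  have hg := s.fac.genus hD {P}
  rw [Finset.sum_singleton] at hg
  by_contra hcon
  have h4 : 1 * 1 ≤ mult P D * (mult P D - 1) := Nat.mul_le_mul (by omega) (by omega)
  rcases s.totalDegree_eq hD with h | h
  · rw [h] at hg
    omega
  · rw [h] at hg
    omega

end Extremal

lemma exists_three_of_card_le {α : Type*} [Nonempty α] {T : Finset α} (h : T.card ≤ 3) :
    ∃ a b c, ∀ p ∈ T, p = a ∨ p = b ∨ p = c := by
  classical
  obtain ⟨o⟩ := ‹Nonempty α›
  rcases Nat.lt_or_ge T.card 1 with h0 | h0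
  · rw [Nat.lt_one_iff, Finset.card_eq_zero] at h0
    exact ⟨o, o, o, by simp [h0]⟩
  obtain ⟨a, ha⟩ := Finset.card_pos.mp h0
  rcases Nat.lt_or_ge T.card 3 with h1 | h1
  · have h2 : (T.erase a).card ≤ 1 := by rw [Finset.card_erase_of_mem ha]; omega
    rcases Finset.eq_empty_or_nonempty (T.erase a) with h3 | ⟨b, hb⟩
    · refine ⟨a, a, a, fun p hp => Or.inl ?_⟩
      by_contra hpa
      exact Finset.notMem_empty p (h3 ▸ Finset.mem_erase.mpr ⟨hpa, hp⟩)
    · refine ⟨a, b, b, fun p hp => ?_⟩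
      by_cases hpa : p = a
      · exact Or.inl hpa
      · exact Or.inr (Or.inl (Finset.card_le_one.mp h2 p (Finset.mem_erase.mpr ⟨hpa, hp⟩) b hb))
  · obtain ⟨a, b, c, -, -, -, rfl⟩ := Finset.card_eq_three.mp (le_antisymm h h1)
    exact ⟨a, b, c, by simp⟩

namespace Extremal

variable {Z : Finset (ℙ ℂ (Fin 3 → ℂ))} {Q P R O : ℙ ℂ (Fin 3 → ℂ)} {m d : ℕ}
  {F C D E : MvPolynomial (Fin 3) ℂ} {I J : Finset (MvPolynomial (Fin 3) ℂ)}
  {x : MvPolynomial (Fin 3) ℂ → ℕ}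

lemma sum_mult_le (s : Extremal Z m d F I x) (hJ : J ⊆ I) (P : ℙ ℂ (Fin 3 → ℂ)) :
    ∑ D ∈ J, mult P D ≤ J.card := by
  rw [Finset.card_eq_sum_ones]
  exact Finset.sum_le_sum fun D hD => s.mult_le_one (hJ hD) P

lemma mult_pos_of_card_le_sum (s : Extremal Z m d F I x) (hJ : J ⊆ I)
    (h : J.card ≤ ∑ D ∈ J, mult P D) : ∀ D ∈ J, 1 ≤ mult P D := by
  classical
  intro D hD
  have h1 := s.sum_mult_le ((Finset.erase_subset D J).trans hJ) P
  rw [← Finset.add_sum_erase _ _ hD] at h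
  rw [Finset.card_erase_of_mem hD] at h1
  have := Finset.card_pos.mpr ⟨D, hD⟩
  omega

/-- Two or three conics among the factors share four points of `Z` of exact order `m`. -/
lemma exists_common_four (s : Extremal Z m d F I x) {k : ℕ} (hk : k ≤ 2) (hJ : J ⊆ I)
    (hcard : J.card = k + 1) (hdeg : 2 * k + 2 ≤ ∑ D ∈ J, D.totalDegree) :
    ∃ W : Finset (ℙ ℂ (Fin 3 → ℂ)), 4 ≤ W.card ∧
      ∀ P ∈ W, P ∈ Z ∧ mult P F = m ∧ ∀ D ∈ J, 1 ≤ mult P D := by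
  classical
  refine ⟨{P ∈ Z | mult P F = m ∧ ∀ D ∈ J, 1 ≤ mult P D}, ?_, fun P hP => by simpa using hP⟩
  by_contra hcon
  have hne : Nonempty (ℙ ℂ (Fin 3 → ℂ)) := by
    have := s.noConic.six_le_card
    obtain ⟨Q, -⟩ := Finset.card_pos.mp (show 0 < Z.card by omega)
    exact ⟨Q⟩
  obtain ⟨Q, R, S, hW⟩ := exists_three_of_card_le (Nat.lt_succ_iff.mp (not_le.mp hcon))
  obtain ⟨l, hl, hlR, hlS⟩ := exists_line_through R S
  obtain ⟨Q', hQ'Z, hQ'⟩ : ∃ Q' ∈ Z, ∀ P ∈ Z, P ≠ Q' →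
      m + ∑ D ∈ J, mult P D ≤ mult P F + mult P l + k := by
    have key : ∀ P ∈ Z, P ≠ Q → m + ∑ D ∈ J, mult P D ≤ mult P F + mult P l + k := by
      intro P hPZ hPQ
      have h1 := s.le_mult P hPZ
      have h2 := s.sum_mult_le hJ P
      by_contra hlt
      have h3 := s.mult_pos_of_card_le_sum hJ (P := P) (by omega)
      rcases hW P (by rw [Finset.mem_filter]; exact ⟨hPZ, by omega, h3⟩) with rfl | rfl | rfl
      · exact hPQ rfl
      · omega
      · omega
    by_cases hQ : Q ∈ Z
    · exact ⟨Q, hQ, key⟩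
    · have := s.noConic.six_le_card
      obtain ⟨T, hT⟩ := Finset.card_pos.mp (show 0 < Z.card by omega)
      exact ⟨T, hT, fun P hP _ => key P hP fun h => hQ (h ▸ hP)⟩
  refine s.exchange hk hJ hl (by omega) Q' ?_ hQ'
  have h1 := s.le_mult Q' hQ'Z
  have h2 := s.sum_mult_le hJ Q'
  omega

/-- One or two conics and a line among the factors share two points of `Z` of exact
order `m`. -/
lemma exists_common_two (s : Extremal Z m d F I x) {k : ℕ} (hk : k ≤ 2) (hJ : J ⊆ I)
    (hcard : J.card = k + 1) (hdeg : 2 * k + 1 ≤ ∑ D ∈ J, D.totalDegree) :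
    ∃ P ∈ Z, ∃ R ∈ Z, P ≠ R ∧ mult P F = m ∧ mult R F = m ∧ (∀ D ∈ J, 1 ≤ mult P D) ∧
      ∀ D ∈ J, 1 ≤ mult R D := by
  rcases s.exists_excess hk hJ hdeg with ⟨P, hP, h⟩ | ⟨P, hP, R, hR, hPR, h1, h2⟩
  · have h3 := s.le_mult P hP
    have h4 := s.sum_mult_le hJ P
    omega
  · have h3 := s.le_mult P hP
    have h4 := s.sum_mult_le hJ P
    have h5 := s.le_mult R hR
    have h6 := s.sum_mult_le hJ R
    exact ⟨P, hP, R, hR, hPR, by omega, by omega,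
      s.mult_pos_of_card_le_sum hJ (by omega), s.mult_pos_of_card_le_sum hJ (by omega)⟩

lemma mult_lt_of_dominated (s : Extremal Z m d F I x) (hE : E ∈ I) (hPE : mult P E = 0)
    (hRE : 1 ≤ mult R E) (h : ∀ D ∈ I, 1 ≤ mult P D → 1 ≤ mult R D) :
    mult P F < mult R F := by
  rw [s.fac.mult_eq s.form.1 P, s.fac.mult_eq s.form.1 R]
  refine Finset.sum_lt_sum (fun D hD => ?_) ⟨E, hE, ?_⟩
  · have h1 := s.mult_le_one hD P
    have h2 := h D hD
    exact Nat.mul_le_mul_left _ (by omega)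
  · rw [hPE, mul_zero]
    exact Nat.mul_pos (s.fac.one_le E hE) hRE

/-- At most one of the factors is a conic. -/
lemma conic_unique (s : Extremal Z m d F I x) (hC : C ∈ I) (hE : E ∈ I)
    (hC2 : C.totalDegree = 2) (hE2 : E.totalDegree = 2) : C = E := by
  classical
  by_contra hCE
  have hsub : ({C, E} : Finset _) ⊆ I :=
    Finset.insert_subset hC (Finset.singleton_subset_iff.mpr hE)
  obtain ⟨K, hK4, hK⟩ := s.exists_common_four (k := 1) (by omega) hsub
    (Finset.card_pair hCE) (by rw [Finset.sum_pair hCE]; omega)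
  have hKmem : ∀ P, 1 ≤ mult P C → 1 ≤ mult P E → P ∈ K := by
    intro P h1 h2
    by_contra hPK
    have := s.fac.card_le hC hE hCE (insert P K) fun R hR => by
      rcases Finset.mem_insert.mp hR with rfl | hR
      · exact ⟨h1, h2⟩
      · exact ⟨(hK R hR).2.2 C (by simp), (hK R hR).2.2 E (by simp)⟩
    rw [Finset.card_insert_of_notMem hPK, hC2, hE2] at this
    omega
  obtain ⟨T, hT5, hT⟩ := s.conic C hC hC2
  obtain ⟨f, hfT, hfE⟩ : ∃ f ∈ T, ¬ 1 ≤ mult f E := by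
    by_contra! hcon
    have := s.fac.card_le hC hE hCE T fun P hP => ⟨(hT P hP).2.2, hcon P hP⟩
    rw [hC2, hE2] at this
    omega
  obtain ⟨-, hfm, hfC⟩ := hT f hfT
  obtain ⟨O, hO⟩ := Finset.card_pos.mp (show 0 < K.card by omega)
  have hlt := s.mult_lt_of_dominated hE (P := f) (R := O) (by omega) ((hK O hO).2.2 E (by simp))
    fun D hD hfD => by
      by_cases hDC : D = C
      · exact hDC ▸ (hK O hO).2.2 C (by simp)
      have hDE : D ≠ E := fun h => hfE (h ▸ hfD)
      have hsub3 : ({D, C, E} : Finset _) ⊆ I := Finset.insert_subset hD hsub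
      have hcard : ({D, C, E} : Finset _).card = 3 := by
        rw [Finset.card_insert_of_notMem (by simp [hDC, hDE]), Finset.card_pair hCE]
      have hdeg : ∑ B ∈ ({D, C, E} : Finset _), B.totalDegree = D.totalDegree + 4 := by
        rw [Finset.sum_insert (by simp [hDC, hDE]), Finset.sum_pair hCE, hC2, hE2]
      rcases s.totalDegree_eq hD with h1 | h2
      · obtain ⟨P, -, R, -, hPR, -, -, hP, hR⟩ :=
          s.exists_common_two (k := 2) le_rfl hsub3 hcard (by omega)
        have hPf : f ≠ P := fun h => hfE (h ▸ hP E (by simp))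
        have hRf : f ≠ R := fun h => hfE (h ▸ hR E (by simp))
        have := s.fac.card_le hD hC hDC {f, P, R} fun W hW => by
          simp only [Finset.mem_insert, Finset.mem_singleton] at hW
          rcases hW with rfl | rfl | rfl
          · exact ⟨hfD, hfC⟩
          · exact ⟨hP D (by simp), hP C (by simp)⟩
          · exact ⟨hR D (by simp), hR C (by simp)⟩
        rw [Finset.card_insert_of_notMem (by simp [hPf, hRf]), Finset.card_pair hPR, h1, hC2]
          at this
        omega
      · obtain ⟨W, hW4, hW⟩ := s.exists_common_four (k := 2) le_rfl hsub3 hcard (by omega)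
        have hWK : W ⊆ K := fun P hP =>
          hKmem P ((hW P hP).2.2 C (by simp)) ((hW P hP).2.2 E (by simp))
        have hK4' : K.card ≤ 4 := by
          have := s.fac.card_le hC hE hCE K fun R hR =>
            ⟨(hK R hR).2.2 C (by simp), (hK R hR).2.2 E (by simp)⟩
          rwa [hC2, hE2] at this
        have hWK' := Finset.eq_of_subset_of_card_le hWK (by omega)
        exact (hW O (hWK' ▸ hO)).2.2 D (by simp)
  have := (hK O hO).2.1
  omega

/-- None of the factors is a conic. -/
lemma totalDegree_eq_one (s : Extremal Z m d F I x) (hD : D ∈ I) : D.totalDegree = 1 := by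
  classical
  by_contra hD1
  obtain ⟨C, hC, hC2⟩ : ∃ C ∈ I, C.totalDegree = 2 :=
    ⟨D, hD, (s.totalDegree_eq hD).resolve_left hD1⟩
  have hline : ∀ {E}, E ∈ I → E ≠ C → E.totalDegree = 1 := fun {E} hE hEC =>
    (s.totalDegree_eq hE).resolve_right fun h => hEC (s.conic_unique hE hC h hC2)
  have hpair : ∀ {g}, g ∈ I → g ≠ C → ∃ P ∈ Z, mult P F = m ∧ 1 ≤ mult P g ∧ 1 ≤ mult P C := by
    intro g hg hgC
    obtain ⟨P, hP, -, -, -, hPm, -, hPJ, -⟩ := s.exists_common_two (k := 1) (by omega)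
      (J := {g, C}) (Finset.insert_subset hg (Finset.singleton_subset_iff.mpr hC))
      (Finset.card_pair hgC) (by rw [Finset.sum_pair hgC, hline hg hgC]; omega)
    exact ⟨P, hP, hPm, hPJ g (by simp), hPJ C (by simp)⟩
  have hCf := s.fac.isForm hC
  rw [hC2] at hCf
  obtain ⟨R, hRZ, hRC⟩ := s.noConic C hCf
  have hRF := s.le_mult R hRZ
  have hm := s.one_le
  obtain ⟨a, ha, hRa⟩ : ∃ a ∈ I, 1 ≤ mult R a := by
    by_contra! hcon
    rw [s.fac.mult_eq s.form.1 R, Finset.sum_eq_zero fun E hE => by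
      rw [Nat.lt_one_iff.mp (hcon E hE), mul_zero]] at hRF
    omega
  have haC : a ≠ C := fun h => by rw [← h] at hRC; omega
  obtain ⟨A, hAZ, hAm, hAa, hAC⟩ := hpair ha haC
  obtain ⟨b, hb, hba, hRb⟩ : ∃ b ∈ I, b ≠ a ∧ 1 ≤ mult R b := by
    by_contra! hcon
    have := s.mult_lt_of_dominated hC hRC hAC fun E hE hRE => by
      by_cases hEa : E = a
      · exact hEa ▸ hAa
      · have := hcon E hE hEa
        omega
    omega
  have hbC : b ≠ C := fun h => by rw [← h] at hRC; omega
  obtain ⟨T, hT5, hT⟩ := s.conic C hC hC2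
  obtain ⟨f, hfT, hfa, hfb⟩ : ∃ f ∈ T, ¬ 1 ≤ mult f a ∧ ¬ 1 ≤ mult f b := by
    by_contra! hcon
    have h1 := s.fac.card_le ha hC haC {P ∈ T | 1 ≤ mult P a} fun P hP => by
      rw [Finset.mem_filter] at hP
      exact ⟨hP.2, (hT P hP.1).2.2⟩
    have h2 := s.fac.card_le hb hC hbC {P ∈ T | ¬ 1 ≤ mult P a} fun P hP => by
      rw [Finset.mem_filter] at hP
      exact ⟨hcon P hP.1 (not_le.mp hP.2), (hT P hP.1).2.2⟩
    have h3 := Finset.card_filter_add_card_filter_not (s := T) (fun P => 1 ≤ mult P a)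
    rw [hline ha haC, hC2] at h1
    rw [hline hb hbC, hC2] at h2
    omega
  obtain ⟨-, hfm, hfC⟩ := hT f hfT
  have hlt := s.mult_lt_of_dominated ha (P := f) (R := A) (by omega) hAa fun c hc hfc => by
    by_cases hcC : c = C
    · exact hcC ▸ hAC
    exfalso
    have hca : c ≠ a := fun h => hfa (h ▸ hfc)
    have hcb : c ≠ b := fun h => hfb (h ▸ hfc)
    have hc1 := hline hc hcC
    have ha1 := hline ha haC
    have hb1 := hline hb hbC
    have hsum := sum_four hcC hca hcb (Ne.symm haC) (Ne.symm hbC) (Ne.symm hba)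
    have hab : ∀ W, 1 ≤ mult W a → 1 ≤ mult W b → W = R := fun W h1 h2 => by
      by_contra hne
      exact hba (s.fac.eq_of_two_points hb ha hb1 ha1 hne h2 hRb h1 hRa)
    have hle := fun W => s.mult_le_one hc W
    have hle2 := fun W => s.mult_le_one hC W
    have hle3 := fun W => s.mult_le_one ha W
    have hle4 := fun W => s.mult_le_one hb W
    have htrip : ∀ W, 3 ≤ mult W c + mult W C + mult W a + mult W b →
        1 ≤ mult W c ∧ (W = R ∨ 1 ≤ mult W C) := fun W hW => by
      have h1 := hle W
      have h2 := hle2 W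
      have h3 := hle3 W
      have h4 := hle4 W
      have h5 := hab W
      by_cases h6 : 1 ≤ mult W a ∧ 1 ≤ mult W b
      · have hWR := h5 h6.1 h6.2
        have hWC : mult W C = mult R C := by rw [hWR]
        exact ⟨by omega, Or.inl hWR⟩
      · omega
    have hcase := s.exists_excess (k := 2) le_rfl (J := {c, C, a, b}) (by
      intro B hB
      simp only [Finset.mem_insert, Finset.mem_singleton] at hB
      rcases hB with rfl | rfl | rfl | rfl
      exacts [hc, hC, ha, hb]) (by rw [hsum]; omega)
    simp only [hsum] at hcase
    rcases hcase with ⟨P, hP, h⟩ | ⟨P, hP, W, hW, hPW, h1, h2⟩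
    · have h1 := s.le_mult P hP
      have h2 := hle P
      have h3 := hle2 P
      have h4 := hle3 P
      have h5 := hle4 P
      have hPR := hab P (by omega) (by omega)
      have hPC : mult P C = mult R C := by rw [hPR]
      omega
    · have h3 := s.le_mult P hP
      have h4 := s.le_mult W hW
      have key : ∀ U V, U ≠ V → 3 ≤ mult U c + mult U C + mult U a + mult U b →
          3 ≤ mult V c + mult V C + mult V a + mult V b → ¬ 1 ≤ mult U C := by
        intro U V hUV hU hV hUC
        have hUf : f ≠ U := by
          rintro rfl
          have h1 := hle f
          have h2 := hle2 f
          omega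
        have hVf : f ≠ V := by
          rintro rfl
          have h1 := hle f
          have h2 := hle2 f
          omega
        rcases (htrip V hV).2 with rfl | hVC
        · have hU1 := hle U
          have hU2 := hle2 U
          rcases (show 1 ≤ mult U a ∨ 1 ≤ mult U b by omega) with h | h
          · exact hca (s.fac.eq_of_two_points hc ha hc1 ha1 hUV (htrip U hU).1 (htrip V hV).1
              h hRa)
          · exact hcb (s.fac.eq_of_two_points hc hb hc1 hb1 hUV (htrip U hU).1 (htrip V hV).1
              h hRb)
        · have := s.fac.card_le hc hC hcC {f, U, V} fun X hX => by
            simp only [Finset.mem_insert, Finset.mem_singleton] at hX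
            rcases hX with rfl | rfl | rfl
            · exact ⟨hfc, hfC⟩
            · exact ⟨(htrip _ hU).1, hUC⟩
            · exact ⟨(htrip _ hV).1, hVC⟩
          rw [Finset.card_insert_of_notMem (by simp [hUf, hVf]), Finset.card_pair hUV, hc1, hC2]
            at this
          omega
      have hP3 : 3 ≤ mult P c + mult P C + mult P a + mult P b := by omega
      have hW3 : 3 ≤ mult W c + mult W C + mult W a + mult W b := by omega
      have hPR := (htrip P hP3).2.resolve_right (key P W hPW hP3 hW3)
      have hWR := (htrip W hW3).2.resolve_right (key W P (Ne.symm hPW) hW3 hP3)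
      exact hPW (hPR.trans hWR.symm)
  omega

end Extremal

namespace Extremal

variable {Z : Finset (ℙ ℂ (Fin 3 → ℂ))} {P R O W : ℙ ℂ (Fin 3 → ℂ)} {m k : ℕ}
  {F D E a b c d g h : MvPolynomial (Fin 3) ℂ} {I J : Finset (MvPolynomial (Fin 3) ℂ)}
  {x : MvPolynomial (Fin 3) ℂ → ℕ}

lemma isForm_line (s : Extremal Z m k F I x) (hD : D ∈ I) : IsForm D 1 :=
  s.totalDegree_eq_one hD ▸ s.fac.isForm hD

lemma eq_of_mem_two (s : Extremal Z m k F I x) (hD : D ∈ I) (hE : E ∈ I) (hne : D ≠ E)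
    (hPD : 1 ≤ mult P D) (hPE : 1 ≤ mult P E) (hRD : 1 ≤ mult R D) (hRE : 1 ≤ mult R E) :
    P = R := by
  by_contra hPR
  exact hne (s.fac.eq_of_two_points hD hE (s.totalDegree_eq_one hD) (s.totalDegree_eq_one hE)
    hPR hPD hRD hPE hRE)

lemma sum_le_mult (s : Extremal Z m k F I x) (hJ : J ⊆ I) (P : ℙ ℂ (Fin 3 → ℂ)) :
    ∑ D ∈ J, x D * mult P D ≤ mult P F := by
  rw [s.fac.mult_eq s.form.1 P]
  exact Finset.sum_le_sum_of_subset hJ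

lemma mult_eq_sum (s : Extremal Z m k F I x) (hJ : J ⊆ I)
    (h : ∀ D ∈ I, 1 ≤ mult P D → D ∈ J) : mult P F = ∑ D ∈ J, x D * mult P D := by
  rw [s.fac.mult_eq s.form.1 P]
  refine (Finset.sum_subset hJ fun D hD hDJ => ?_).symm
  have : mult P D = 0 := by
    by_contra h0
    exact hDJ (h D hD (Nat.one_le_iff_ne_zero.mpr h0))
  rw [this, mul_zero]

lemma add_le_mult (s : Extremal Z m k F I x) (hD : D ∈ I) (hE : E ∈ I) (hne : D ≠ E)
    (hPD : 1 ≤ mult P D) (hPE : 1 ≤ mult P E) : x D + x E ≤ mult P F := by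
  classical
  have h1 := s.sum_le_mult (J := {D, E}) (by
    simp only [Finset.insert_subset_iff, Finset.singleton_subset_iff]
    exact ⟨hD, hE⟩) P
  rw [Finset.sum_pair hne, le_antisymm (s.mult_le_one hD P) hPD,
    le_antisymm (s.mult_le_one hE P) hPE] at h1
  omega

lemma add_add_le_mult (s : Extremal Z m k F I x) (hD : D ∈ I) (hE : E ∈ I) (hg : g ∈ I)
    (hne : D ≠ E) (hDg : D ≠ g) (hEg : E ≠ g)
    (hPD : 1 ≤ mult P D) (hPE : 1 ≤ mult P E) (hPg : 1 ≤ mult P g) :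
    x D + x E + x g ≤ mult P F := by
  classical
  have h1 := s.sum_le_mult (J := {D, E, g}) (by
    simp only [Finset.insert_subset_iff, Finset.singleton_subset_iff]
    exact ⟨hD, hE, hg⟩) P
  rw [Finset.sum_insert (by simp [hne, hDg]), Finset.sum_pair hEg,
    le_antisymm (s.mult_le_one hD P) hPD, le_antisymm (s.mult_le_one hE P) hPE,
    le_antisymm (s.mult_le_one hg P) hPg] at h1
  omega

lemma exists_factor (s : Extremal Z m k F I x) (hP : P ∈ Z) : ∃ D ∈ I, 1 ≤ mult P D := by
  by_contra! hcon
  have h1 := s.le_mult P hP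
  rw [s.mult_eq_sum (Finset.empty_subset I) fun D hD h => absurd h (not_le.mpr (hcon D hD)),
    Finset.sum_empty] at h1
  have := s.one_le
  omega

lemma exists_ne_ne (s : Extremal Z m k F I x) (ha : a ∈ I) (hb : b ∈ I) :
    ∃ c ∈ I, c ≠ a ∧ c ≠ b := by
  by_contra! hcon
  refine s.noConic.not_two_lines (s.isForm_line ha) (s.isForm_line hb) fun P hP => ?_
  obtain ⟨D, hD, hPD⟩ := s.exists_factor hP
  by_cases hDa : D = a
  · exact Or.inl (hDa ▸ hPD)
  · exact Or.inr (hcon D hD hDa ▸ hPD)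

/-- Every point of `Z` lies on two of the lines. -/
lemma exists_ne_factor (s : Extremal Z m k F I x) (ha : a ∈ I) (hP : P ∈ Z) :
    ∃ D ∈ I, D ≠ a ∧ 1 ≤ mult P D := by
  classical
  by_contra! hcon
  have hxa : m ≤ x a := by
    have h1 := s.le_mult P hP
    rw [s.mult_eq_sum (J := {a}) (by simpa using ha) fun D hD h => by
      by_contra hDa
      exact absurd h (not_le.mpr (hcon D hD (by simpa using hDa))), Finset.sum_singleton] at h1
    exact h1.trans (by simpa using Nat.mul_le_mul_left (x a) (s.mult_le_one ha P))
  obtain ⟨b, hb, hba, -⟩ := s.exists_ne_ne ha ha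
  obtain ⟨c, hc, hca, hcb⟩ := s.exists_ne_ne ha hb
  have hxb := s.fac.one_le b hb
  have hxc := s.fac.one_le c hc
  have hsum : ∀ f : MvPolynomial (Fin 3) ℂ → ℕ, ∑ D ∈ {a, b, c}, f D = f a + f b + f c :=
    fun f => by
      rw [Finset.sum_insert (by simp [hba.symm, hca.symm]), Finset.sum_pair hcb.symm, add_assoc]
  have hdeg := s.totalDegree_eq_one ha
  have hdegb := s.totalDegree_eq_one hb
  have hdegc := s.totalDegree_eq_one hc
  have hcase := s.exists_excess (k := 1) (by omega) (J := {a, b, c}) (by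
    simp only [Finset.insert_subset_iff, Finset.singleton_subset_iff]
    exact ⟨ha, hb, hc⟩) (by rw [hsum]; omega)
  simp only [hsum] at hcase
  have hoff : ∀ Q ∈ Z, mult Q F + 2 ≤ m + (mult Q a + mult Q b + mult Q c) →
      1 ≤ mult Q b ∧ 1 ≤ mult Q c ∧ mult Q a = 0 := fun Q hQ hle => by
    have h0 := s.le_mult Q hQ
    have h1 := s.mult_le_one ha Q
    have h2 := s.mult_le_one hb Q
    have h3 := s.mult_le_one hc Q
    by_cases hQa : 1 ≤ mult Q a
    · exfalso
      have h4 : 1 ≤ mult Q b → x a + x b ≤ mult Q F := s.add_le_mult ha hb hba.symm hQa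
      have h5 : 1 ≤ mult Q c → x a + x c ≤ mult Q F := s.add_le_mult ha hc hca.symm hQa
      have h6 : 1 ≤ mult Q b → 1 ≤ mult Q c → x a + x b + x c ≤ mult Q F :=
        s.add_add_le_mult ha hb hc hba.symm hca.symm hcb.symm hQa
      omega
    · omega
  rcases hcase with ⟨Q, hQ, h1⟩ | ⟨Q, hQ, R, hR, hQR, h1, h2⟩
  · have h2 := hoff Q hQ (by omega)
    have h0 := s.le_mult Q hQ
    have h3 := s.mult_le_one hb Q
    have h4 := s.mult_le_one hc Q
    omega
  · obtain ⟨h3, h4, -⟩ := hoff Q hQ (by omega)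
    obtain ⟨h5, h6, -⟩ := hoff R hR (by omega)
    exact hQR (s.eq_of_mem_two hb hc hcb.symm h3 h4 h5 h6)

lemma exists_ne_ne_ne (s : Extremal Z m k F I x) (ha : a ∈ I) (hb : b ∈ I) (hc : c ∈ I)
    (hab : a ≠ b) : ∃ d ∈ I, d ≠ a ∧ d ≠ b ∧ d ≠ c := by
  by_contra! hcon
  have key : ∀ P ∈ Z, ¬ 1 ≤ mult P c → 1 ≤ mult P a ∧ 1 ≤ mult P b := fun P hP hPc => by
    obtain ⟨D, hD, hDa, hPD⟩ := s.exists_ne_factor ha hP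
    obtain ⟨E, hE, hEb, hPE⟩ := s.exists_ne_factor hb hP
    constructor
    · by_cases hEa : E = a
      · exact hEa ▸ hPE
      · exact absurd (hcon E hE hEa hEb ▸ hPE) hPc
    · by_cases hDb : D = b
      · exact hDb ▸ hPD
      · exact absurd (hcon D hD hDa hDb ▸ hPD) hPc
  by_cases hO : ∃ O ∈ Z, ¬ 1 ≤ mult O c
  · obtain ⟨O, hOZ, hOc⟩ := hO
    obtain ⟨hOa, hOb⟩ := key O hOZ hOc
    refine s.noConic.not_line_points (s.isForm_line hc) O O fun P hP hPO _ => ?_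
    by_contra hPc
    obtain ⟨hPa, hPb⟩ := key P hP hPc
    exact hPO (s.eq_of_mem_two ha hb hab hPa hPb hOa hOb)
  · push Not at hO
    exact s.noConic.not_two_lines (s.isForm_line hc) (s.isForm_line hc) fun P hP =>
      Or.inl (hO P hP)

/-- Not all of the lines pass through one point. -/
lemma exists_not_mem (s : Extremal Z m k F I x) (ha : a ∈ I) (O : ℙ ℂ (Fin 3 → ℂ)) :
    ∃ d ∈ I, ¬ 1 ≤ mult O d := by
  by_contra! hcon
  refine s.noConic.not_line_points (s.isForm_line ha) O O fun P hP hPO _ => ?_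
  obtain ⟨D, hD, -, hPD⟩ := s.exists_ne_factor ha hP
  obtain ⟨E, hE, hED, hPE⟩ := s.exists_ne_factor hD hP
  exact absurd (s.eq_of_mem_two hE hD hED hPE hPD (hcon E hE) (hcon D hD)) hPO

/-- At least two of the lines avoid a given point. -/
lemma exists_not_mem_ne (s : Extremal Z m k F I x) (hd : d ∈ I) (O : ℙ ℂ (Fin 3 → ℂ)) :
    ∃ g ∈ I, g ≠ d ∧ ¬ 1 ≤ mult O g := by
  by_contra! hcon
  refine s.noConic.not_line_points (s.isForm_line hd) O O fun P hP hPO _ => ?_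
  by_contra hPd
  obtain ⟨D, hD, hDd, hPD⟩ := s.exists_ne_factor hd hP
  obtain ⟨E, hE, hED, hPE⟩ := s.exists_ne_factor hD hP
  exact hPO (s.eq_of_mem_two hE hD hED hPE hPD (hcon E hE fun h => hPd (h ▸ hPE))
    (hcon D hD hDd))

/-- Four lines among the factors, no three of them concurrent. -/
structure Quad (I : Finset (MvPolynomial (Fin 3) ℂ)) (a b c d : MvPolynomial (Fin 3) ℂ) :
    Prop where
  ha : a ∈ I
  hb : b ∈ I
  hc : c ∈ I
  hd : d ∈ I
  hab : a ≠ b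
  hac : a ≠ c
  had : a ≠ d
  hbc : b ≠ c
  hbd : b ≠ d
  hcd : c ≠ d
  le_two : ∀ P, mult P a + mult P b + mult P c + mult P d ≤ 2

lemma exists_quad_of_concurrent (s : Extremal Z m k F I x) (ha : a ∈ I) (hb : b ∈ I)
    (hc : c ∈ I) (hab : a ≠ b) (hac : a ≠ c) (hbc : b ≠ c) (hOa : 1 ≤ mult O a)
    (hOb : 1 ≤ mult O b) (hOc : 1 ≤ mult O c) : ∃ a b c d, Quad I a b c d := by
  obtain ⟨d, hd, hOd⟩ := s.exists_not_mem ha O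
  obtain ⟨g, hg, hgd, hOg⟩ := s.exists_not_mem_ne hd O
  by_contra! hcon
  have key : ∀ p q, p ∈ I → q ∈ I → p ≠ q → 1 ≤ mult O p → 1 ≤ mult O q →
      ∃ W, 1 ≤ mult W d ∧ 1 ≤ mult W g ∧ (1 ≤ mult W p ∨ 1 ≤ mult W q) := by
    intro p q hp hq hpq hOp hOq
    by_contra! hno
    refine hcon p q d g ⟨hp, hq, hd, hg, hpq, fun h => hOd (h ▸ hOp), fun h => hOg (h ▸ hOp),
      fun h => hOd (h ▸ hOq), fun h => hOg (h ▸ hOq), hgd.symm, fun W => ?_⟩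
    have h1 := hno W
    have h2 := s.mult_le_one hp W
    have h3 := s.mult_le_one hq W
    have h4 := s.mult_le_one hd W
    have h5 := s.mult_le_one hg W
    by_cases h6 : 1 ≤ mult W p ∧ 1 ≤ mult W q
    · have hWO := s.eq_of_mem_two hp hq hpq h6.1 h6.2 hOp hOq
      have h7 : mult W d = mult O d := by rw [hWO]
      have h8 : mult W g = mult O g := by rw [hWO]
      omega
    · omega
  obtain ⟨W, hWd, hWg, hW⟩ := key a b ha hb hab hOa hOb
  obtain ⟨W₂, hWd₂, hWg₂, hW₂⟩ := key a c ha hc hac hOa hOc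
  obtain ⟨W₃, hWd₃, hWg₃, hW₃⟩ := key b c hb hc hbc hOb hOc
  rw [s.eq_of_mem_two hd hg hgd.symm hWd₂ hWg₂ hWd hWg] at hW₂
  rw [s.eq_of_mem_two hd hg hgd.symm hWd₃ hWg₃ hWd hWg] at hW₃
  have hWO : W ≠ O := fun h => hOd (h ▸ hWd)
  have h1 : ¬ (1 ≤ mult W a ∧ 1 ≤ mult W b) := fun h =>
    hWO (s.eq_of_mem_two ha hb hab h.1 h.2 hOa hOb)
  have h2 : ¬ (1 ≤ mult W a ∧ 1 ≤ mult W c) := fun h =>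
    hWO (s.eq_of_mem_two ha hc hac h.1 h.2 hOa hOc)
  have h3 : ¬ (1 ≤ mult W b ∧ 1 ≤ mult W c) := fun h =>
    hWO (s.eq_of_mem_two hb hc hbc h.1 h.2 hOb hOc)
  omega

lemma exists_quad (s : Extremal Z m k F I x) : ∃ a b c d, Quad I a b c d := by
  obtain ⟨P, hP⟩ : ∃ P, P ∈ Z := by
    have := s.noConic.six_le_card
    exact Finset.card_pos.mp (by omega)
  obtain ⟨a, ha, -⟩ := s.exists_factor hP
  obtain ⟨b, hb, hba, -⟩ := s.exists_ne_ne ha ha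
  obtain ⟨c, hc, hca, hcb⟩ := s.exists_ne_ne ha hb
  obtain ⟨d, hd, hda, hdb, hdc⟩ := s.exists_ne_ne_ne ha hb hc hba.symm
  by_cases hO : ∃ O, 3 ≤ mult O a + mult O b + mult O c + mult O d
  · obtain ⟨O, hO⟩ := hO
    have h1 := s.mult_le_one ha O
    have h2 := s.mult_le_one hb O
    have h3 := s.mult_le_one hc O
    have h4 := s.mult_le_one hd O
    by_cases hOa : 1 ≤ mult O a
    · by_cases hOb : 1 ≤ mult O b
      · by_cases hOc : 1 ≤ mult O c
        · exact s.exists_quad_of_concurrent ha hb hc hba.symm hca.symm hcb.symm hOa hOb hOc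
        · exact s.exists_quad_of_concurrent ha hb hd hba.symm hda.symm hdb.symm hOa hOb
            (by omega)
      · have hOc : 1 ≤ mult O c := by omega
        have hOd : 1 ≤ mult O d := by omega
        exact s.exists_quad_of_concurrent ha hc hd hca.symm hda.symm hdc.symm hOa hOc hOd
    · have hOb : 1 ≤ mult O b := by omega
      have hOc : 1 ≤ mult O c := by omega
      have hOd : 1 ≤ mult O d := by omega
      exact s.exists_quad_of_concurrent hb hc hd hcb.symm hdb.symm hdc.symm hOb hOc hOd
  · push Not at hO
    exact ⟨a, b, c, d, ha, hb, hc, hd, hba.symm, hca.symm, hda.symm, hcb.symm, hdb.symm,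
      hdc.symm, fun P => Nat.lt_succ_iff.mp (hO P)⟩

end Extremal

namespace Extremal

variable {Z : Finset (ℙ ℂ (Fin 3 → ℂ))} {P R O W : ℙ ℂ (Fin 3 → ℂ)} {m k : ℕ}
  {F D E a b c d g h : MvPolynomial (Fin 3) ℂ} {I J : Finset (MvPolynomial (Fin 3) ℂ)}
  {x : MvPolynomial (Fin 3) ℂ → ℕ}

namespace Quad

lemma swap_mid (q : Quad I a b c d) : Quad I a c b d :=
  ⟨q.ha, q.hc, q.hb, q.hd, q.hac, q.hab, q.had, q.hbc.symm, q.hcd, q.hbd, fun P => by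
    have := q.le_two P
    omega⟩

lemma swap_last (q : Quad I a b c d) : Quad I a b d c :=
  ⟨q.ha, q.hb, q.hd, q.hc, q.hab, q.had, q.hac, q.hbd, q.hbc, q.hcd.symm, fun P => by
    have := q.le_two P
    omega⟩

lemma swap_first (q : Quad I a b c d) : Quad I b a c d :=
  ⟨q.hb, q.ha, q.hc, q.hd, q.hab.symm, q.hbc, q.hbd, q.hac, q.had, q.hcd, fun P => by
    have := q.le_two P
    omega⟩

end Quad

/-- A further line `g` joining the points `a ∩ b` and `c ∩ d`, both in `Z` and of exact
order `m` on `F`. -/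
structure Diagonal (Z : Finset (ℙ ℂ (Fin 3 → ℂ))) (m : ℕ) (F : MvPolynomial (Fin 3) ℂ)
    (I : Finset (MvPolynomial (Fin 3) ℂ)) (a b c d g : MvPolynomial (Fin 3) ℂ) : Prop where
  mem : g ∈ I
  ne_a : g ≠ a
  ne_b : g ≠ b
  ne_c : g ≠ c
  ne_d : g ≠ d
  left : ∃ P ∈ Z, mult P F = m ∧ 1 ≤ mult P a ∧ 1 ≤ mult P b ∧ 1 ≤ mult P g
  right : ∃ P ∈ Z, mult P F = m ∧ 1 ≤ mult P c ∧ 1 ≤ mult P d ∧ 1 ≤ mult P g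

namespace Diagonal

lemma swap (t : Diagonal Z m F I a b c d g) : Diagonal Z m F I c d a b g :=
  ⟨t.mem, t.ne_c, t.ne_d, t.ne_a, t.ne_b, t.right, t.left⟩

lemma swap_left (t : Diagonal Z m F I a b c d g) : Diagonal Z m F I b a c d g :=
  ⟨t.mem, t.ne_b, t.ne_a, t.ne_c, t.ne_d,
    let ⟨P, h1, h2, h3, h4, h5⟩ := t.left
    ⟨P, h1, h2, h4, h3, h5⟩, t.right⟩

lemma swap_right (t : Diagonal Z m F I a b c d g) : Diagonal Z m F I a b d c g :=
  t.swap.swap_left.swap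

lemma unique (s : Extremal Z m k F I x) (q : Quad I a b c d) (t : Diagonal Z m F I a b c d g)
    (u : Diagonal Z m F I a b c d h) : g = h := by
  obtain ⟨P, -, -, hPa, hPb, hPg⟩ := t.left
  obtain ⟨R, -, -, hRc, hRd, hRg⟩ := t.right
  obtain ⟨P', -, -, hPa', hPb', hPh⟩ := u.left
  obtain ⟨R', -, -, hRc', hRd', hRh⟩ := u.right
  have hP := s.eq_of_mem_two q.ha q.hb q.hab hPa' hPb' hPa hPb
  have hR := s.eq_of_mem_two q.hc q.hd q.hcd hRc' hRd' hRc hRd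
  by_contra hne
  have hPR : P = R := s.eq_of_mem_two t.mem u.mem hne hPg (hP ▸ hPh) hRg (hR ▸ hRh)
  have h1 := q.le_two P
  have h2 : 1 ≤ mult P c := hPR ▸ hRc
  omega

lemma sum_le (s : Extremal Z m k F I x) (q : Quad I a b c d) (t : Diagonal Z m F I a b c d g) :
    x a + x b + x g ≤ m ∧ x c + x d + x g ≤ m := by
  obtain ⟨P, -, hP, hPa, hPb, hPg⟩ := t.left
  obtain ⟨R, -, hR, hRc, hRd, hRg⟩ := t.right
  exact ⟨hP ▸ s.add_add_le_mult q.ha q.hb t.mem q.hab t.ne_a.symm t.ne_b.symm hPa hPb hPg,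
    hR ▸ s.add_add_le_mult q.hc q.hd t.mem q.hcd t.ne_c.symm t.ne_d.symm hRc hRd hRg⟩

/-- A diagonal meets the four lines only in its two vertices. -/
lemma vertex (s : Extremal Z m k F I x) (t : Diagonal Z m F I a b c d g)
    (q : Quad I a b c d) (hWg : 1 ≤ mult W g)
    (hW : 1 ≤ mult W a + mult W b + mult W c + mult W d) :
    (1 ≤ mult W a ∧ 1 ≤ mult W b) ∨ (1 ≤ mult W c ∧ 1 ≤ mult W d) := by
  obtain ⟨P, -, -, hPa, hPb, hPg⟩ := t.left
  obtain ⟨R, -, -, hRc, hRd, hRg⟩ := t.right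
  have h1 : 1 ≤ mult W a → 1 ≤ mult W b := fun h =>
    s.eq_of_mem_two t.mem q.ha t.ne_a hPg hPa hWg h ▸ hPb
  have h2 : 1 ≤ mult W b → 1 ≤ mult W a := fun h =>
    s.eq_of_mem_two t.mem q.hb t.ne_b hPg hPb hWg h ▸ hPa
  have h3 : 1 ≤ mult W c → 1 ≤ mult W d := fun h =>
    s.eq_of_mem_two t.mem q.hc t.ne_c hRg hRc hWg h ▸ hRd
  have h4 : 1 ≤ mult W d → 1 ≤ mult W c := fun h =>
    s.eq_of_mem_two t.mem q.hd t.ne_d hRg hRd hWg h ▸ hRc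
  omega

/-- Diagonals of different types do not meet on the four lines. -/
lemma sum_eq_zero (s : Extremal Z m k F I x) (q : Quad I a b c d)
    (t : Diagonal Z m F I a b c d g) (u : Diagonal Z m F I a c b d h) (hWg : 1 ≤ mult W g)
    (hWh : 1 ≤ mult W h) : mult W a + mult W b + mult W c + mult W d = 0 := by
  by_contra hne
  have h1 := t.vertex s q hWg (by omega)
  have h2 := u.vertex s q.swap_mid hWh (by omega)
  have h3 := q.le_two W
  omega

end Diagonal

/-- Every further line is a diagonal. -/
lemma diagonal_cases (s : Extremal Z m k F I x) (q : Quad I a b c d) (hg : g ∈ I) (hga : g ≠ a)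
    (hgb : g ≠ b) (hgc : g ≠ c) (hgd : g ≠ d) : Diagonal Z m F I a b c d g ∨
      Diagonal Z m F I a c b d g ∨ Diagonal Z m F I a d b c g := by
  classical
  have hsum : ∀ f : MvPolynomial (Fin 3) ℂ → ℕ,
      ∑ D ∈ {g, a, b, c, d}, f D = f g + (f a + f b + f c + f d) := fun f => by
    rw [Finset.sum_insert (by simp [hga, hgb, hgc, hgd]),
      sum_four q.hab q.hac q.had q.hbc q.hbd q.hcd]
  have hdeg := s.totalDegree_eq_one hg
  have hdega := s.totalDegree_eq_one q.ha
  have hdegb := s.totalDegree_eq_one q.hb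
  have hdegc := s.totalDegree_eq_one q.hc
  have hdegd := s.totalDegree_eq_one q.hd
  have hcase := s.exists_excess (k := 2) le_rfl (J := {g, a, b, c, d}) (by
    simp only [Finset.insert_subset_iff, Finset.singleton_subset_iff]
    exact ⟨hg, q.ha, q.hb, q.hc, q.hd⟩) (by rw [hsum]; omega)
  simp only [hsum] at hcase
  rcases hcase with ⟨P, hP, h1⟩ | ⟨P, hP, R, hR, hPR, h1, h2⟩
  · have h2 := s.le_mult P hP
    have h3 := s.mult_le_one hg P
    have h4 := q.le_two P
    omega
  · have hP1 := s.le_mult P hP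
    have hP2 := s.mult_le_one hg P
    have hP3 := q.le_two P
    have hR1 := s.le_mult R hR
    have hR2 := s.mult_le_one hg R
    have hR3 := q.le_two R
    have hPg : 1 ≤ mult P g := by omega
    have hRg : 1 ≤ mult R g := by omega
    have hPm : mult P F = m := by omega
    have hRm : mult R F = m := by omega
    have hle : ∀ l ∈ I, g ≠ l → mult P l + mult R l ≤ 1 := fun l hl hgl => by
      have h3 := s.mult_le_one hl P
      have h4 := s.mult_le_one hl R
      by_contra hcon
      exact hPR (s.eq_of_mem_two hg hl hgl hPg (by omega) hRg (by omega))
    have ha := hle a q.ha hga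
    have hb := hle b q.hb hgb
    have hc := hle c q.hc hgc
    have hd := hle d q.hd hgd
    have mk : ∀ p q r t, g ≠ p → g ≠ q → g ≠ r → g ≠ t → 1 ≤ mult P p → 1 ≤ mult P q →
        1 ≤ mult R r → 1 ≤ mult R t → Diagonal Z m F I p q r t g :=
      fun p q r t hp hq hr ht h1 h2 h3 h4 =>
        ⟨hg, hp, hq, hr, ht, ⟨P, hP, hPm, h1, h2, hPg⟩, ⟨R, hR, hRm, h3, h4, hRg⟩⟩
    by_cases hPa : 1 ≤ mult P a
    · by_cases hPb : 1 ≤ mult P b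
      · exact Or.inl (mk a b c d hga hgb hgc hgd hPa hPb (by omega) (by omega))
      · by_cases hPc : 1 ≤ mult P c
        · exact Or.inr (Or.inl (mk a c b d hga hgc hgb hgd hPa hPc (by omega) (by omega)))
        · have hPd : 1 ≤ mult P d := by omega
          exact Or.inr (Or.inr (mk a d b c hga hgd hgb hgc hPa hPd (by omega) (by omega)))
    · by_cases hPb : 1 ≤ mult P b
      · by_cases hPc : 1 ≤ mult P c
        · have hRa : 1 ≤ mult R a := by omega
          have hRd : 1 ≤ mult R d := by omega
          exact Or.inr (Or.inr (mk b c a d hgb hgc hga hgd hPb hPc hRa hRd).swap)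
        · have hPd : 1 ≤ mult P d := by omega
          have hRa : 1 ≤ mult R a := by omega
          have hRc : 1 ≤ mult R c := by omega
          exact Or.inr (Or.inl (mk b d a c hgb hgd hga hgc hPb hPd hRa hRc).swap)
      · have hPc : 1 ≤ mult P c := by omega
        have hPd : 1 ≤ mult P d := by omega
        have hRa : 1 ≤ mult R a := by omega
        have hRb : 1 ≤ mult R b := by omega
        exact Or.inl (mk c d a b hgc hgd hga hgb hPc hPd hRa hRb).swap

/-- The three diagonals do not all occur. -/
lemma not_three_diagonals (s : Extremal Z m k F I x) (q : Quad I a b c d)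
    {g₁ g₂ g₃ : MvPolynomial (Fin 3) ℂ} (t₁ : Diagonal Z m F I a b c d g₁)
    (t₂ : Diagonal Z m F I a c b d g₂) (t₃ : Diagonal Z m F I a d b c g₃) : False := by
  classical
  have h12 : ∀ W, 1 ≤ mult W g₁ → 1 ≤ mult W g₂ →
      mult W a + mult W b + mult W c + mult W d = 0 := fun W => t₁.sum_eq_zero s q t₂
  have h13 : ∀ W, 1 ≤ mult W g₁ → 1 ≤ mult W g₃ →
      mult W a + mult W b + mult W c + mult W d = 0 := fun W h1 h3 => by
    have := t₁.swap_right.sum_eq_zero s q.swap_last t₃ h1 h3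
    omega
  have h23 : ∀ W, 1 ≤ mult W g₂ → 1 ≤ mult W g₃ →
      mult W a + mult W b + mult W c + mult W d = 0 := fun W h2 h3 => by
    have := t₂.swap_right.sum_eq_zero s q.swap_mid.swap_last t₃.swap_right h2 h3
    omega
  have hne : ∀ {u v}, Diagonal Z m F I a b c d u ∨ Diagonal Z m F I a c b d u →
      (∀ W, 1 ≤ mult W u → 1 ≤ mult W v →
        mult W a + mult W b + mult W c + mult W d = 0) → u ≠ v := by
    rintro u v (hu | hu) huv rfl
    · obtain ⟨P, -, -, hPa, -, hPu⟩ := hu.left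
      have := huv P hPu hPu
      omega
    · obtain ⟨P, -, -, hPa, -, hPu⟩ := hu.left
      have := huv P hPu hPu
      omega
  have hn12 := hne (Or.inl t₁) h12
  have hn13 := hne (Or.inl t₁) h13
  have hn23 := hne (Or.inr t₂) h23
  have hsum : ∀ f : MvPolynomial (Fin 3) ℂ → ℕ, ∑ D ∈ {g₁, g₂, g₃, a, b, c, d}, f D =
      f g₁ + (f g₂ + (f g₃ + (f a + f b + f c + f d))) := fun f => by
    rw [Finset.sum_insert (by simp [hn12, hn13, t₁.ne_a, t₁.ne_b, t₁.ne_c, t₁.ne_d]),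
      Finset.sum_insert (by simp [hn23, t₂.ne_a, t₂.ne_b, t₂.ne_c, t₂.ne_d]),
      Finset.sum_insert (by simp [t₃.ne_a, t₃.ne_b, t₃.ne_c, t₃.ne_d]),
      sum_four q.hab q.hac q.had q.hbc q.hbd q.hcd]
  obtain ⟨U, e, hU, hdeg, hmult⟩ := s.fac.exists_cofactor s.form
    (J := {g₁, g₂, g₃, a, b, c, d}) (by
      simp only [Finset.insert_subset_iff, Finset.singleton_subset_iff]
      exact ⟨t₁.mem, t₂.mem, t₃.mem, q.ha, q.hb, q.hc, q.hd⟩)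
  have := s.low 3 (by omega) U e hU fun P hP => by
    have h1 := hmult P
    rw [hsum] at h1
    have h2 := s.le_mult P hP
    have h3 := q.le_two P
    have h4 := h12 P
    have h5 := h13 P
    have h6 := h23 P
    have h7 := s.mult_le_one t₁.mem P
    have h8 := s.mult_le_one t₂.mem P
    have h9 := s.mult_le_one t₃.mem P
    omega
  rw [hsum, s.totalDegree_eq_one t₁.mem, s.totalDegree_eq_one t₂.mem,
    s.totalDegree_eq_one t₃.mem, s.totalDegree_eq_one q.ha, s.totalDegree_eq_one q.hb,
    s.totalDegree_eq_one q.hc, s.totalDegree_eq_one q.hd] at hdeg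
  omega

/-- If no diagonal passes through the vertex `a ∩ d`, only two lines pass through it. -/
lemma le_add_of_vertex (s : Extremal Z m k F I x) (q : Quad I a b c d)
    (hno : ∀ g, ¬ Diagonal Z m F I a d b c g) (hW : W ∈ Z) (hWa : 1 ≤ mult W a)
    (hWd : 1 ≤ mult W d) : m ≤ x a + x d := by
  classical
  have hle := q.le_two W
  have h1 := s.le_mult W hW
  rw [s.mult_eq_sum (J := {a, d}) (by
    simp only [Finset.insert_subset_iff, Finset.singleton_subset_iff]
    exact ⟨q.ha, q.hd⟩) fun D hD hWD => by
      by_contra hDJ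
      simp only [Finset.mem_insert, Finset.mem_singleton, not_or] at hDJ
      have hDb : D ≠ b := fun h => by
        have : 1 ≤ mult W b := h ▸ hWD
        omega
      have hDc : D ≠ c := fun h => by
        have : 1 ≤ mult W c := h ▸ hWD
        omega
      rcases s.diagonal_cases q hD hDJ.1 hDb hDc hDJ.2 with t | t | t
      · have := t.vertex s q hWD (by omega)
        omega
      · have := t.vertex s q.swap_mid hWD (by omega)
        omega
      · exact hno D t, Finset.sum_pair q.had] at h1
  have h2 := Nat.mul_le_mul_left (x a) (s.mult_le_one q.ha W)
  have h3 := Nat.mul_le_mul_left (x d) (s.mult_le_one q.hd W)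
  omega

/-- If the diagonal joining `a ∩ d` and `b ∩ c` is missing, then `a ∩ d` lies in `Z`. -/
lemma exists_vertex (s : Extremal Z m k F I x) (q : Quad I a b c d)
    (hno : ∀ g, ¬ Diagonal Z m F I a d b c g) : ∃ W ∈ Z, 1 ≤ mult W a ∧ 1 ≤ mult W d := by
  classical
  by_contra! hcon
  have hxa := s.fac.one_le a q.ha
  have hxb := s.fac.one_le b q.hb
  have hxc := s.fac.one_le c q.hc
  have hxd := s.fac.one_le d q.hd
  refine s.noConic.not_two_lines (s.isForm_line q.hb) (s.isForm_line q.hc) fun P hP => ?_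
  by_contra hPbc
  have hPad := hcon P hP
  have hne : ∀ l, ∀ D, 1 ≤ mult P D → ¬ 1 ≤ mult P l → D ≠ l := fun l D hPD hPl h =>
    hPl (h ▸ hPD)
  have hzero : mult P a + mult P b + mult P c + mult P d = 0 := by
    by_contra h0
    obtain ⟨l, hl, hPl⟩ : ∃ l ∈ I, 1 ≤ mult P a ∧ l = a ∨ 1 ≤ mult P d ∧ l = d := by
      by_cases hPa : 1 ≤ mult P a
      · exact ⟨a, q.ha, Or.inl ⟨hPa, rfl⟩⟩
      · exact ⟨d, q.hd, Or.inr ⟨by omega, rfl⟩⟩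
    obtain ⟨D, hD, hDl, hPD⟩ := s.exists_ne_factor hl hP
    have hDa : D ≠ a := by
      rcases hPl with ⟨-, rfl⟩ | ⟨h, rfl⟩
      · exact hDl
      · exact hne a D hPD fun h' => by have := hPad h'; omega
    have hDd : D ≠ d := by
      rcases hPl with ⟨h, rfl⟩ | ⟨-, rfl⟩
      · exact hne d D hPD fun h' => by have := hPad h; omega
      · exact hDl
    rcases s.diagonal_cases q hD hDa (hne b D hPD fun h' => hPbc (Or.inl h'))
      (hne c D hPD fun h' => hPbc (Or.inr h')) hDd with t | t | t
    · have := t.vertex s q hPD (by omega)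
      omega
    · have := t.vertex s q.swap_mid hPD (by omega)
      omega
    · exact hno D t
  have hdiag : ∀ D ∈ I, 1 ≤ mult P D →
      Diagonal Z m F I a b c d D ∨ Diagonal Z m F I a c b d D := fun D hD hPD => by
    rcases s.diagonal_cases q hD (hne a D hPD (by omega)) (hne b D hPD (by omega))
      (hne c D hPD (by omega)) (hne d D hPD (by omega)) with t | t | t
    · exact Or.inl t
    · exact Or.inr t
    · exact absurd t (hno D)
  obtain ⟨g, h, t, u⟩ : ∃ g h, Diagonal Z m F I a b c d g ∧ Diagonal Z m F I a c b d h := by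
    obtain ⟨D, hD, -, hPD⟩ := s.exists_ne_factor q.ha hP
    obtain ⟨E, hE, hED, hPE⟩ := s.exists_ne_factor hD hP
    rcases hdiag D hD hPD with t | t <;> rcases hdiag E hE hPE with u | u
    · exact absurd (u.unique s q t) hED
    · exact ⟨D, E, t, u⟩
    · exact ⟨E, D, u, t⟩
    · exact absurd (u.unique s q.swap_mid t) hED
  have hgh : g ≠ h := by
    rintro rfl
    obtain ⟨R, -, -, hRa, -, hRg⟩ := t.left
    have := t.sum_eq_zero s q u hRg hRg
    omega
  have hm : m ≤ x g + x h := by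
    have h1 := s.le_mult P hP
    rw [s.mult_eq_sum (J := {g, h}) (by
      simp only [Finset.insert_subset_iff, Finset.singleton_subset_iff]
      exact ⟨t.mem, u.mem⟩) fun D hD hPD => by
        rw [Finset.mem_insert, Finset.mem_singleton]
        exact (hdiag D hD hPD).imp (fun v => v.unique s q t) fun v => v.unique s q.swap_mid u,
      Finset.sum_pair hgh] at h1
    have h2 := Nat.mul_le_mul_left (x g) (s.mult_le_one t.mem P)
    have h3 := Nat.mul_le_mul_left (x h) (s.mult_le_one u.mem P)
    omega
  have htm := t.sum_le s q
  have hum := u.sum_le s q.swap_mid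
  refine s.noConic.not_two_lines (s.isForm_line t.mem) (s.isForm_line u.mem) fun W hW => ?_
  by_contra hWgh
  have hfour : ∀ D ∈ I, 1 ≤ mult W D → D = a ∨ D = b ∨ D = c ∨ D = d := fun D hD hWD => by
    by_contra! hD4
    rcases s.diagonal_cases q hD hD4.1 hD4.2.1 hD4.2.2.1 hD4.2.2.2 with v | v | v
    · exact hWgh (Or.inl (v.unique s q t ▸ hWD))
    · exact hWgh (Or.inr (v.unique s q.swap_mid u ▸ hWD))
    · exact hno D v
  have hab : 1 ≤ mult W a → 1 ≤ mult W b → False := fun h1 h2 => by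
    obtain ⟨R, -, -, hR1, hR2, hRg⟩ := t.left
    exact hWgh (Or.inl (s.eq_of_mem_two q.ha q.hb q.hab hR1 hR2 h1 h2 ▸ hRg))
  have hcd : 1 ≤ mult W c → 1 ≤ mult W d → False := fun h1 h2 => by
    obtain ⟨R, -, -, hR1, hR2, hRg⟩ := t.right
    exact hWgh (Or.inl (s.eq_of_mem_two q.hc q.hd q.hcd hR1 hR2 h1 h2 ▸ hRg))
  have hac : 1 ≤ mult W a → 1 ≤ mult W c → False := fun h1 h2 => by
    obtain ⟨R, -, -, hR1, hR2, hRg⟩ := u.left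
    exact hWgh (Or.inr (s.eq_of_mem_two q.ha q.hc q.hac hR1 hR2 h1 h2 ▸ hRg))
  have hbd : 1 ≤ mult W b → 1 ≤ mult W d → False := fun h1 h2 => by
    obtain ⟨R, -, -, hR1, hR2, hRg⟩ := u.right
    exact hWgh (Or.inr (s.eq_of_mem_two q.hb q.hd q.hbd hR1 hR2 h1 h2 ▸ hRg))
  have had : 1 ≤ mult W a → 1 ≤ mult W d → False := fun h1 h2 => by
    have := hcon W hW h1
    omega
  have hbc : 1 ≤ mult W b → 1 ≤ mult W c → False := fun h1 h2 => by
    have := s.le_add_of_vertex q.swap_first.swap_last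
      (fun v hv => hno v hv.swap) hW h1 h2
    omega
  obtain ⟨D, hD, -, hWD⟩ := s.exists_ne_factor q.ha hW
  obtain ⟨E, hE, hED, hWE⟩ := s.exists_ne_factor hD hW
  rcases hfour D hD hWD with rfl | rfl | rfl | rfl <;>
    rcases hfour E hE hWE with rfl | rfl | rfl | rfl
  exacts [hED rfl, hab hWD hWE, hac hWD hWE, had hWD hWE, hab hWE hWD, hED rfl, hbc hWD hWE,
    hbd hWD hWE, hac hWE hWD, hbc hWE hWD, hED rfl, hcd hWD hWE, had hWE hWD, hbd hWE hWD,
    hcd hWE hWD, hED rfl]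

end Extremal

namespace Extremal

variable {Z : Finset (ℙ ℂ (Fin 3 → ℂ))} {P R O W : ℙ ℂ (Fin 3 → ℂ)} {m k : ℕ}
  {F H a b c d : MvPolynomial (Fin 3) ℂ} {I : Finset (MvPolynomial (Fin 3) ℂ)}
  {x : MvPolynomial (Fin 3) ℂ → ℕ}

/-- If the diagonal joining `a ∩ d` and `b ∩ c` is missing, there are no further lines. -/
lemma eq_of_no_diagonal (s : Extremal Z m k F I x) (q : Quad I a b c d)
    (hno : ∀ g, ¬ Diagonal Z m F I a d b c g) {g : MvPolynomial (Fin 3) ℂ} (hg : g ∈ I) :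
    g = a ∨ g = b ∨ g = c ∨ g = d := by
  obtain ⟨V, hV, hVa, hVd⟩ := s.exists_vertex q hno
  obtain ⟨W, hW, hWb, hWc⟩ := s.exists_vertex q.swap_first.swap_last fun g t => hno g t.swap
  have h1 := s.le_add_of_vertex q hno hV hVa hVd
  have h2 := s.le_add_of_vertex q.swap_first.swap_last (fun g t => hno g t.swap) hW hWb hWc
  have h3 := s.fac.one_le g hg
  by_contra! hne
  rcases s.diagonal_cases q hg hne.1 hne.2.1 hne.2.2.1 hne.2.2.2 with t | t | t
  · have := t.sum_le s q
    omega
  · have := t.sum_le s q.swap_mid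
    omega
  · exact hno g t

/-- A line through three points of `Z` divides a form of low degree. -/
lemma dvd_of_three_points (s : Extremal Z m k F I x) {l : MvPolynomial (Fin 3) ℂ} {e j : ℕ}
    (hl : l ∈ I) (hH : IsForm H e) (he : e < 3 * j) (hPR : P ≠ R) (hPW : P ≠ W) (hRW : R ≠ W)
    (hP : 1 ≤ mult P l) (hR : 1 ≤ mult R l) (hW : 1 ≤ mult W l) (hPH : j ≤ mult P H)
    (hRH : j ≤ mult R H) (hWH : j ≤ mult W H) : l ∣ H := by
  classical
  by_contra hdvd
  have h1 := sum_mult_mul_mult_le {P, R, W} (s.fac.irreducible l hl) (s.isForm_line hl).2 hH.2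
    hdvd
  rw [Finset.sum_insert (by simp [hPR, hPW]), Finset.sum_pair hRW] at h1
  have h2 := Nat.mul_le_mul hP hPH
  have h3 := Nat.mul_le_mul hR hRH
  have h4 := Nat.mul_le_mul hW hWH
  omega

/-- Four lines in general position whose six intersection points lie in `Z`. -/
structure SixPoints (Z : Finset (ℙ ℂ (Fin 3 → ℂ))) (a b c d : MvPolynomial (Fin 3) ℂ) :
    Prop where
  hab : ∃ W ∈ Z, 1 ≤ mult W a ∧ 1 ≤ mult W b
  hac : ∃ W ∈ Z, 1 ≤ mult W a ∧ 1 ≤ mult W c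
  had : ∃ W ∈ Z, 1 ≤ mult W a ∧ 1 ≤ mult W d
  hbc : ∃ W ∈ Z, 1 ≤ mult W b ∧ 1 ≤ mult W c
  hbd : ∃ W ∈ Z, 1 ≤ mult W b ∧ 1 ≤ mult W d
  hcd : ∃ W ∈ Z, 1 ≤ mult W c ∧ 1 ≤ mult W d

lemma dvd_of_vertices (s : Extremal Z m k F I x) (q : Quad I a b c d) {e j : ℕ}
    (hH : IsForm H e) (he : e < 3 * j) (hZH : ∀ P ∈ Z, j ≤ mult P H)
    (hab : ∃ W ∈ Z, 1 ≤ mult W a ∧ 1 ≤ mult W b) (hac : ∃ W ∈ Z, 1 ≤ mult W a ∧ 1 ≤ mult W c)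
    (had : ∃ W ∈ Z, 1 ≤ mult W a ∧ 1 ≤ mult W d) : a ∣ H := by
  obtain ⟨P, hP, hPa, hPb⟩ := hab
  obtain ⟨R, hR, hRa, hRc⟩ := hac
  obtain ⟨W, hW, hWa, hWd⟩ := had
  have h1 := q.le_two P
  have h2 := q.le_two R
  refine s.dvd_of_three_points q.ha hH he (fun h => ?_) (fun h => ?_) (fun h => ?_) hPa hRa hWa
    (hZH P hP) (hZH R hR) (hZH W hW)
  · have : 1 ≤ mult P c := h ▸ hRc
    omega
  · have : 1 ≤ mult P d := h ▸ hWd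
    omega
  · have : 1 ≤ mult R d := h ▸ hWd
    omega

/-- Six points of a complete quadrilateral: odd orders `j` need degree more than `2 * j`. -/
lemma not_form_of_odd (s : Extremal Z m k F I x) (q : Quad I a b c d) (v : SixPoints Z a b c d)
    (hle : ∀ P ∈ Z, mult P a + mult P b + mult P c + mult P d ≤ 2) (t : ℕ) :
    ∀ H e, IsForm H e → e ≤ 2 * (2 * t + 1) → (∀ P ∈ Z, 2 * t + 1 ≤ mult P H) → False := by
  classical
  induction t with
  | zero =>
    intro H e hH he hZH
    obtain ⟨P, hP, h0⟩ := s.noConic (H * a ^ (2 - e)) (by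
      have := hH.mul ((s.isForm_line q.ha).pow (2 - e))
      rwa [show e + (2 - e) * 1 = 2 by omega] at this)
    rw [mult_mul P hH.1 (pow_ne_zero _ (s.isForm_line q.ha).1)] at h0
    have := hZH P hP
    omega
  | succ t ih =>
    intro H e hH he hZH
    have hda := s.dvd_of_vertices q hH (by omega) hZH v.hab v.hac v.had
    have hdb := s.dvd_of_vertices q.swap_first hH (by omega) hZH
      (v.hab.imp fun _ h => ⟨h.1, h.2.2, h.2.1⟩) v.hbc v.hbd
    have hdc := s.dvd_of_vertices q.swap_mid.swap_first hH (by omega) hZH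
      (v.hac.imp fun _ h => ⟨h.1, h.2.2, h.2.1⟩) (v.hbc.imp fun _ h => ⟨h.1, h.2.2, h.2.1⟩) v.hcd
    have hdd := s.dvd_of_vertices q.swap_last.swap_mid.swap_first hH (by omega) hZH
      (v.had.imp fun _ h => ⟨h.1, h.2.2, h.2.1⟩) (v.hbd.imp fun _ h => ⟨h.1, h.2.2, h.2.1⟩)
      (v.hcd.imp fun _ h => ⟨h.1, h.2.2, h.2.1⟩)
    have hI : ({a, b, c, d} : Finset (MvPolynomial (Fin 3) ℂ)) ⊆ I := by
      simp only [Finset.insert_subset_iff, Finset.singleton_subset_iff]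
      exact ⟨q.ha, q.hb, q.hc, q.hd⟩
    obtain ⟨U, hU⟩ : ∏ D ∈ {a, b, c, d}, D ∣ H :=
      Finset.prod_dvd_of_isRelPrime (fun D hD E hE hDE =>
        (s.fac.irreducible D (hI hD)).isRelPrime_iff_not_dvd.mpr fun h =>
          hDE (s.fac.eq_of_dvd D (hI hD) E (hI hE) h)) (fun D hD => by
        simp only [Finset.mem_insert, Finset.mem_singleton] at hD
        rcases hD with rfl | rfl | rfl | rfl
        exacts [hda, hdb, hdc, hdd])
    have hprod : IsForm (∏ D ∈ ({a, b, c, d} : Finset _), D) 4 := by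
      have := isForm_prod {a, b, c, d} (fun D => D) (fun _ => 1) fun D hD =>
        s.isForm_line (hI hD)
      rwa [sum_four q.hab q.hac q.had q.hbc q.hbd q.hcd] at this
    have hUf := (hU ▸ hH).of_mul_right hprod
    have he4 := (hH.totalDegree.symm.trans (congrArg totalDegree hU)).trans
      (hprod.mul hUf).totalDegree
    refine ih U _ hUf (by omega) fun P hP => ?_
    have h1 := hZH P hP
    rw [hU, mult_mul P hprod.1 hUf.1, mult_prod P _ _ fun D hD => (s.isForm_line (hI hD)).1,
      sum_four q.hab q.hac q.had q.hbc q.hbd q.hcd] at h1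
    have h2 := hle P hP
    omega

lemma false_of_no_diagonal (s : Extremal Z m k F I x) (q : Quad I a b c d)
    (hno : ∀ g, ¬ Diagonal Z m F I a d b c g) : False := by
  classical
  have hfour := fun g (hg : g ∈ I) => s.eq_of_no_diagonal q hno hg
  have hno2 : ∀ g, ¬ Diagonal Z m F I a c b d g := fun g t => by
    rcases hfour g t.mem with h | h | h | h
    exacts [t.ne_a h, t.ne_c h, t.ne_b h, t.ne_d h]
  have hno1 : ∀ g, ¬ Diagonal Z m F I a b c d g := fun g t => by
    rcases hfour g t.mem with h | h | h | h
    exacts [t.ne_a h, t.ne_b h, t.ne_c h, t.ne_d h]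
  have hI : ({a, b, c, d} : Finset (MvPolynomial (Fin 3) ℂ)) = I := by
    refine Finset.Subset.antisymm ?_ fun g hg => by simpa using hfour g hg
    simp only [Finset.insert_subset_iff, Finset.singleton_subset_iff]
    exact ⟨q.ha, q.hb, q.hc, q.hd⟩
  have qbc := q.swap_first.swap_last
  have qac := q.swap_last
  have qbd := q.swap_first
  have qab := q.swap_mid.swap_last
  have qcd : Quad I c a b d := q.swap_mid.swap_first
  have nbc : ∀ g, ¬ Diagonal Z m F I b c a d g := fun g t => hno g t.swap
  have nbd : ∀ g, ¬ Diagonal Z m F I b d a c g := fun g t => hno2 g t.swap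
  have ncd : ∀ g, ¬ Diagonal Z m F I c d a b g := fun g t => hno1 g t.swap
  have v : SixPoints Z a b c d := ⟨s.exists_vertex qab hno1, s.exists_vertex qac hno2,
    s.exists_vertex q hno, s.exists_vertex qbc nbc, s.exists_vertex qbd nbd,
    s.exists_vertex qcd ncd⟩
  have hxab : m ≤ x a + x b :=
    let ⟨_, hW, h1, h2⟩ := v.hab
    s.le_add_of_vertex qab hno1 hW h1 h2
  have hxac : m ≤ x a + x c :=
    let ⟨_, hW, h1, h2⟩ := v.hac
    s.le_add_of_vertex qac hno2 hW h1 h2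
  have hxad : m ≤ x a + x d :=
    let ⟨_, hW, h1, h2⟩ := v.had
    s.le_add_of_vertex q hno hW h1 h2
  have hxbc : m ≤ x b + x c :=
    let ⟨_, hW, h1, h2⟩ := v.hbc
    s.le_add_of_vertex qbc nbc hW h1 h2
  have hxbd : m ≤ x b + x d :=
    let ⟨_, hW, h1, h2⟩ := v.hbd
    s.le_add_of_vertex qbd nbd hW h1 h2
  have hxcd : m ≤ x c + x d :=
    let ⟨_, hW, h1, h2⟩ := v.hcd
    s.le_add_of_vertex qcd ncd hW h1 h2
  have hdeg := s.fac.degree_eq s.form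
  rw [← hI, sum_four q.hab q.hac q.had q.hbc q.hbd q.hcd, s.totalDegree_eq_one q.ha,
    s.totalDegree_eq_one q.hb, s.totalDegree_eq_one q.hc, s.totalDegree_eq_one q.hd] at hdeg
  have htwo : ∀ P ∈ Z, mult P a + mult P b + mult P c + mult P d = 2 := fun P hP => by
    obtain ⟨D, hD, -, hPD⟩ := s.exists_ne_factor q.ha hP
    obtain ⟨E, hE, hED, hPE⟩ := s.exists_ne_factor hD hP
    refine le_antisymm (q.le_two P) ?_
    rw [← sum_four q.hab q.hac q.had q.hbc q.hbd q.hcd, hI, ← Finset.add_sum_erase _ _ hD]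
    have := Finset.single_le_sum (f := fun D => mult P D) (fun _ _ => Nat.zero_le _)
      (Finset.mem_erase.mpr ⟨hED, hE⟩)
    omega
  have hprod : IsForm (∏ D ∈ I, D) 4 := by
    have := isForm_prod I (fun D => D) (fun _ => 1) fun D hD => s.isForm_line hD
    rwa [← hI, sum_four q.hab q.hac q.had q.hbc q.hbd q.hcd, hI] at this
  have hlow := s.low (m % 2) (by omega) _ _ (hprod.pow (m / 2)) fun P hP => by
    rw [mult_pow P hprod.1, mult_prod P I _ fun D hD => (s.isForm_line hD).1, ← hI,
      sum_four q.hab q.hac q.had q.hbc q.hbd q.hcd, htwo P hP]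
    omega
  obtain ⟨H, e, hH, he, hZH⟩ := s.pred
  refine s.not_form_of_odd q v (fun P hP => (htwo P hP).le) (m / 2 - 1) H e hH ?_ fun P hP => ?_
  · have := s.one_le
    omega
  · have := s.one_le
    have := hZH P hP
    omega

/-- There is no extremal form. -/
lemma false (s : Extremal Z m k F I x) : False := by
  obtain ⟨a, b, c, d, q⟩ := s.exists_quad
  by_cases h₁ : ∃ g, Diagonal Z m F I a b c d g
  · by_cases h₂ : ∃ g, Diagonal Z m F I a c b d g
    · by_cases h₃ : ∃ g, Diagonal Z m F I a d b c g
      · obtain ⟨g₁, t₁⟩ := h₁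
        obtain ⟨g₂, t₂⟩ := h₂
        obtain ⟨g₃, t₃⟩ := h₃
        exact s.not_three_diagonals q t₁ t₂ t₃
      · exact s.false_of_no_diagonal q (not_exists.mp h₃)
    · exact s.false_of_no_diagonal q.swap_last (not_exists.mp h₂)
  · exact s.false_of_no_diagonal q.swap_mid.swap_last (not_exists.mp h₁)

end Extremal

lemma exists_two_lines_of_card_le {T : Finset (ℙ ℂ (Fin 3 → ℂ))} (hT : T.card ≤ 4) :
    ∃ l k, IsForm l 1 ∧ IsForm k 1 ∧ ∀ P ∈ T, 1 ≤ mult P l + mult P k := by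
  classical
  rcases T.eq_empty_or_nonempty with rfl | ⟨a, ha⟩
  · have hX : IsForm (X 0 : MvPolynomial (Fin 3) ℂ) 1 := ⟨X_ne_zero 0, isHomogeneous_X _ _⟩
    exact ⟨X 0, X 0, hX, hX, by simp⟩
  · have : Nonempty (ℙ ℂ (Fin 3 → ℂ)) := ⟨a⟩
    obtain ⟨b, c, e, h⟩ := exists_three_of_card_le (T := T.erase a) (by
      rw [Finset.card_erase_of_mem ha]
      omega)
    obtain ⟨l, hl, hla, hlb⟩ := exists_line_through a b
    obtain ⟨k, hk, hkc, hke⟩ := exists_line_through c e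
    refine ⟨l, k, hl, hk, fun P hP => ?_⟩
    by_cases hPa : P = a
    · subst hPa
      omega
    · rcases h P (Finset.mem_erase.mpr ⟨hPa, hP⟩) with rfl | rfl | rfl <;> omega

/-- Point sets off all conics have no five consecutive initial degrees with steps two. -/
lemma NoConic.false_of_initial_degrees {Z : Finset (ℙ ℂ (Fin 3 → ℂ))} (hZ : NoConic Z) {m d : ℕ}
    (hm : 1 ≤ m)
    (low : ∀ k ≤ 4, ∀ H e, IsForm H e → (∀ P ∈ Z, m ≤ mult P H + k) → d ≤ e + 2 * k)
    (pred : ∃ H e, IsForm H e ∧ e + 2 ≤ d ∧ ∀ P ∈ Z, m ≤ mult P H + 1)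
    (exists_form : ∃ F, IsForm F d ∧ ∀ P ∈ Z, m ≤ mult P F) : False := by
  classical
  have hex : ∃ e L U n, IsForm L n ∧ IsForm U e ∧ n + e = d ∧
      (∀ C, Irreducible C → C.totalDegree = 2 → ¬ C ∣ L) ∧ ∀ P ∈ Z, m ≤ mult P (L * U) := by
    obtain ⟨F, hF, hZF⟩ := exists_form
    exact ⟨d, 1, F, 0, isForm_one, hF, zero_add d,
      fun C hC _ h => hC.not_isUnit (isUnit_of_dvd_one h), by simpa using hZF⟩
  obtain ⟨L, U, n, hL, hU, hn, hCL, hZF⟩ := Nat.find_spec hex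
  set e := Nat.find hex with he
  have hF : IsForm (L * U) d := hn ▸ hL.mul hU
  obtain ⟨I, x, fac⟩ := hF.exists_isFactorization
  refine Extremal.false (Z := Z) (m := m) (k := d) (F := L * U) (I := I) (x := x)
    ⟨hZ, hm, low, pred, hF, hZF, fac, fun C hC hC2 => ?_⟩
  refine ⟨{P ∈ Z | mult P (L * U) = m ∧ 1 ≤ mult P C}, ?_, fun P hP => by simpa using hP⟩
  by_contra hcard
  have hirr := fac.irreducible C hC
  have hdvd : C ∣ L * U := by
    obtain ⟨V, hV⟩ := fac.exists_eq_prod_mul (J := {C}) (by simpa using hC)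
    rw [Finset.prod_singleton] at hV
    exact ⟨V, hV⟩
  obtain ⟨V, rfl⟩ := (hirr.prime.dvd_or_dvd hdvd).resolve_left (hCL C hirr hC2)
  have hCf : IsForm C 2 := hC2 ▸ fac.isForm hC
  have hV := hU.of_mul_right hCf
  have hdeg := hU.totalDegree.symm.trans (hCf.mul hV).totalDegree
  obtain ⟨l, k, hl, hk, hT⟩ := exists_two_lines_of_card_le (Nat.lt_succ_iff.mp (not_le.mp hcard))
  have hmin := Nat.find_min hex (m := e - 2) (by omega)
  refine hmin ⟨L * (l * k), V, n + (1 + 1), hL.mul (hl.mul hk), hV, by omega, ?_,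
    fun P hP => ?_⟩
  · have hline : ∀ C, Irreducible C → C.totalDegree = 2 → ∀ l, IsForm l 1 → ¬ C ∣ l :=
      fun C _ hC2 l hl h => by
        have := totalDegree_le_of_dvd_of_isDomain h hl.1
        rw [hC2, hl.totalDegree] at this
        omega
    intro D hD hD2 h
    rcases hD.prime.dvd_or_dvd h with h | h
    · exact hCL D hD hD2 h
    · rcases hD.prime.dvd_or_dvd h with h | h
      · exact hline D hD hD2 l hl h
      · exact hline D hD hD2 k hk h
  · have h1 := hZF P hP
    have h2 := hT P
    have h3 : mult P C ≤ 1 := by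
      have hg := fac.genus hC {P}
      rw [Finset.sum_singleton, hC2] at hg
      by_contra hcon
      have h4 : 1 * 1 ≤ mult P C * (mult P C - 1) := Nat.mul_le_mul (by omega) (by omega)
      omega
    rw [Finset.mem_filter] at h2
    rw [mult_mul P hL.1 hU.1, mult_mul P hCf.1 hV.1] at h1 h2
    rw [mult_mul P (hL.mul (hl.mul hk)).1 hV.1, mult_mul P hL.1 (hl.mul hk).1,
      mult_mul P hl.1 hk.1]
    by_cases h5 : 1 ≤ mult P C
    · by_cases h6 : mult P L + (mult P C + mult P V) = m
      · have := h2 ⟨hP, h6, h5⟩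
        omega
      · omega
    · omega

lemma exists_isForm_of_order (Z : Finset (ℙ ℂ (Fin 3 → ℂ))) (m : ℕ) :
    ∃ d F, IsForm F d ∧ ∀ P ∈ Z, m ≤ mult P F := by
  choose l hl hPl _ using fun P : ℙ ℂ (Fin 3 → ℂ) => exists_line_through P P
  refine ⟨_, (∏ P ∈ Z, l P) ^ m, (isForm_prod Z l (fun _ => 1) fun P _ => hl P).pow m,
    fun P hP => ?_⟩
  rw [mult_pow P (isForm_prod Z l (fun _ => 1) fun P _ => hl P).1,
    mult_prod P Z l fun R _ => (hl R).1]
  have h1 : 1 ≤ ∑ R ∈ Z, mult P (l R) :=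
    (hPl P).trans (Finset.single_le_sum (f := fun R => mult P (l R)) (fun _ _ => Nat.zero_le _) hP)
  simpa using Nat.mul_le_mul_left m h1

lemma exists_isForm_initialDegree (Z : Finset (ℙ ℂ (Fin 3 → ℂ))) (m : ℕ) :
    ∃ F, IsForm F (initialDegree (symbolicPower (Z : Set (ℙ ℂ (Fin 3 → ℂ))) m)) ∧
      ∀ P ∈ Z, m ≤ mult P F := by
  obtain ⟨d, F, hF, h⟩ := exists_isForm_of_order Z m
  obtain ⟨G, hG, hG0, hGh⟩ := Nat.sInf_mem (s := {t | ∃ F ∈ symbolicPower (Z : Set _) m,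
    F ≠ 0 ∧ F.IsHomogeneous t}) ⟨d, F, (hF.mem_symbolicPower_iff _ m).mpr h, hF⟩
  have hGf : IsForm G (initialDegree (symbolicPower (Z : Set (ℙ ℂ (Fin 3 → ℂ))) m)) := ⟨hG0, hGh⟩
  exact ⟨G, hGf, (hGf.mem_symbolicPower_iff _ m).mp hG⟩

lemma IsForm.initialDegree_le {Z : Finset (ℙ ℂ (Fin 3 → ℂ))} {m e : ℕ}
    {H : MvPolynomial (Fin 3) ℂ} (hH : IsForm H e) (h : ∀ P ∈ Z, m ≤ mult P H) :
    initialDegree (symbolicPower (Z : Set (ℙ ℂ (Fin 3 → ℂ))) m) ≤ e :=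
  Nat.sInf_le ⟨H, (hH.mem_symbolicPower_iff _ m).mpr h, hH⟩

end PlaneCurve

/-- Theorem B: if the initial sequence of the radical ideal of a finite nonempty planar point
set `Z` has four consecutive first differences equal to `2`, i.e.
`α(I^(m+k)) = α(I^(m)) + 2k` for `k = 1, 2, 3, 4`, then `Z` is contained in a conic. -/
theorem theoremB (Z : Set (ℙ ℂ (Fin 3 → ℂ))) (hfin : Z.Finite) (hne : Z.Nonempty)
    (m : ℕ) (hm : 1 ≤ m)
    (h : ∀ k : ℕ, 1 ≤ k → k ≤ 4 →
      initialDegree (symbolicPower Z (m + k)) = initialDegree (symbolicPower Z m) + 2 * k) :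
    ContainedInConic Z := by
  lift Z to Finset (ℙ ℂ (Fin 3 → ℂ)) using hfin
  by_contra hcon
  have hZ : PlaneCurve.NoConic Z := fun H hH => by
    by_contra! hH0
    exact hcon (hH.containedInConic fun P hP => Nat.one_le_iff_ne_zero.mpr (hH0 P hP))
  have hα : ∀ k ≤ 4, initialDegree (symbolicPower (Z : Set (ℙ ℂ (Fin 3 → ℂ))) (m + k)) =
      initialDegree (symbolicPower (Z : Set (ℙ ℂ (Fin 3 → ℂ))) m) + 2 * k := fun k hk => by
    rcases Nat.eq_zero_or_pos k with rfl | hk0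
    · rfl
    · exact h k hk0 hk
  have h4 := hα 4 le_rfl
  refine hZ.false_of_initial_degrees (m := m + 4)
    (d := initialDegree (symbolicPower (Z : Set (ℙ ℂ (Fin 3 → ℂ))) (m + 4))) (by omega)
    (fun k hk H e hH hZH => ?_) ?_ (PlaneCurve.exists_isForm_initialDegree Z (m + 4))
  · have h1 := hα (4 - k) (by omega)
    have h2 := hH.initialDegree_le (Z := Z) (m := m + (4 - k)) fun P hP => by
      have := hZH P hP
      omega
    omega
  · obtain ⟨H, hH, hZH⟩ := PlaneCurve.exists_isForm_initialDegree Z (m + 3)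
    have h3 := hα 3 (by omega)
    exact ⟨H, _, hH, by omega, fun P hP => by have := hZH P hP; omega⟩
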